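/- Let A be a finitary hereditary abelian category over a finite field and t an odd positive integer. Let L_t(A) be the C-vector space with basis the isomorphism classes [A^•] of t-periodic complexes A^• = (A^i, 0)_{i∈Z_t} with zero differentials, regarded as objects of D_t(A), with multiplication [A_1^•][A_2^•] = ∑_{[X^•], X^• = (X^i,0)} h^{X^•}_{A_1^• A_2^•} · a'_{X^•} / (a'_{A_1^•} a'_{A_2^•}) · [X^•], where h^{X^•}_{A_1^• A_2^•} = ∑_{M^i,N^i,S^i ∈ Iso(A)} ∏_{i∈Z_t} ( g^{A_2^i}_{N^i S^i} · g^{X^i}_{M^i N^i} · g^{A_1^i}_{S^{i+1} M^i} · a_{M^i} a_{N^i} a_{S^i} / ( a_{X^i} · ⟨A_1^i, S^i⟩ · ⟨S^{i+1}, N^i⟩ ) · sqrt( ⟨A_1^i, A_2^i⟩ · ∏_{k=1}^{t-1} ⟨A_1^{i+k}, A_2^i⟩^{(-1)^{k+1}} ) ) and a'_{Y^•} := a_{Y^•} · sqrt( ∏_{i=1}^{t} |Hom_{D_t(A)}(Y^•[i], Y^•)|^{(-1)^i} ). Then this multiplication is associative and L_t(A) is a unital associative algebra with unit the class of the zero complex;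 the associativity is a consequence of Green's formula. -/

import Mathlib

/-!
STATEMENT 4.
For a finitary hereditary abelian category `A` over a finite field and an odd positive
integer `t`, the ℂ-vector space `L_t(A)` with basis the isomorphism classes of `t`-periodic
complexes with zero differentials (encoded by functions `ZMod t → IsoCl A`), equipped with
the multiplication `[A₁][A₂] = ∑ h^{X}_{A₁ A₂} · a'_X / (a'_{A₁} a'_{A₂}) [X]`, is an
associative unital algebra with unit the class of the zero complex.
Here `D_t(A)` is encoded as any localization `L : C_t(A) ⥤ E` at the quasi-isomorphisms,
where `E` carries a shift by `ℤ` compatible with the degree shift of periodic complexes.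
-/

open CategoryTheory CategoryTheory.Limits ZeroObject

noncomputable section

namespace GreenDH

def IsoCl (C : Type*) [Category C] : Type _ := Quotient (CategoryTheory.isIsomorphicSetoid C)

def cl {C : Type*} [Category C] (X : C) : IsoCl C := Quotient.mk _ X

def IsoCl.out {C : Type*} [Category C] (s : IsoCl C) : C := Quotient.out s

def autCard {C : Type*} [Category C] (X : C) : ℕ := Nat.card (Aut X)

def homCard {C : Type*} [Category C] (X Y : C) : ℕ := Nat.card (X ⟶ Y)

def ext1Card {A : Type} [SmallCategory A] [Abelian A] [HasExt.{0} A] (X Y : A) : ℕ :=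
  Nat.card (Abelian.Ext X Y 1)

/-- The multiplicative Euler form `⟨X, Y⟩ = |Hom(X,Y)| / |Ext¹(X,Y)|`. -/
def eulerR {A : Type} [SmallCategory A] [Abelian A] [HasExt.{0} A] (X Y : A) : ℝ :=
  (homCard X Y : ℝ) / (ext1Card X Y : ℝ)

def hall {A : Type} [SmallCategory A] [Abelian A] (a b c : A) : ℕ :=
  Nat.card {S : Subobject c // Nonempty ((S : A) ≅ b) ∧ Nonempty ((cokernel S.arrow) ≅ a)}

def pShape (t : ℕ) : ComplexShape (ZMod t) := ComplexShape.up' (1 : ZMod t)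

abbrev Ct (A : Type) [SmallCategory A] [Abelian A] (t : ℕ) :=
  HomologicalComplex A (pShape t)

/-- The `t`-periodic complex with prescribed components and zero differentials. -/
def mkZero {A : Type} [SmallCategory A] [Abelian A] {t : ℕ} (f : ZMod t → A) : Ct A t where
  X := f
  d _ _ := 0
  shape _ _ _ := rfl
  d_comp_d' := by intros; simp

variable {A : Type} [SmallCategory A] [Abelian A] [HasExt.{0} A] {t : ℕ} [NeZero t]

/-- The structure constants `h^{X}_{A₁ A₂}` of `L_t(A)` (for odd `t`). -/
def hconstR (f g x : ZMod t → IsoCl A) : ℝ :=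
  ∑ᶠ M : ZMod t → IsoCl A, ∑ᶠ N : ZMod t → IsoCl A, ∑ᶠ S : ZMod t → IsoCl A,
    ∏ i : ZMod t,
      ((hall (N i).out (S i).out (g i).out : ℝ) *
        (hall (M i).out (N i).out (x i).out : ℝ) *
        (hall (S (i + 1)).out (M i).out (f i).out : ℝ) *
        ((autCard (M i).out : ℝ) * (autCard (N i).out : ℝ) * (autCard (S i).out : ℝ)) /
        ((autCard (x i).out : ℝ) * eulerR ((f i).out) ((S i).out) *
          eulerR ((S (i + 1)).out) ((N i).out)) *
        Real.sqrt (eulerR ((f i).out) ((g i).out) *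
          ∏ k ∈ Finset.Icc 1 (t - 1),
            (eulerR ((f (i + (k : ZMod t))).out) ((g i).out)) ^ ((-1 : ℤ) ^ (k + 1))))

variable (E : Type*) [Category E] [HasShift E ℤ] (L : Ct A t ⥤ E)

/-- `a'_{Y^•} = a_{Y^•} · √(∏_{i=1}^{t} |Hom_{D_t(A)}(Y^•[i], Y^•)|^{(-1)^i})`,
for the `t`-periodic complex with zero differentials and components `f`. -/
def aprimeR (f : ZMod t → IsoCl A) : ℝ :=
  (autCard (L.obj (mkZero (fun i => (f i).out))) : ℝ) *
    Real.sqrt (∏ i ∈ Finset.Icc 1 t,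
      (Nat.card ((L.obj (mkZero (fun j => (f j).out)))⟦(i : ℤ)⟧ ⟶
          L.obj (mkZero (fun j => (f j).out))) : ℝ) ^ ((-1 : ℤ) ^ i))

/-- The basis element `[A^•]` of `L_t(A)`. -/
def deltaT (f : ZMod t → IsoCl A) : (ZMod t → IsoCl A) → ℂ :=
  open scoped Classical in fun x => if x = f then 1 else 0

/-- The multiplication of `L_t(A)`, extended bilinearly from the basis. -/
def mulLt (u v : (ZMod t → IsoCl A) → ℂ) : (ZMod t → IsoCl A) → ℂ :=
  fun x => ∑ᶠ f : ZMod t → IsoCl A, ∑ᶠ g : ZMod t → IsoCl A,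
    u f * v g *
      (((hconstR f g x * aprimeR E L x / (aprimeR E L f * aprimeR E L g) : ℝ)) : ℂ)

section Realization

open DerivedCategory Pretriangulated


lemma exists_shortExact_of_ext {𝓐 : Type} [SmallCategory 𝓐] [Abelian 𝓐] [HasExt.{0} 𝓐]
    {X Y : 𝓐} (α : Abelian.Ext X Y 1) :
    ∃ (Z : 𝓐) (i : Y ⟶ Z) (p : Z ⟶ X) (w : i ≫ p = 0)
      (h : (ShortComplex.mk i p w).ShortExact), h.extClass = α := by
  let := HasDerivedCategory.standard 𝓐
  obtain ⟨Z', f, g, hT⟩ := distinguished_cocone_triangle₂ (X := (singleFunctor 𝓐 0).obj Y) (α.hom)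
  have hX0 : ∀ (n : ℤ) (_ : n ≠ 0) (W : 𝓐), IsZero ((homologyFunctor 𝓐 n).obj ((singleFunctor 𝓐 0).obj W)) := by
    intro n hn W
    rcases lt_or_gt_of_ne hn with h | h
    · exact isZero_of_isGE _ 0 n h
    · exact isZero_of_isLE _ 0 n h
  have hZ : ∀ (n : ℤ) (_ : n ≠ 0), IsZero ((homologyFunctor 𝓐 n).obj Z') := by
    intro n hn
    exact (HomologySequence.exact₂ _ hT n).isZero_of_both_zeros
      ((hX0 n hn Y).eq_of_src _ _) ((hX0 n hn X).eq_of_tgt _ _)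
  have : Z'.IsGE 0 := (isGE_iff _ _).2 (fun i hi => hZ i hi.ne)
  have : Z'.IsLE 0 := (isLE_iff _ _).2 (fun i hi => hZ i hi.ne')
  obtain ⟨Z, ⟨e⟩⟩ := exists_iso_singleFunctor_obj_of_isGE_of_isLE Z' 0
  obtain ⟨i, hi⟩ := (singleFunctor 𝓐 0).map_surjective (f ≫ e.hom)
  obtain ⟨p, hp⟩ := (singleFunctor 𝓐 0).map_surjective (e.inv ≫ g)
  let T : Triangle (DerivedCategory 𝓐) := Triangle.mk ((singleFunctor 𝓐 0).map i) ((singleFunctor 𝓐 0).map p) α.hom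
  have hT' : T ∈ distTriang _ := by
    refine isomorphic_distinguished _ hT _ (Triangle.isoMk _ _ (Iso.refl _) e.symm (Iso.refl _) ?_ ?_ ?_)
    · change (singleFunctor 𝓐 0).map i ≫ e.inv = 𝟙 _ ≫ f
      rw [hi, Category.assoc, e.hom_inv_id, Category.comp_id, Category.id_comp]
    · change (singleFunctor 𝓐 0).map p ≫ 𝟙 _ = e.inv ≫ g
      rw [hp, Category.comp_id]
    · change α.hom ≫ (shiftFunctor (DerivedCategory 𝓐) (1 : ℤ)).map (𝟙 _) = 𝟙 _ ≫ α.hom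
      rw [CategoryTheory.Functor.map_id, Category.id_comp]
      exact Category.comp_id _
  have w : i ≫ p = 0 := by
    apply (singleFunctor 𝓐 0).map_injective
    rw [Functor.map_comp, Functor.map_zero]
    exact comp_distTriang_mor_zero₁₂ T hT'
  have hse : (ShortComplex.mk i p w).ShortExact := by
    let S : ShortComplex 𝓐 := ShortComplex.mk ((homologyFunctor 𝓐 0).map T.mor₁) ((homologyFunctor 𝓐 0).map T.mor₂)
      (by simp only [← Functor.map_comp, comp_distTriang_mor_zero₁₂ _ hT', Functor.map_zero])
    have hS : S.ShortExact := by
      have h1 : Mono S.f := (HomologySequence.mono_homologyMap_mor₁_iff T hT' (-1) 0).2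
        ((hX0 (-1) (by decide) X).eq_of_src _ _)
      have h2 : Epi S.g := (HomologySequence.epi_homologyMap_mor₂_iff T hT' 0 1).2
        ((hX0 1 (by decide) Y).eq_of_tgt _ _)
      exact { exact := HomologySequence.exact₂ _ hT' 0 }
    refine ShortComplex.shortExact_of_iso (ShortComplex.isoMk
      ((singleFunctorCompHomologyFunctorIso 𝓐 0).app Y)
      ((singleFunctorCompHomologyFunctorIso 𝓐 0).app Z)
      ((singleFunctorCompHomologyFunctorIso 𝓐 0).app X) ?_ ?_) hS
    · exact ((singleFunctorCompHomologyFunctorIso 𝓐 0).hom.naturality i).symm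
    · exact ((singleFunctorCompHomologyFunctorIso 𝓐 0).hom.naturality p).symm
  -- compare the two triangles
  have hcomm : T.mor₁ ≫ 𝟙 _ = 𝟙 _ ≫ hse.singleTriangle.mor₁ := by
    change (singleFunctor 𝓐 0).map i ≫ 𝟙 _ = 𝟙 _ ≫ (singleFunctor 𝓐 0).map i
    rw [Category.id_comp, Category.comp_id]
  obtain ⟨c, hc1, hc2⟩ := complete_distinguished_triangle_morphism T hse.singleTriangle hT'
    hse.singleTriangle_distinguished (𝟙 _) (𝟙 _) hcomm
  obtain ⟨c', rfl⟩ := (singleFunctor 𝓐 0).map_surjective c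
  have hp' : p ≫ c' = p := by
    apply (singleFunctor 𝓐 0).map_injective
    rw [Functor.map_comp]
    exact hc1.trans (Category.id_comp _)
  have : c' = 𝟙 _ := by
    have := hse.epi_g
    rw [← cancel_epi p]; simpa using hp'
  subst this
  refine ⟨Z, i, p, w, hse, ?_⟩
  apply Abelian.Ext.ext
  rw [hse.extClass_hom]
  have h3 : α.hom ≫ (shiftFunctor (DerivedCategory 𝓐) (1 : ℤ)).map (𝟙 _) =
    (singleFunctor 𝓐 0).map (𝟙 X) ≫ hse.singleδ := hc2
  rw [CategoryTheory.Functor.map_id, CategoryTheory.Functor.map_id, Category.id_comp] at h3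
  exact h3.symm.trans (Category.comp_id _)

end Realization

section SES

variable {𝓐 : Type} [SmallCategory 𝓐] [Abelian 𝓐]

/-- `b ⟶ c ⟶ a` is a short exact sequence. -/
def IsSES {b c a : 𝓐} (i : b ⟶ c) (p : c ⟶ a) : Prop :=
  ∃ w : i ≫ p = 0, (ShortComplex.mk i p w).ShortExact

namespace IsSES

variable {b c a : 𝓐} {i : b ⟶ c} {p : c ⟶ a}

lemma w (h : IsSES i p) : i ≫ p = 0 := h.choose

lemma se (h : IsSES i p) : (ShortComplex.mk i p h.w).ShortExact := h.choose_spec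

lemma mono (h : IsSES i p) : Mono i := h.se.mono_f

lemma epi (h : IsSES i p) : Epi p := h.se.epi_g

lemma lift (h : IsSES i p) {W : 𝓐} (k : W ⟶ c) (hk : k ≫ p = 0) : ∃ l : W ⟶ b, l ≫ i = k := by
  have := h.mono
  exact ⟨h.se.exact.lift k hk, h.se.exact.lift_f k hk⟩

lemma desc (h : IsSES i p) {W : 𝓐} (k : c ⟶ W) (hk : i ≫ k = 0) : ∃ l : a ⟶ W, p ≫ l = k := by
  have := h.epi
  exact ⟨h.se.exact.desc k hk, h.se.exact.g_desc k hk⟩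

lemma mk_of_refine (w : i ≫ p = 0) (hm : ∀ {W : 𝓐} (k : W ⟶ b), k ≫ i = 0 → k = 0)
    (he : ∀ {W : 𝓐} (k : W ⟶ a), ∃ (W' : 𝓐) (π : W' ⟶ W) (_ : Epi π) (l : W' ⟶ c), π ≫ k = l ≫ p)
    (hx : ∀ {W : 𝓐} (k : W ⟶ c), k ≫ p = 0 →
      ∃ (W' : 𝓐) (π : W' ⟶ W) (_ : Epi π) (l : W' ⟶ b), π ≫ k = l ≫ i) : IsSES i p := by
  refine ⟨w, ?_⟩
  have hm' : Mono i := Preadditive.mono_of_cancel_zero _ (fun k hk => hm k hk)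
  have he' : Epi p := by
    rw [epi_iff_surjective_up_to_refinements]
    intro W k
    obtain ⟨W', π, h, l, hl⟩ := he k
    exact ⟨W', π, h, l, hl⟩
  have hxx : (ShortComplex.mk i p w).Exact := by
    rw [ShortComplex.exact_iff_exact_up_to_refinements]
    intro W k hk
    obtain ⟨W', π, h, l, hl⟩ := hx k hk
    exact ⟨W', π, h, l, hl⟩
  exact { exact := hxx }

/-- epimorphisms can be lifted against after refinement -/
lemma refine_epi {X Y : 𝓐} (q : X ⟶ Y) (hq : Epi q) {W : 𝓐} (k : W ⟶ Y) :
    ∃ (W' : 𝓐) (π : W' ⟶ W) (_ : Epi π) (l : W' ⟶ X), π ≫ k = l ≫ q := by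
  obtain ⟨W', π, h, l, hl⟩ := surjective_up_to_refinements_of_epi q k
  exact ⟨W', π, h, l, hl⟩

lemma comp_iso (h : IsSES i p) {c' : 𝓐} (e : c ≅ c') : IsSES (i ≫ e.hom) (e.inv ≫ p) := by
  refine ⟨by simp [h.w], ?_⟩
  have e' : ShortComplex.mk i p h.w ≅ ShortComplex.mk (i ≫ e.hom) (e.inv ≫ p) (by simp [h.w]) :=
    ShortComplex.isoMk (Iso.refl _) e (Iso.refl _) (by simp) (by simp)
  exact ShortComplex.shortExact_of_iso e' h.se

lemma iso_left (h : IsSES i p) {b' : 𝓐} (e : b' ≅ b) : IsSES (e.hom ≫ i) p := by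
  refine ⟨by simp [h.w], ?_⟩
  have e' : ShortComplex.mk i p h.w ≅ ShortComplex.mk (e.hom ≫ i) p (by simp [h.w]) :=
    ShortComplex.isoMk e.symm (Iso.refl _) (Iso.refl _) (by simp) (by simp)
  exact ShortComplex.shortExact_of_iso e' h.se

lemma iso_right (h : IsSES i p) {a' : 𝓐} (e : a ≅ a') : IsSES i (p ≫ e.hom) := by
  refine ⟨by simp [reassoc_of% h.w], ?_⟩
  have e' : ShortComplex.mk i p h.w ≅ ShortComplex.mk i (p ≫ e.hom) (by simp [reassoc_of% h.w]) :=
    ShortComplex.isoMk (Iso.refl _) (Iso.refl _) e (by simp) (by simp)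
  exact ShortComplex.shortExact_of_iso e' h.se

lemma of_mono (i : b ⟶ c) [Mono i] : IsSES i (cokernel.π i) :=
  ⟨by simp, { exact := ShortComplex.exact_of_g_is_cokernel _ (cokernelIsCokernel i) }⟩

lemma of_epi (p : c ⟶ a) [Epi p] : IsSES (kernel.ι p) p :=
  ⟨by simp, { exact := ShortComplex.exact_of_f_is_kernel _ (kernelIsKernel p) }⟩

variable [HasExt.{0} 𝓐]

/-- The class of a short exact sequence. -/
def cls (h : IsSES i p) : Abelian.Ext a b 1 := h.se.extClass

end IsSES

variable [HasExt.{0} 𝓐]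

open Abelian

lemma exists_isSES {X Y : 𝓐} (α : Ext X Y 1) :
    ∃ (Z : 𝓐) (i : Y ⟶ Z) (p : Z ⟶ X) (h : IsSES i p), h.cls = α := by
  obtain ⟨Z, i, p, w, h, hα⟩ := exists_shortExact_of_ext α
  exact ⟨Z, i, p, ⟨w, h⟩, hα⟩

/-- naturality of the class with respect to morphisms of short exact sequences -/
lemma cls_naturality {D Y C D' E Q : 𝓐} {d : D ⟶ Y} {c : Y ⟶ C} {ι : D' ⟶ E} {q : E ⟶ Q}
    (h₁ : IsSES d c) (h₂ : IsSES ι q) (l : D ⟶ D') (y : Y ⟶ E) (k : C ⟶ Q)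
    (hl : d ≫ y = l ≫ ι) (hy : y ≫ q = c ≫ k) :
    h₁.cls.comp (Ext.mk₀ l) (add_zero 1) = (Ext.mk₀ k).comp h₂.cls (zero_add 1) :=
  ShortComplex.ShortExact.extClass_naturality h₁.se h₂.se
    (ShortComplex.homMk l y k hl.symm hy)

lemma lift_iff {D Y C E Q : 𝓐} {d : D ⟶ Y} {c : Y ⟶ C} {ι : D ⟶ E} {q : E ⟶ Q}
    (h₁ : IsSES d c) (h₂ : IsSES ι q) (k : C ⟶ Q) :
    (∃ y : Y ⟶ E, d ≫ y = ι ∧ y ≫ q = c ≫ k) ↔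
      (Ext.mk₀ k).comp h₂.cls (zero_add 1) = h₁.cls := by
  constructor
  · rintro ⟨y, hy1, hy2⟩
    have := cls_naturality h₁ h₂ (𝟙 D) y k (by simpa using hy1) hy2
    rw [← this, Ext.comp_mk₀_id]
  · intro hk
    obtain ⟨y₀', hy₀'⟩ := Ext.contravariant_sequence_exact₁ h₁.se E (Ext.mk₀ ι) (add_zero 1) (by
      change h₁.cls.comp _ _ = 0
      rw [← hk, Ext.comp_assoc _ _ _ (zero_add 1) (add_zero 1) (by rfl)]
      have : h₂.cls.comp (Ext.mk₀ ι) (add_zero 1) = 0 := h₂.se.extClass_comp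
      rw [this, Ext.comp_zero])
    obtain ⟨y₀, rfl⟩ := Ext.homEquiv₀.symm.surjective y₀'
    have hy₀ : d ≫ y₀ = ι := by
      apply Ext.homEquiv₀.symm.injective
      change Ext.mk₀ _ = Ext.mk₀ _
      rw [← hy₀']
      exact (Ext.mk₀_comp_mk₀ _ _).symm
    obtain ⟨k₀, hk₀⟩ := h₁.desc (y₀ ≫ q) (by rw [reassoc_of% hy₀, h₂.w])
    have hn := cls_naturality h₁ h₂ (𝟙 D) y₀ k₀ (by simpa using hy₀) hk₀.symm
    rw [Ext.comp_mk₀_id] at hn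
    have hz : (Ext.mk₀ (k - k₀)).comp h₂.cls (zero_add 1) = 0 := by
      rw [sub_eq_add_neg, Ext.mk₀_add, Ext.mk₀_neg, Ext.add_comp, Ext.neg_comp, hk, hn, add_neg_cancel]
    obtain ⟨l', hl'⟩ := Ext.covariant_sequence_exact₃ C h₂.se (Ext.mk₀ (k - k₀)) (zero_add 1) hz
    obtain ⟨l, rfl⟩ := Ext.homEquiv₀.symm.surjective l'
    have hl : l ≫ q = k - k₀ := by
      apply Ext.homEquiv₀.symm.injective
      change Ext.mk₀ _ = Ext.mk₀ _
      rw [← hl']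
      exact (Ext.mk₀_comp_mk₀ _ _).symm
    refine ⟨y₀ + c ≫ l, ?_, ?_⟩
    · rw [Preadditive.comp_add, reassoc_of% h₁.w, hy₀]; simp
    · rw [Preadditive.add_comp, Category.assoc, hl, ← hk₀]; simp

/-- Number of lifts. -/
lemma card_lift {D Y C E Q : 𝓐} {d : D ⟶ Y} {c : Y ⟶ C} {ι : D ⟶ E} {q : E ⟶ Q}
    (h₁ : IsSES d c) (h₂ : IsSES ι q) (k : C ⟶ Q) (hk : (Ext.mk₀ k).comp h₂.cls (zero_add 1) = h₁.cls) :
    Nat.card {y : Y ⟶ E // d ≫ y = ι ∧ y ≫ q = c ≫ k} = Nat.card (C ⟶ D) := by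
  obtain ⟨y₀, hy₀, hy₀'⟩ := (lift_iff h₁ h₂ k).2 hk
  have := h₁.epi
  have := h₂.mono
  symm
  refine Nat.card_congr (Equiv.ofBijective
    (fun g => ⟨y₀ + c ≫ g ≫ ι, by simp [hy₀, reassoc_of% h₁.w], by simp [hy₀', h₂.w]⟩) ⟨?_, ?_⟩)
  · intro g g' hg
    have := congrArg Subtype.val hg
    simpa [cancel_epi, cancel_mono] using this
  · rintro ⟨y, hy, hy'⟩
    obtain ⟨m, hm⟩ := h₂.lift (y - y₀) (by simp [hy', hy₀'])
    obtain ⟨g, hg⟩ := h₁.desc m (by rw [← cancel_mono ι]; simp [hm, hy, hy₀])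
    refine ⟨g, ?_⟩
    apply Subtype.ext
    simp [reassoc_of% hg, hm]

lemma isIso_of_lift {D Y C E : 𝓐} {d : D ⟶ Y} {c : Y ⟶ C} {ι : D ⟶ E} {q : E ⟶ C}
    (h₁ : IsSES d c) (h₂ : IsSES ι q) (y : Y ⟶ E) (h : d ≫ y = ι) (h' : y ≫ q = c) : IsIso y := by
  let φ : ShortComplex.mk d c h₁.w ⟶ ShortComplex.mk ι q h₂.w :=
    ShortComplex.homMk (𝟙 D) y (𝟙 C) (by simpa using h.symm) (by simpa using h')
  have : IsIso φ.τ₁ := inferInstanceAs (IsIso (𝟙 D))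
  have : IsIso φ.τ₃ := inferInstanceAs (IsIso (𝟙 C))
  exact ShortComplex.isIso₂_of_shortExact_of_isIso₁₃ φ h₁.se h₂.se

end SES

set_option linter.unusedSectionVars false

section Counting

open scoped ENNReal

universe u v w

/-- cardinality in `ℝ≥0∞` -/
def cc (α : Type u) : ℝ≥0∞ := ∑' _ : α, 1

lemma cc_congr {α : Type u} {β : Type v} (e : α ≃ β) : cc α = cc β :=
  e.tsum_eq (fun _ => (1 : ℝ≥0∞))

lemma cc_sigma {α : Type u} (β : α → Type v) : cc (Σ a, β a) = ∑' a, cc (β a) :=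
  ENNReal.tsum_sigma (fun _ _ => (1 : ℝ≥0∞))

lemma cc_prod (α : Type u) (β : Type v) : cc (α × β) = cc α * cc β := by
  rw [cc_congr (Equiv.sigmaEquivProd α β).symm, cc_sigma]
  change _ = (∑' _ : α, 1) * _
  rw [← ENNReal.tsum_mul_right]
  simp

lemma cc_eq (α : Type u) [Finite α] : cc α = (Nat.card α : ℝ≥0∞) := by
  have := Fintype.ofFinite α
  rw [cc, tsum_fintype]
  simp

lemma tsum_const_cc (α : Type u) (c : ℝ≥0∞) : ∑' _ : α, c = cc α * c := by
  rw [cc, ← ENNReal.tsum_mul_right]; simp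

lemma cc_pos (α : Type u) [Nonempty α] : cc α ≠ 0 := by
  rw [cc, ne_eq, ENNReal.tsum_eq_zero]
  simp

lemma cc_ne_top (α : Type u) [Finite α] : cc α ≠ ⊤ := by
  rw [cc_eq]; exact ENNReal.natCast_ne_top _

lemma cc_fiber {α : Type u} {β : Type v} (f : α → β) : cc α = ∑' b, cc {a // f a = b} := by
  rw [cc_congr (Equiv.sigmaFiberEquiv f).symm, cc_sigma]

lemma cc_subtype_of_unique {α : Type u} {p : α → Prop} (a : α) (ha : p a) (hu : ∀ b, p b → b = a) :
    cc {a // p a} = 1 := by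
  have : Unique {a // p a} := ⟨⟨⟨a, ha⟩⟩, fun b => Subtype.ext (hu _ b.2)⟩
  rw [cc]; simp

lemma cc_empty {α : Type u} (h : IsEmpty α) : cc α = 0 := by
  rw [cc]; simp

/-- double counting with weights -/
lemma tsum_subtype_comm {α : Type u} {β : Type v} (r : α → β → Prop) (F : α → β → ℝ≥0∞) :
    ∑' a, ∑' b : {b // r a b}, F a b = ∑' b, ∑' a : {a // r a b}, F a b := by
  classical
  have h1 : ∀ a, ∑' b : {b // r a b}, F a b = ∑' b, if r a b then F a b else 0 := by
    intro a
    rw [show (∑' b : {b // r a b}, F a b) = ∑' b : ({b | r a b} : Set β), F a b from rfl,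
      tsum_subtype ({b | r a b}) (F a)]
    rfl
  have h2 : ∀ b, ∑' a : {a // r a b}, F a b = ∑' a, if r a b then F a b else 0 := by
    intro b
    rw [show (∑' a : {a // r a b}, F a b) = ∑' a : ({a | r a b} : Set α), F a b from rfl,
      tsum_subtype ({a | r a b}) (fun a => F a b)]
    rfl
  simp_rw [h1, h2]
  exact ENNReal.tsum_comm

end Counting

section Ses

open scoped ENNReal

variable {𝓐 : Type} [SmallCategory 𝓐] [Abelian 𝓐]

lemma out_iso (X : 𝓐) : Nonempty ((cl X).out ≅ X) :=
  Quotient.exact (Quotient.out_eq (cl X))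

lemma cl_eq_iff {X Y : 𝓐} : cl X = cl Y ↔ Nonempty (X ≅ Y) := by
  constructor
  · intro h; exact Quotient.exact h
  · intro h; exact Quotient.sound h

lemma cl_out (s : IsoCl 𝓐) : cl s.out = s := Quotient.out_eq s

lemma out_cl_eq {s : IsoCl 𝓐} {X : 𝓐} (h : Nonempty (X ≅ s.out)) : s = cl X := by
  rw [← cl_out s]; exact (cl_eq_iff.2 h).symm

/-- number of automorphisms -/
def aE (X : 𝓐) : ℝ≥0∞ := cc (X ≅ X)

lemma cc_iso_eq {X Y : 𝓐} (e : X ≅ Y) : cc (X ≅ Y) = aE Y :=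
  cc_congr ⟨fun f => e.symm ≪≫ f, fun f => e ≪≫ f, fun f => by ext; simp, fun f => by ext; simp⟩

lemma aE_congr {X Y : 𝓐} (e : X ≅ Y) : aE X = aE Y := by
  rw [← cc_iso_eq e]
  exact cc_congr ⟨fun f => f ≪≫ e, fun f => f ≪≫ e.symm, fun f => by ext; simp, fun f => by ext; simp⟩

lemma aE_pos (X : 𝓐) : aE X ≠ 0 :=
  have : Nonempty (X ≅ X) := ⟨Iso.refl X⟩
  cc_pos _

variable [hF : ∀ X Y : 𝓐, Finite (X ⟶ Y)]

instance finite_iso (X Y : 𝓐) : Finite (X ≅ Y) :=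
  Finite.of_injective (fun e => e.hom) (fun _ _ h => Iso.ext h)

lemma aE_top (X : 𝓐) : aE X ≠ ⊤ := cc_ne_top _

lemma aE_eq (X : 𝓐) : aE X = (autCard X : ℝ≥0∞) := cc_eq _

/-- torsor lemma -/
lemma tsum_torsor (X : 𝓐) : ∑' s : IsoCl 𝓐, cc (X ≅ s.out) / aE s.out = 1 := by
  rw [tsum_eq_single (cl X)]
  · obtain ⟨e⟩ := out_iso X
    rw [cc_iso_eq e.symm]
    exact ENNReal.div_self (aE_pos _) (aE_top _)
  · intro s hs
    rw [cc_empty, ENNReal.zero_div]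
    constructor
    intro e
    exact hs (out_cl_eq ⟨e⟩)

/-- short exact sequences with prescribed objects -/
abbrev Ses (b c a : 𝓐) := {s : (b ⟶ c) × (c ⟶ a) // IsSES s.1 s.2}

lemma IsSES.mk_of_lift {b c a : 𝓐} {i : b ⟶ c} {p : c ⟶ a} (w : i ≫ p = 0) (hm : Mono i) (he : Epi p)
    (hx : ∀ {W : 𝓐} (k : W ⟶ c), k ≫ p = 0 → ∃ (l : W ⟶ b), l ≫ i = k) : IsSES i p := by
  refine IsSES.mk_of_refine w ?_ ?_ ?_
  · intro W k hk
    rwa [← cancel_mono i, zero_comp]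
  · intro W k
    exact IsSES.refine_epi p he k
  · intro W k hk
    obtain ⟨l, hl⟩ := hx k hk
    exact ⟨W, 𝟙 W, inferInstance, l, by simp [hl]⟩

lemma IsSES.mk_of_desc {b c a : 𝓐} {i : b ⟶ c} {p : c ⟶ a} (w : i ≫ p = 0) (hm : Mono i) (he : Epi p)
    (hx : ∀ {W : 𝓐} (k : c ⟶ W), i ≫ k = 0 → ∃ (l : a ⟶ W), p ≫ l = k) : IsSES i p := by
  refine IsSES.mk_of_lift w hm he ?_
  intro W k hk
  obtain ⟨l, hl⟩ := hx (cokernel.π i) (by simp)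
  exact (IsSES.of_mono i).lift k (by rw [← hl, reassoc_of% hk, zero_comp])

/-- two short exact sequences with the same middle term and same kernel -/
lemma IsSES.unique {b b' c a a' : 𝓐} {i : b ⟶ c} {p : c ⟶ a} {i' : b' ⟶ c} {p' : c ⟶ a'}
    (h : IsSES i p) (h' : IsSES i' p') (h1 : i ≫ p' = 0) (h2 : i' ≫ p = 0) :
    ∃ (eb : b ≅ b') (ea : a ≅ a'), eb.inv ≫ i = i' ∧ p ≫ ea.hom = p' := by
  have := h.mono
  have := h'.mono
  have := h.epi
  have := h'.epi
  obtain ⟨x, hx⟩ := h'.lift i h1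
  obtain ⟨y, hy⟩ := h.lift i' h2
  obtain ⟨x', hx'⟩ := h.desc p' h1
  obtain ⟨y', hy'⟩ := h'.desc p h2
  refine ⟨⟨x, y, ?_, ?_⟩, ⟨x', y', ?_, ?_⟩, hy, hx'⟩
  · rw [← cancel_mono i]; simp [hx, hy]
  · rw [← cancel_mono i']; simp [hx, hy]
  · rw [← cancel_epi p]; simp [reassoc_of% hx', hy']
  · rw [← cancel_epi p']; simp [reassoc_of% hy', hx']

lemma cc_ses (b c a : 𝓐) : cc (Ses b c a) = (hall a b c : ℝ≥0∞) * aE a * aE b := by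
  have key : cc (Ses b c a) =
      cc (Σ S : {S : Subobject c // Nonempty ((S : 𝓐) ≅ b) ∧ Nonempty ((cokernel S.arrow) ≅ a)},
        ((S.1 : 𝓐) ≅ b) × ((cokernel S.1.arrow) ≅ a)) := by
    symm
    refine cc_congr (Equiv.ofBijective (fun x => ⟨(x.2.1.inv ≫ x.1.1.arrow, cokernel.π _ ≫ x.2.2.hom),
      ((IsSES.of_mono x.1.1.arrow).iso_left x.2.1.symm).iso_right x.2.2⟩) ⟨?_, ?_⟩)
    · rintro ⟨⟨S, hS⟩, e, e'⟩ ⟨⟨T, hT⟩, f, f'⟩ h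
      have h := congrArg Subtype.val h
      simp only [Prod.mk.injEq] at h
      obtain ⟨h1, h2⟩ := h
      have hST : S = T := by
        have : S.arrow = (e.hom ≫ f.inv) ≫ T.arrow := by simp [← h1]
        apply le_antisymm
        · exact Subobject.le_of_comm _ this.symm
        · refine Subobject.le_of_comm (f.hom ≫ e.inv) ?_
          simp [h1]
      subst hST
      have he : e = f := by
        have : e.inv = f.inv := (cancel_mono S.arrow).1 h1
        exact Iso.ext_inv this
      have he' : e' = f' := Iso.ext ((cancel_epi (cokernel.π S.arrow)).1 h2)
      subst he; subst he'; rfl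
    · rintro ⟨⟨i, p⟩, h⟩
      have := h.mono
      have hs : IsSES (Subobject.mk i).arrow (cokernel.π (Subobject.mk i).arrow) := IsSES.of_mono _
      obtain ⟨eb, ea, h1, h2⟩ := hs.unique h
        (by rw [← cancel_epi (Subobject.underlyingIso i).inv]; simp [h.w])
        (by
          have h3 := Subobject.underlyingIso_arrow i
          have h4 : i = (Subobject.underlyingIso i).inv ≫ (Subobject.mk i).arrow := h3.symm
          change i ≫ _ = 0
          rw [← Subobject.underlyingIso_arrow_assoc i, cokernel.condition, comp_zero])
      exact ⟨⟨⟨Subobject.mk i, ⟨eb⟩, ⟨ea⟩⟩, eb, ea⟩, Subtype.ext (Prod.ext h1 h2)⟩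
  have hfin : Finite {S : Subobject c // Nonempty ((S : 𝓐) ≅ b) ∧ Nonempty ((cokernel S.arrow) ≅ a)} := by
    refine Finite.of_injective (β := (b ⟶ c)) (fun S => S.2.1.some.inv ≫ S.1.arrow) ?_
    rintro ⟨S, hS⟩ ⟨T, hT⟩ h
    simp only at h
    apply Subtype.ext
    simp only
    apply le_antisymm
    · exact Subobject.le_of_comm (hS.1.some.hom ≫ hT.1.some.inv) (by simp [← h])
    · exact Subobject.le_of_comm (hT.1.some.hom ≫ hS.1.some.inv) (by simp [h])
  rw [key, cc_sigma]
  have : ∀ S : {S : Subobject c // Nonempty ((S : 𝓐) ≅ b) ∧ Nonempty ((cokernel S.arrow) ≅ a)},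
      cc (((S.1 : 𝓐) ≅ b) × ((cokernel S.1.arrow) ≅ a)) = aE a * aE b := by
    rintro ⟨S, ⟨e⟩, ⟨e'⟩⟩
    rw [cc_prod, cc_iso_eq e, cc_iso_eq e', mul_comm]
  simp_rw [this]
  rw [tsum_const_cc, cc_eq, hall, mul_assoc]

end Ses

set_option linter.unusedSectionVars false

section SixTerm

lemma card_ker_range {G H : Type*} [AddCommGroup G] [AddCommGroup H] (f : G →+ H) :
    Nat.card f.ker * Nat.card f.range = Nat.card G := by
  rw [← AddSubgroup.index_ker, AddSubgroup.card_mul_index]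

lemma card_ker_of_exact {G H K : Type*} [AddCommGroup G] [AddCommGroup H] [AddCommGroup K]
    (f : G →+ H) (g : H →+ K) (h : ∀ x, g x = 0 ↔ ∃ y, f y = x) : Nat.card g.ker = Nat.card f.range := by
  have : g.ker = f.range := by
    ext x
    rw [AddMonoidHom.mem_ker, AddMonoidHom.mem_range, h]
  rw [this]

lemma six_term {G1 G2 G3 G4 G5 G6 : Type*} [AddCommGroup G1] [AddCommGroup G2] [AddCommGroup G3]
    [AddCommGroup G4] [AddCommGroup G5] [AddCommGroup G6]
    (f1 : G1 →+ G2) (f2 : G2 →+ G3) (f3 : G3 →+ G4) (f4 : G4 →+ G5) (f5 : G5 →+ G6)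
    (h1 : Function.Injective f1) (h2 : ∀ x, f2 x = 0 ↔ ∃ y, f1 y = x)
    (h3 : ∀ x, f3 x = 0 ↔ ∃ y, f2 y = x) (h4 : ∀ x, f4 x = 0 ↔ ∃ y, f3 y = x)
    (h5 : ∀ x, f5 x = 0 ↔ ∃ y, f4 y = x) (h6 : Function.Surjective f5) :
    Nat.card G1 * Nat.card G3 * Nat.card G5 = Nat.card G2 * Nat.card G4 * Nat.card G6 := by
  have e1 : Nat.card f1.range = Nat.card G1 :=
    (Nat.card_congr (AddMonoidHom.ofInjective h1).toEquiv).symm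
  have e6 : Nat.card f5.range = Nat.card G6 := by
    rw [AddMonoidHom.range_eq_top.2 h6]
    exact Nat.card_congr AddSubgroup.topEquiv.toEquiv
  rw [← card_ker_range f2, ← card_ker_range f3, ← card_ker_range f4, ← card_ker_range f5,
    card_ker_of_exact _ _ h2, card_ker_of_exact _ _ h3, card_ker_of_exact _ _ h4,
    card_ker_of_exact _ _ h5, e1, e6]
  ring

end SixTerm

section Euler

open Abelian

open scoped NNReal ENNReal

variable {𝓐 : Type} [SmallCategory 𝓐] [Abelian 𝓐] [HasExt.{0} 𝓐]
variable [hF : ∀ X Y : 𝓐, Finite (X ⟶ Y)] [hFE : ∀ X Y : 𝓐, Finite (Ext X Y 1)]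

/-- Euler form in `ℝ≥0`. -/
def eN (X Y : 𝓐) : ℝ≥0 := (Nat.card (X ⟶ Y) : ℝ≥0) / (Nat.card (Ext X Y 1) : ℝ≥0)

/-- automorphism number in `ℝ≥0`. -/
def aN (X : 𝓐) : ℝ≥0 := (autCard X : ℝ≥0)

lemma eN_coe (X Y : 𝓐) : ((eN X Y : ℝ≥0) : ℝ) = eulerR X Y := by
  simp [eN, eulerR, homCard, ext1Card]

lemma natCard_hom_ne (X Y : 𝓐) : (Nat.card (X ⟶ Y) : ℝ≥0) ≠ 0 := by
  have : Nat.card (X ⟶ Y) ≠ 0 := Nat.card_ne_zero.2 ⟨⟨0⟩, inferInstance⟩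
  exact_mod_cast this

lemma natCard_ext_ne (X Y : 𝓐) : (Nat.card (Ext X Y 1) : ℝ≥0) ≠ 0 := by
  have : Nat.card (Ext X Y 1) ≠ 0 := Nat.card_ne_zero.2 ⟨⟨0⟩, inferInstance⟩
  exact_mod_cast this

lemma eN_ne (X Y : 𝓐) : eN X Y ≠ 0 := div_ne_zero (natCard_hom_ne X Y) (natCard_ext_ne X Y)

lemma aE_coe (X : 𝓐) : aE X = (aN X : ℝ≥0∞) := by
  rw [aE_eq, aN]; simp

lemma aN_ne (X : 𝓐) : aN X ≠ 0 := by
  have := aE_pos X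
  rw [aE_coe] at this
  exact_mod_cast this

variable [hH : ∀ X Y : 𝓐, Subsingleton (Ext X Y 2)]

lemma ext_card_zero (X Y : 𝓐) : Nat.card (Ext X Y 0) = Nat.card (X ⟶ Y) :=
  Nat.card_congr Ext.homEquiv₀

lemma ext_surj_left {b c a : 𝓐} {i : b ⟶ c} {p : c ⟶ a} (h : IsSES i p) (Z : 𝓐) (x : Ext b Z 1) :
    ∃ y : Ext c Z 1, (Ext.mk₀ i).comp y (zero_add 1) = x :=
  Ext.contravariant_sequence_exact₁ h.se Z x (n₁ := 2) (by rfl) (Subsingleton.elim _ _)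

lemma eN_left {b c a : 𝓐} {i : b ⟶ c} {p : c ⟶ a} (h : IsSES i p) (Z : 𝓐) :
    eN c Z = eN a Z * eN b Z := by
  have hp : Epi p := h.epi
  have key := six_term ((Ext.mk₀ p).precomp Z (zero_add 0)) ((Ext.mk₀ i).precomp Z (zero_add 0))
    (h.cls.precomp Z (add_zero 1)) ((Ext.mk₀ p).precomp Z (zero_add 1))
    ((Ext.mk₀ i).precomp Z (zero_add 1)) (Ext.precomp_mk₀_injective_of_epi Z p)
    (fun x => ⟨fun hx => Ext.contravariant_sequence_exact₂ h.se Z x hx, by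
      rintro ⟨y, rfl⟩
      change (Ext.mk₀ i).comp ((Ext.mk₀ p).comp y (zero_add 0)) (zero_add 0) = 0
      rw [Ext.mk₀_comp_mk₀_assoc, h.w]; simp⟩)
    (fun x => ⟨fun hx => Ext.contravariant_sequence_exact₁ h.se Z x (add_zero 1) hx, by
      rintro ⟨y, rfl⟩
      exact h.se.extClass_comp_assoc y (h := add_zero 1)⟩)
    (fun x => ⟨fun hx => Ext.contravariant_sequence_exact₃ h.se Z x hx (add_zero 1), by
      rintro ⟨y, rfl⟩
      exact h.se.comp_extClass_assoc y (add_zero 1)⟩)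
    (fun x => ⟨fun hx => Ext.contravariant_sequence_exact₂ h.se Z x hx, by
      rintro ⟨y, rfl⟩
      change (Ext.mk₀ i).comp ((Ext.mk₀ p).comp y (zero_add 1)) (zero_add 1) = 0
      rw [Ext.mk₀_comp_mk₀_assoc, h.w]; simp⟩)
    (fun x => ext_surj_left h Z x)
  simp only [ext_card_zero] at key
  have h1 := natCard_ext_ne a Z
  have h2 := natCard_ext_ne b Z
  have h3 := natCard_ext_ne c Z
  have key' : (Nat.card (a ⟶ Z) * Nat.card (b ⟶ Z) * Nat.card (Ext c Z 1) : ℝ≥0) =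
    Nat.card (c ⟶ Z) * Nat.card (Ext a Z 1) * Nat.card (Ext b Z 1) := by exact_mod_cast key
  rw [eN, eN, eN]
  field_simp
  rw [mul_assoc] at key' ⊢
  rw [← mul_assoc, ← key']
  ring

lemma eN_right {b c a : 𝓐} {i : b ⟶ c} {p : c ⟶ a} (h : IsSES i p) (Z : 𝓐) :
    eN Z c = eN Z a * eN Z b := by
  have hp : Mono i := h.mono
  have key := six_term ((Ext.mk₀ i).postcomp Z (add_zero 0)) ((Ext.mk₀ p).postcomp Z (add_zero 0))
    (h.cls.postcomp Z (zero_add 1)) ((Ext.mk₀ i).postcomp Z (add_zero 1))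
    ((Ext.mk₀ p).postcomp Z (add_zero 1)) (Ext.postcomp_mk₀_injective_of_mono Z i)
    (fun x => ⟨fun hx => Ext.covariant_sequence_exact₂ Z h.se x hx, by
      rintro ⟨y, rfl⟩
      change (y.comp (Ext.mk₀ i) (add_zero 0)).comp (Ext.mk₀ p) (add_zero 0) = 0
      rw [Ext.comp_assoc_of_third_deg_zero, Ext.mk₀_comp_mk₀, h.w]; simp⟩)
    (fun x => ⟨fun hx => Ext.covariant_sequence_exact₃ Z h.se x (zero_add 1) hx, by
      rintro ⟨y, rfl⟩
      change (y.comp (Ext.mk₀ p) (add_zero 0)).comp (h.se.extClass) (zero_add 1) = 0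
      rw [Ext.comp_assoc_of_second_deg_zero, h.se.comp_extClass]; simp⟩)
    (fun x => ⟨fun hx => Ext.covariant_sequence_exact₁ Z h.se x hx (zero_add 1), by
      rintro ⟨y, rfl⟩
      change (y.comp (h.se.extClass) (zero_add 1)).comp (Ext.mk₀ i) (add_zero 1) = 0
      rw [Ext.comp_assoc_of_third_deg_zero, h.se.extClass_comp]; simp⟩)
    (fun x => ⟨fun hx => Ext.covariant_sequence_exact₂ Z h.se x hx, by
      rintro ⟨y, rfl⟩
      change (y.comp (Ext.mk₀ i) (add_zero 1)).comp (Ext.mk₀ p) (add_zero 1) = 0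
      rw [Ext.comp_assoc_of_third_deg_zero, Ext.mk₀_comp_mk₀, h.w]; simp⟩)
    (fun x => Ext.covariant_sequence_exact₃ Z h.se x (n₁ := 2) rfl (Subsingleton.elim _ _))
  simp only [ext_card_zero] at key
  have h1 := natCard_ext_ne Z a
  have h2 := natCard_ext_ne Z b
  have h3 := natCard_ext_ne Z c
  have key' : (Nat.card (Z ⟶ b) * Nat.card (Z ⟶ a) * Nat.card (Ext Z c 1) : ℝ≥0) =
    Nat.card (Z ⟶ c) * Nat.card (Ext Z b 1) * Nat.card (Ext Z a 1) := by exact_mod_cast key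
  rw [eN, eN, eN]
  field_simp
  rw [mul_right_comm, ← key']
  ring

end Euler

section Riedtmann

open Abelian

open scoped NNReal ENNReal

variable {𝓐 : Type} [SmallCategory 𝓐] [Abelian 𝓐] [HasExt.{0} 𝓐]
variable [hF : ∀ X Y : 𝓐, Finite (X ⟶ Y)]

lemma cc_hom_ne (X Y : 𝓐) : cc (X ⟶ Y) ≠ 0 := cc_pos _

lemma riedtmann {X Y : 𝓐} (ξ : Ext X Y 1) :
    ∑' E : IsoCl 𝓐, cc {s : Ses Y E.out X // s.2.cls = ξ} / aE E.out = (cc (X ⟶ Y))⁻¹ := by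
  obtain ⟨E₀, i₀, p₀, h₀, hξ⟩ := exists_isSES ξ
  have key : ∀ E : 𝓐, cc (E₀ ≅ E) = cc (X ⟶ Y) * cc {s : Ses Y E X // s.2.cls = ξ} := by
    intro E
    have hcls : ∀ e : E₀ ≅ E, (h₀.comp_iso e).cls = ξ := by
      intro e
      have := (lift_iff h₀ (h₀.comp_iso e) (𝟙 X)).1 ⟨e.hom, rfl, by simp⟩
      rw [Ext.mk₀_id_comp] at this
      rw [this, hξ]
    let F : (E₀ ≅ E) → {s : Ses Y E X // s.2.cls = ξ} := fun e =>
      ⟨⟨(i₀ ≫ e.hom, e.inv ≫ p₀), h₀.comp_iso e⟩, hcls e⟩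
    rw [cc_fiber F, mul_comm, ← tsum_const_cc]
    congr 1
    funext s
    obtain ⟨⟨⟨i, p⟩, h⟩, hs⟩ := s
    have hl := card_lift h₀ h (𝟙 X) (by rw [Ext.mk₀_id_comp, hs, hξ])
    rw [cc_eq, cc_eq, ← hl]
    congr 1
    refine Nat.card_congr ⟨fun e => ⟨e.1.hom, ?_⟩,
      fun y => ⟨@asIso _ _ _ _ y.1 (isIso_of_lift h₀ h y.1 y.2.1 (by simpa using y.2.2)), ?_⟩, ?_, ?_⟩
    · have := congrArg (fun z => z.1.1) e.2
      simp only [F, Prod.mk.injEq] at this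
      refine ⟨this.1, ?_⟩
      have h2 : e.1.inv ≫ p₀ = p := this.2
      change e.1.hom ≫ p = _
      rw [Iso.inv_comp_eq] at h2
      rw [← h2]; simp
    · simp only [F, asIso_hom, asIso_inv]
      apply Subtype.ext; apply Subtype.ext
      refine Prod.ext y.2.1 ?_
      simp only
      rw [IsIso.inv_comp_eq]
      simpa using y.2.2.symm
    · intro e; apply Subtype.ext; ext; simp
    · intro e; apply Subtype.ext; simp
  have h1 := tsum_torsor E₀
  simp_rw [key, mul_div_assoc] at h1
  rw [ENNReal.tsum_mul_left] at h1
  exact ENNReal.eq_inv_of_mul_eq_one_left (by rw [mul_comm]; exact h1)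

end Riedtmann

set_option linter.unusedSectionVars false

section DoubleCount

open scoped ENNReal

/-- subtypes of sigma types -/
def sigSub {J : Type*} {Q : J → Type*} (R : ∀ j, Q j → Prop) :
    (Σ j, {r : Q j // R j r}) ≃ {y : Σ j, Q j // R y.1 y.2} where
  toFun x := ⟨⟨x.1, x.2.1⟩, x.2.2⟩
  invFun y := ⟨y.1.1, ⟨y.1.2, y.2⟩⟩
  left_inv _ := rfl
  right_inv _ := rfl

lemma double_count {I J : Type*} (P : I → Type*) (Q : J → Type*) (wI : I → ℝ≥0∞) (wJ : J → ℝ≥0∞)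
    (cJ : J → ℝ≥0∞) (R : ∀ i j, P i → Q j → Prop)
    (h1 : ∀ i (l : P i), ∑' j, cc {r : Q j // R i j l r} * wJ j = 1)
    (h2 : ∀ j (r : Q j), ∑' i, cc {l : P i // R i j l r} * wI i = cJ j) :
    ∑' i, cc (P i) * wI i = ∑' j, cc (Q j) * (wJ j * cJ j) := by
  have e1 : ∑' i, cc (P i) * wI i = ∑' x : (Σ i, P i), ∑' y : {y : Σ j, Q j // R x.1 y.1 x.2 y.2},
      wI x.1 * wJ y.1.1 := by
    rw [ENNReal.tsum_sigma']
    congr 1; funext i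
    rw [← tsum_const_cc]
    congr 1; funext l
    simp only
    rw [ENNReal.tsum_mul_left]
    have : ∑' y : {y : Σ j, Q j // R i y.1 l y.2}, wJ y.1.1 = 1 := by
      rw [← h1 i l, ← (sigSub (fun j r => R i j l r)).tsum_eq, ENNReal.tsum_sigma']
      congr 1; funext j
      rw [← tsum_const_cc]
      rfl
    rw [this, mul_one]
  have e2 : ∑' j, cc (Q j) * (wJ j * cJ j) =
      ∑' y : (Σ j, Q j), ∑' x : {x : Σ i, P i // R x.1 y.1 x.2 y.2}, wI x.1.1 * wJ y.1 := by
    rw [ENNReal.tsum_sigma']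
    congr 1; funext j
    rw [← tsum_const_cc]
    congr 1; funext r
    simp only
    rw [ENNReal.tsum_mul_right]
    have : ∑' x : {x : Σ i, P i // R x.1 j x.2 r}, wI x.1.1 = cJ j := by
      rw [← h2 j r, ← (sigSub (fun i l => R i j l r)).tsum_eq, ENNReal.tsum_sigma']
      congr 1; funext i
      rw [← tsum_const_cc]
      rfl
    rw [this, mul_comm]
  rw [e1, e2]
  exact tsum_subtype_comm (fun (x : Σ i, P i) (y : Σ j, Q j) => R x.1 y.1 x.2 y.2)
    (fun x y => wI x.1 * wJ y.1)

end DoubleCount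

section HallAssoc

open scoped ENNReal

variable {𝓐 : Type} [SmallCategory 𝓐] [Abelian 𝓐]
variable [hF : ∀ X Y : 𝓐, Finite (X ⟶ Y)]

lemma tsum_torsor' {G : IsoCl 𝓐 → Type} (X : 𝓐) (F : ∀ s : IsoCl 𝓐, (X ≅ s.out) → G s)
    (hFb : ∀ s, Function.Bijective (F s)) : ∑' s : IsoCl 𝓐, cc (G s) * (aE s.out)⁻¹ = 1 := by
  rw [← tsum_torsor X]
  congr 1; funext s
  rw [div_eq_mul_inv, cc_congr (Equiv.ofBijective _ (hFb s))]

lemma hall_assoc_ses (F S A B : 𝓐) :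
    ∑' M : IsoCl 𝓐, cc (Ses M.out F S × Ses B M.out A) * (aE M.out)⁻¹ =
    ∑' M : IsoCl 𝓐, cc (Ses B F M.out × Ses A M.out S) * (aE M.out)⁻¹ := by
  have := double_count (fun M : IsoCl 𝓐 => Ses M.out F S × Ses B M.out A)
    (fun M : IsoCl 𝓐 => Ses B F M.out × Ses A M.out S) (fun M => (aE M.out)⁻¹)
    (fun M => (aE M.out)⁻¹) (fun _ => 1)
    (fun M M' l r => l.2.1.1 ≫ l.1.1.1 = r.1.1.1 ∧ r.1.1.2 ≫ r.2.1.2 = l.1.1.2 ∧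
      l.1.1.1 ≫ r.1.1.2 = l.2.1.2 ≫ r.2.1.1) ?_ ?_
  · simpa using this
  · rintro M ⟨⟨⟨m, s⟩, h1⟩, ⟨⟨j, a⟩, h2⟩⟩
    simp only at h1 h2
    have := h1.mono
    have := h1.epi
    have := h2.mono
    have := h2.epi
    obtain ⟨M', q, hq⟩ : ∃ (M' : 𝓐) (q : F ⟶ M'), IsSES (j ≫ m) q := ⟨_, _, IsSES.of_mono _⟩
    have := hq.epi
    obtain ⟨a', ha'⟩ := h2.desc (m ≫ q) (by rw [← Category.assoc]; exact hq.w)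
    obtain ⟨s', hs'⟩ := hq.desc s (by simp [h1.w])
    have hs : IsSES a' s' := by
      refine IsSES.mk_of_refine ?_ ?_ ?_ ?_
      · rw [← cancel_epi a, reassoc_of% ha', hs', h1.w, comp_zero]
      · intro W k hk
        obtain ⟨W', π, hπ, l, hl⟩ := IsSES.refine_epi a inferInstance k
        obtain ⟨n, hn⟩ := hq.lift (l ≫ m) (by
          rw [Category.assoc, ← ha', ← reassoc_of% hl, hk, comp_zero])
        have : l = n ≫ j := by rw [← cancel_mono m]; simp [hn]
        rw [← cancel_epi π, hl, this, Category.assoc, h2.w]; simp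
      · intro W k
        refine IsSES.refine_epi s' ?_ k
        exact epi_of_epi_fac hs'
      · intro W k hk
        obtain ⟨W', π, hπ, l, hl⟩ := IsSES.refine_epi q inferInstance k
        obtain ⟨n, hn⟩ := h1.lift l (by
          rw [← hs', ← reassoc_of% hl, hk, comp_zero])
        refine ⟨W', π, hπ, n ≫ a, ?_⟩
        rw [hl, Category.assoc, ha', reassoc_of% hn]
    refine tsum_torsor' M' (fun M'' e => ⟨⟨⟨(j ≫ m, q ≫ e.hom), hq.iso_right e⟩,
      ⟨(a' ≫ e.hom, e.inv ≫ s'), hs.comp_iso e⟩⟩, by simp, by simp [hs'], by simp [reassoc_of% ha']⟩) ?_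
    intro M''
    constructor
    · intro e e' he
      have := congrArg (fun z => z.1.1.1.2) he
      ext
      exact (cancel_epi q).1 this
    · rintro ⟨⟨⟨⟨b₁, q₁⟩, h₁⟩, ⟨⟨a₁, s₁⟩, h₁'⟩⟩, hb, hs, ha⟩
      simp only at hb hs ha h₁ h₁'
      subst hb
      obtain ⟨-, e, -, he⟩ := hq.unique h₁ h₁.w hq.w
      have := h₁.epi
      refine ⟨e, ?_⟩
      apply Subtype.ext
      refine Prod.ext (Subtype.ext (Prod.ext rfl he)) (Subtype.ext (Prod.ext ?_ ?_))
      · change a' ≫ e.hom = a₁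
        rw [← cancel_epi a, reassoc_of% ha', he, ha]
      · change e.inv ≫ s' = s₁
        rw [Iso.inv_comp_eq, ← cancel_epi q, reassoc_of% he, hs', hs]
  · rintro M' ⟨⟨⟨b, q⟩, h1⟩, ⟨⟨a', s'⟩, h2⟩⟩
    simp only at h1 h2
    have := h1.mono
    have := h1.epi
    have := h2.mono
    have := h2.epi
    obtain ⟨M, m, hm⟩ : ∃ (M : 𝓐) (m : M ⟶ F), IsSES m (q ≫ s') := ⟨_, _, IsSES.of_epi _⟩
    have := hm.mono
    obtain ⟨a, ha⟩ := h2.lift (m ≫ q) (by rw [Category.assoc]; exact hm.w)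
    obtain ⟨j, hj⟩ := hm.lift b (by simp [reassoc_of% h1.w])
    have hs : IsSES j a := by
      refine IsSES.mk_of_refine ?_ ?_ ?_ ?_
      · rw [← cancel_mono a', Category.assoc, ha, reassoc_of% hj, h1.w, zero_comp]
      · intro W k hk
        rw [← cancel_mono b, ← hj, reassoc_of% hk]; simp
      · intro W k
        obtain ⟨W', π, hπ, l, hl⟩ := IsSES.refine_epi q inferInstance (k ≫ a')
        obtain ⟨n, hn⟩ := hm.lift l (by rw [← reassoc_of% hl, h2.w]; simp)
        refine ⟨W', π, hπ, n, ?_⟩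
        rw [← cancel_mono a', Category.assoc, hl, ← hn, Category.assoc, Category.assoc, ha]
      · intro W k hk
        obtain ⟨n, hn⟩ := h1.lift (k ≫ m) (by rw [Category.assoc, ← ha, reassoc_of% hk, zero_comp])
        refine ⟨W, 𝟙 W, inferInstance, n, ?_⟩
        rw [← cancel_mono m]; simp [hj, hn]
    refine tsum_torsor' M (fun M'' e => ⟨⟨⟨(e.inv ≫ m, q ≫ s'), hm.iso_left e.symm⟩,
      ⟨(j ≫ e.hom, e.inv ≫ a), hs.comp_iso e⟩⟩, by simp [hj], by simp, by simp [ha]⟩) ?_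
    intro M''
    constructor
    · intro e e' he
      have := congrArg (fun z => z.1.1.1.1) he
      exact Iso.ext_inv ((cancel_mono m).1 this)
    · rintro ⟨⟨⟨⟨m₁, s₁⟩, h₁⟩, ⟨⟨j₁, a₁⟩, h₁'⟩⟩, hb, hs, ha₁⟩
      simp only at hb hs ha₁ h₁ h₁'
      subst hs
      obtain ⟨e, -, he, -⟩ := hm.unique h₁ hm.w h₁.w
      have := h₁.mono
      refine ⟨e, ?_⟩
      apply Subtype.ext
      refine Prod.ext (Subtype.ext (Prod.ext he rfl)) (Subtype.ext (Prod.ext ?_ ?_))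
      · change j ≫ e.hom = j₁
        rw [← cancel_mono m₁, ← he, Category.assoc, e.hom_inv_id_assoc, hj, he, hb]
      · change e.inv ≫ a = a₁
        rw [← cancel_mono a', Category.assoc, ha, reassoc_of% he, ha₁]

/-- associativity of Hall numbers -/
lemma hall_assoc (F S A B : 𝓐) :
    ∑' M : IsoCl 𝓐, (hall S M.out F : ℝ≥0∞) * (hall A B M.out : ℝ≥0∞) =
    ∑' M : IsoCl 𝓐, (hall M.out B F : ℝ≥0∞) * (hall S A M.out : ℝ≥0∞) := by
  have h := hall_assoc_ses F S A B
  simp_rw [cc_prod, cc_ses] at h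
  have hc : aE S * aE A * aE B ≠ 0 := mul_ne_zero (mul_ne_zero (aE_pos _) (aE_pos _)) (aE_pos _)
  have hc' : aE S * aE A * aE B ≠ ⊤ :=
    ENNReal.mul_ne_top (ENNReal.mul_ne_top (aE_top _) (aE_top _)) (aE_top _)
  have h1 : ∀ M : IsoCl 𝓐, aE M.out * (aE M.out)⁻¹ = 1 :=
    fun M => ENNReal.mul_inv_cancel (aE_pos _) (aE_top _)
  rw [← ENNReal.mul_right_inj hc hc', ← ENNReal.tsum_mul_left, ← ENNReal.tsum_mul_left]
  convert h using 3 with M M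
  · trans (↑(hall S M.out F) * aE S * (↑(hall A B M.out) * aE A * aE B)) * (aE M.out * (aE M.out)⁻¹)
    · rw [h1]; ring
    · ring
  · trans (↑(hall M.out B F) * aE B * (↑(hall S A M.out) * aE S * aE A)) * (aE M.out * (aE M.out)⁻¹)
    · rw [h1]; ring
    · ring

end HallAssoc

set_option linter.unusedSectionVars false

section Green

open scoped ENNReal NNReal
open Abelian

variable {𝓐 : Type} [SmallCategory 𝓐] [Abelian 𝓐]
variable [hF : ∀ X Y : 𝓐, Finite (X ⟶ Y)]

lemma tsum_torsor4 {G : (IsoCl 𝓐 × IsoCl 𝓐 × IsoCl 𝓐 × IsoCl 𝓐) → Type} (A₀ B₀ C₀ D₀ : 𝓐)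
    (F : ∀ s : (IsoCl 𝓐 × IsoCl 𝓐 × IsoCl 𝓐 × IsoCl 𝓐),
      (A₀ ≅ s.1.out) × (B₀ ≅ s.2.1.out) × (C₀ ≅ s.2.2.1.out) × (D₀ ≅ s.2.2.2.out) → G s)
    (hFb : ∀ s, Function.Bijective (F s)) :
    ∑' s, cc (G s) * ((aE s.1.out)⁻¹ * (aE s.2.1.out)⁻¹ * (aE s.2.2.1.out)⁻¹ * (aE s.2.2.2.out)⁻¹) = 1 := by
  have : ∀ s, cc (G s) * ((aE s.1.out)⁻¹ * (aE s.2.1.out)⁻¹ * (aE s.2.2.1.out)⁻¹ * (aE s.2.2.2.out)⁻¹)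
      = (cc (A₀ ≅ s.1.out) / aE s.1.out) * ((cc (B₀ ≅ s.2.1.out) / aE s.2.1.out) *
        ((cc (C₀ ≅ s.2.2.1.out) / aE s.2.2.1.out) * (cc (D₀ ≅ s.2.2.2.out) / aE s.2.2.2.out))) := by
    intro s
    rw [← cc_congr (Equiv.ofBijective _ (hFb s)), cc_prod, cc_prod, cc_prod]
    simp only [div_eq_mul_inv]
    ring
  simp_rw [this]
  simp only [ENNReal.tsum_prod', ENNReal.tsum_mul_left, tsum_torsor, mul_one]

/-- crosses -/
abbrev Cross (X Y U V E : 𝓐) := Ses Y E X × Ses V E U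

/-- frames -/
abbrev Frame (X Y U V A B C D : 𝓐) := (Ses D Y C × Ses D V B) × (Ses B X A × Ses C U A)

/-- compatibility of a cross and a frame -/
def GCompat {X Y U V E A B C D : 𝓐} (κ : Cross X Y U V E) (φ : Frame X Y U V A B C D) : Prop :=
  φ.1.1.1.1 ≫ κ.1.1.1 = φ.1.2.1.1 ≫ κ.2.1.1 ∧ κ.1.1.1 ≫ κ.2.1.2 = φ.1.1.1.2 ≫ φ.2.2.1.1 ∧
  κ.2.1.1 ≫ κ.1.1.2 = φ.1.2.1.2 ≫ φ.2.1.1.1 ∧ κ.1.1.2 ≫ φ.2.1.1.2 = κ.2.1.2 ≫ φ.2.2.1.2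

lemma green_frames {X Y U V E : 𝓐} (κ : Cross X Y U V E) :
    ∑' s : (IsoCl 𝓐 × IsoCl 𝓐 × IsoCl 𝓐 × IsoCl 𝓐),
      cc {φ : Frame X Y U V s.1.out s.2.1.out s.2.2.1.out s.2.2.2.out // GCompat κ φ} *
      ((aE s.1.out)⁻¹ * (aE s.2.1.out)⁻¹ * (aE s.2.2.1.out)⁻¹ * (aE s.2.2.2.out)⁻¹) = 1 := by
  obtain ⟨⟨⟨y, x⟩, hx⟩, ⟨⟨v, u⟩, hu⟩⟩ := κ
  simp only at hx hu
  have := hx.mono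
  have := hx.epi
  have := hu.mono
  have := hu.epi
  obtain ⟨C, c, γ, hc, hγ, hcγ⟩ : ∃ (C : 𝓐) (c : Y ⟶ C) (γ : C ⟶ U), Epi c ∧ Mono γ ∧ c ≫ γ = y ≫ u :=
    ⟨_, factorThruImage (y ≫ u), image.ι _, inferInstance, inferInstance, image.fac _⟩
  obtain ⟨B, b, β, hb, hβ, hbβ⟩ : ∃ (B : 𝓐) (b : V ⟶ B) (β : B ⟶ X), Epi b ∧ Mono β ∧ b ≫ β = v ≫ x :=
    ⟨_, factorThruImage (v ≫ x), image.ι _, inferInstance, inferInstance, image.fac _⟩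
  obtain ⟨D, d, hd⟩ : ∃ (D : 𝓐) (d : D ⟶ Y), IsSES d c := ⟨_, _, IsSES.of_epi c⟩
  obtain ⟨A, α, hα⟩ : ∃ (A : 𝓐) (α : X ⟶ A), IsSES β α := ⟨_, _, IsSES.of_mono β⟩
  have := hd.mono
  have := hα.epi
  obtain ⟨d', hd'⟩ := hu.lift (d ≫ y) (by rw [Category.assoc, ← hcγ, reassoc_of% hd.w, zero_comp])
  obtain ⟨α', hα'⟩ := hu.desc (x ≫ α) (by rw [← Category.assoc, ← hbβ, Category.assoc, hα.w, comp_zero])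
  have hd'b : IsSES d' b := by
    refine IsSES.mk_of_lift ?_ ?_ hb ?_
    · rw [← cancel_mono β, Category.assoc, hbβ, reassoc_of% hd', hx.w]; simp
    · have : Mono (d' ≫ v) := by rw [hd']; infer_instance
      exact mono_of_mono d' v
    · intro W k hk
      obtain ⟨l, hl⟩ := hx.lift (k ≫ v) (by rw [Category.assoc, ← hbβ, reassoc_of% hk, zero_comp])
      obtain ⟨m, hm⟩ := hd.lift l (by
        rw [← cancel_mono γ, Category.assoc, hcγ, reassoc_of% hl, hu.w]; simp)
      exact ⟨m, by rw [← cancel_mono v, Category.assoc, hd', reassoc_of% hm, hl]⟩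
  have hγα' : IsSES γ α' := by
    refine IsSES.mk_of_desc ?_ hγ ?_ ?_
    · rw [← cancel_epi c, reassoc_of% hcγ, hα', reassoc_of% hx.w]; simp
    · have : Epi (u ≫ α') := by rw [hα']; infer_instance
      exact epi_of_epi u α'
    · intro W k hk
      obtain ⟨l, hl⟩ := hx.desc (u ≫ k) (by rw [← Category.assoc, ← hcγ, Category.assoc, hk, comp_zero])
      obtain ⟨m, hm⟩ := hα.desc l (by
        rw [← cancel_epi b, reassoc_of% hbβ, hl, reassoc_of% hu.w]; simp)
      exact ⟨m, by rw [← cancel_epi u, reassoc_of% hα', hm, hl]⟩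
  refine tsum_torsor4 A B C D (fun s e =>
    ⟨⟨⟨⟨(e.2.2.2.inv ≫ d, c ≫ e.2.2.1.hom), (hd.iso_left e.2.2.2.symm).iso_right e.2.2.1⟩,
      ⟨(e.2.2.2.inv ≫ d', b ≫ e.2.1.hom), (hd'b.iso_left e.2.2.2.symm).iso_right e.2.1⟩⟩,
      ⟨⟨(e.2.1.inv ≫ β, α ≫ e.1.hom), (hα.iso_left e.2.1.symm).iso_right e.1⟩,
      ⟨(e.2.2.1.inv ≫ γ, α' ≫ e.1.hom), (hγα'.iso_left e.2.2.1.symm).iso_right e.1⟩⟩⟩,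
      by simp [hd'], by simp [hcγ], by simp [hbβ], by simp [reassoc_of% hα']⟩) ?_
  intro s
  constructor
  · rintro ⟨eA, eB, eC, eD⟩ ⟨fA, fB, fC, fD⟩ h
    have h1 : eD.inv ≫ d = fD.inv ≫ d := congrArg (fun z => z.1.1.1.1.1) h
    have h2 : c ≫ eC.hom = c ≫ fC.hom := congrArg (fun z => z.1.1.1.1.2) h
    have h3 : b ≫ eB.hom = b ≫ fB.hom := congrArg (fun z => z.1.1.2.1.2) h
    have h4 : α ≫ eA.hom = α ≫ fA.hom := congrArg (fun z => z.1.2.1.1.2) h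
    rw [cancel_epi] at h2 h3 h4
    rw [cancel_mono] at h1
    rw [Iso.ext_inv h1, Iso.ext h2, Iso.ext h3, Iso.ext h4]
  · rintro ⟨⟨⟨⟨⟨d₁, c₁⟩, k1⟩, ⟨⟨d₁', b₁⟩, k2⟩⟩, ⟨⟨⟨β₁, α₁⟩, k3⟩, ⟨⟨γ₁, α₁'⟩, k4⟩⟩⟩, q1, q2, q3, q4⟩
    simp only at k1 k2 k3 k4 q1 q2 q3 q4
    have := k1.epi
    have := k2.epi
    have := k4.mono
    have := k3.mono
    obtain ⟨eD, eC, hD1, hC1⟩ := hd.unique k1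
      (by rw [← cancel_mono γ₁, Category.assoc, ← q2, ← hcγ, reassoc_of% hd.w]; simp)
      (by rw [← cancel_mono γ, Category.assoc, hcγ, q2, reassoc_of% k1.w]; simp)
    obtain ⟨eD', eB, hD2, hB1⟩ := hd'b.unique k2
      (by rw [← cancel_mono β₁, Category.assoc, ← q3, ← hbβ, reassoc_of% hd'b.w]; simp)
      (by rw [← cancel_mono β, Category.assoc, hbβ, q3, reassoc_of% k2.w]; simp)
    obtain ⟨eB', eA, hB2, hA1⟩ := hα.unique k3
      (by rw [← cancel_epi b, reassoc_of% hbβ, reassoc_of% q3, k3.w]; simp)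
      (by rw [← cancel_epi b₁, ← reassoc_of% q3, ← reassoc_of% hbβ, hα.w]; simp)
    refine ⟨(eA, eB, eC, eD), ?_⟩
    apply Subtype.ext
    refine Prod.ext (Prod.ext (Subtype.ext (Prod.ext hD1 hC1)) (Subtype.ext (Prod.ext ?_ hB1)))
      (Prod.ext (Subtype.ext (Prod.ext ?_ hA1)) (Subtype.ext (Prod.ext ?_ ?_)))
    · change eD.inv ≫ d' = d₁'
      rw [← cancel_mono v, Category.assoc, hd', reassoc_of% hD1, q1]
    · change eB.inv ≫ β = β₁
      rw [Iso.inv_comp_eq, ← cancel_epi b, hbβ, reassoc_of% hB1, q3]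
    · change eC.inv ≫ γ = γ₁
      rw [Iso.inv_comp_eq, ← cancel_epi c, hcγ, reassoc_of% hC1, q2]
    · change α' ≫ eA.hom = α₁'
      rw [← cancel_epi u, reassoc_of% hα', hA1, q4]

end Green

set_option linter.unusedSectionVars false

section Green2

open scoped ENNReal NNReal
open Abelian

variable {𝓐 : Type} [SmallCategory 𝓐] [Abelian 𝓐] [HasExt.{0} 𝓐]
variable [hF : ∀ X Y : 𝓐, Finite (X ⟶ Y)] [hFE : ∀ X Y : 𝓐, Finite (Ext X Y 1)]
variable [hH : ∀ X Y : 𝓐, Subsingleton (Ext X Y 2)]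

lemma card_fiber_of_surj {G H : Type*} [AddCommGroup G] [AddCommGroup H] [Finite G] (f : G →+ H)
    (hf : Function.Surjective f) (y : H) : Nat.card {x // f x = y} * Nat.card H = Nat.card G := by
  obtain ⟨x₀, hx₀⟩ := hf y
  rw [← card_ker_range f, AddMonoidHom.range_eq_top.2 hf, Nat.card_congr AddSubgroup.topEquiv.toEquiv]
  congr 1
  refine Nat.card_congr ⟨fun x => ⟨x.1 - x₀, by simp [AddMonoidHom.mem_ker, x.2, hx₀]⟩,
    fun x => ⟨x.1 + x₀, by have := x.2; rw [AddMonoidHom.mem_ker] at this; simp [this, hx₀]⟩, ?_, ?_⟩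
  · intro x; simp
  · intro x; simp

set_option linter.unusedVariables false in
lemma cross_ses_iff {X Y U V E A B C D Q : 𝓐} {d : D ⟶ Y} {c : Y ⟶ C} {d' : D ⟶ V} {b : V ⟶ B}
    {β : B ⟶ X} {α : X ⟶ A} {γ : C ⟶ U} {α' : U ⟶ A} (h1 : IsSES d c) (h2 : IsSES d' b)
    (h3 : IsSES β α) (h4 : IsSES γ α') {f : Q ⟶ X} {g : Q ⟶ U} (hQ : IsPullback f g α α')
    {ι : D ⟶ E} {q : E ⟶ Q} (h : IsSES ι q) (y : Y ⟶ E) (hy1 : d ≫ y = ι)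
    (hyf : y ≫ q ≫ f = 0) (hyg : y ≫ q ≫ g = c ≫ γ) : IsSES y (q ≫ f) := by
  have := h1.mono
  have := h1.epi
  have := h3.epi
  have := h4.mono
  have := h4.epi
  have := h.epi
  have := h.mono
  have hf : Epi f := by
    have := epi_pullback_of_epi_g α α'
    rw [← hQ.isoPullback_hom_fst]
    infer_instance
  refine IsSES.mk_of_refine hyf ?_ ?_ ?_
  · intro W k hk
    have : k ≫ c = 0 := by
      rw [← cancel_mono γ, Category.assoc, ← hyg, reassoc_of% hk]; simp
    obtain ⟨l, rfl⟩ := h1.lift k this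
    have : l ≫ ι = 0 := by rw [← hy1, ← Category.assoc, hk]
    rw [(cancel_mono ι).1 (this.trans zero_comp.symm), zero_comp]
  · intro W k
    exact IsSES.refine_epi _ inferInstance k
  · intro W k hk
    obtain ⟨l, hl⟩ := h4.lift (k ≫ q ≫ g) (by
      rw [Category.assoc, Category.assoc, ← hQ.w, reassoc_of% hk, zero_comp])
    obtain ⟨W', π, hπ, m, hm⟩ := IsSES.refine_epi c inferInstance l
    obtain ⟨n, hn⟩ := h.lift (π ≫ k - m ≫ y) (by
      apply hQ.hom_ext
      · simp only [Preadditive.sub_comp, Category.assoc, zero_comp]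
        rw [hk, hyf]; simp
      · simp only [Preadditive.sub_comp, Category.assoc, zero_comp]
        rw [hyg, ← hl, ← reassoc_of% hm]; simp)
    refine ⟨W', π, hπ, m + n ≫ d, ?_⟩
    rw [Preadditive.add_comp, Category.assoc, hy1, hn]; simp

set_option linter.unusedVariables false in
lemma cross_ses_Q {X Y U V E A B C D Q : 𝓐} {d : D ⟶ Y} {c : Y ⟶ C}
    {β : B ⟶ X} {α : X ⟶ A} {γ : C ⟶ U} {α' : U ⟶ A} (h1 : IsSES d c)
    (h3 : IsSES β α) (h4 : IsSES γ α') {f : Q ⟶ X} {g : Q ⟶ U} (hQ : IsPullback f g α α')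
    {y : Y ⟶ E} {x : E ⟶ X} {v : V ⟶ E} {u : E ⟶ U} (hx : IsSES y x) (hu : IsSES v u)
    (hyu : y ≫ u = c ≫ γ) (hxu : x ≫ α = u ≫ α') :
    IsSES (d ≫ y) (hQ.lift x u hxu) := by
  have := h1.mono
  have := h1.epi
  have := hx.mono
  have := hx.epi
  have := h4.mono
  refine IsSES.mk_of_refine ?_ ?_ ?_ ?_
  · apply hQ.hom_ext
    · simp [hx.w]
    · simp [hyu, reassoc_of% h1.w]
  · intro W k hk
    rwa [← cancel_mono (d ≫ y), zero_comp]
  · intro W k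
    obtain ⟨W', π, hπ, l, hl⟩ := IsSES.refine_epi x inferInstance (k ≫ f)
    obtain ⟨m, hm⟩ := h4.lift (l ≫ u - π ≫ k ≫ g) (by
      simp only [Preadditive.sub_comp, Category.assoc]
      rw [← hxu, ← hQ.w, ← reassoc_of% hl, sub_self])
    obtain ⟨W'', π', hπ', n, hn⟩ := IsSES.refine_epi c inferInstance m
    refine ⟨W'', π' ≫ π, inferInstance, π' ≫ l - n ≫ y, ?_⟩
    apply hQ.hom_ext
    · simp only [Preadditive.sub_comp, Category.assoc, IsPullback.lift_fst, hx.w, comp_zero, sub_zero]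
      rw [hl]
    · simp only [Preadditive.sub_comp, Category.assoc, IsPullback.lift_snd]
      rw [hyu, ← reassoc_of% hn, hm]; simp
  · intro W k hk
    have hk1 : k ≫ x = 0 := by
      rw [← hQ.lift_fst x u hxu, reassoc_of% hk, zero_comp]
    have hk2 : k ≫ u = 0 := by
      rw [← hQ.lift_snd x u hxu, reassoc_of% hk, zero_comp]
    obtain ⟨l, rfl⟩ := hx.lift k hk1
    obtain ⟨m, rfl⟩ := h1.lift l (by
      rw [← cancel_mono γ, Category.assoc, ← hyu, ← Category.assoc, hk2, zero_comp])
    exact ⟨W, 𝟙 W, inferInstance, m, by simp⟩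

lemma green_arith {hQ eQ hB eB hC eC n eA : ℝ≥0} (n1 : hQ ≠ 0) (n3 : eC ≠ 0) (n4 : eB ≠ 0)
    (n5 : hC ≠ 0) (n6 : hB ≠ 0) (n7 : eA ≠ 0) (n8 : n ≠ 0)
    (he : hQ / eQ = eA * (hB / eB) * (hC / eC)) (h : n * (eC * eB) = eQ) :
    hQ⁻¹ * (n * (hC * hB)) = eA⁻¹ := by
  subst h
  rw [← NNReal.coe_ne_zero] at *
  rw [← NNReal.coe_inj] at *
  push_cast at *
  field_simp at he ⊢
  linear_combination -he

open scoped Classical in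
lemma green_crosses {X Y U V A B C D : 𝓐} (φ : Frame X Y U V A B C D) :
    ∑' E : IsoCl 𝓐, cc {κ : Cross X Y U V E.out // GCompat κ φ} * (aE E.out)⁻¹ =
      (((eN A D)⁻¹ : ℝ≥0) : ℝ≥0∞) := by
  obtain ⟨⟨⟨⟨d, c⟩, h1⟩, ⟨⟨d', b⟩, h2⟩⟩, ⟨⟨⟨β, α⟩, h3⟩, ⟨⟨γ, α'⟩, h4⟩⟩⟩ := φ
  simp only at h1 h2 h3 h4
  obtain ⟨Q, f, g, hQ⟩ : ∃ (Q : 𝓐) (f : Q ⟶ X) (g : Q ⟶ U), IsPullback f g α α' :=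
    ⟨_, _, _, IsPullback.of_hasPullback α α'⟩
  let kC : C ⟶ Q := hQ.lift 0 γ (by simp [h4.w])
  let kB : B ⟶ Q := hQ.lift β 0 (by simp [h3.w])
  have kCf : kC ≫ f = 0 := hQ.lift_fst _ _ _
  have kCg : kC ≫ g = γ := hQ.lift_snd _ _ _
  have kBf : kB ≫ f = β := hQ.lift_fst _ _ _
  have kBg : kB ≫ g = 0 := hQ.lift_snd _ _ _
  -- the Ext part
  let ρ : Ext Q D 1 →+ Ext C D 1 × Ext B D 1 :=
    ((Ext.mk₀ kC).precomp D (zero_add 1)).prod ((Ext.mk₀ kB).precomp D (zero_add 1))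
  have hCQ : IsSES kC f := by
    have := h4.mono
    have := h4.epi
    have hf : Epi f := by
      have := epi_pullback_of_epi_g α α'
      rw [← hQ.isoPullback_hom_fst]
      infer_instance
    refine IsSES.mk_of_lift kCf ?_ hf ?_
    · exact mono_of_mono_fac kCg
    · intro W k hk
      obtain ⟨l, hl⟩ := h4.lift (k ≫ g) (by rw [Category.assoc, ← hQ.w, reassoc_of% hk, zero_comp])
      refine ⟨l, hQ.hom_ext ?_ ?_⟩
      · rw [Category.assoc, kCf, hk, comp_zero]
      · rw [Category.assoc, kCg, hl]
  have hρ : Function.Surjective ρ := by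
    rintro ⟨η, ζ⟩
    obtain ⟨ξ₀, hξ₀⟩ := ext_surj_left hCQ D η
    obtain ⟨ω, hω⟩ := ext_surj_left h3 D (ζ - (Ext.mk₀ kB).comp ξ₀ (zero_add 1))
    refine ⟨ξ₀ + (Ext.mk₀ f).comp ω (zero_add 1), Prod.ext ?_ ?_⟩
    · change (Ext.mk₀ kC).comp (ξ₀ + (Ext.mk₀ f).comp ω (zero_add 1)) (zero_add 1) = η
      rw [Ext.comp_add, Ext.mk₀_comp_mk₀_assoc, kCf, hξ₀]; simp
    · change (Ext.mk₀ kB).comp (ξ₀ + (Ext.mk₀ f).comp ω (zero_add 1)) (zero_add 1) = ζ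
      rw [Ext.comp_add, Ext.mk₀_comp_mk₀_assoc, kBf, hω]; simp
  let N : Ext Q D 1 → ℝ≥0∞ := fun ξ =>
    if ρ ξ = (h1.cls, h2.cls) then cc (C ⟶ D) * cc (B ⟶ D) else 0
  have step1 : ∀ E : 𝓐, cc {κ : Cross X Y U V E // GCompat κ
      ((⟨⟨⟨(d, c), h1⟩, ⟨(d', b), h2⟩⟩, ⟨⟨(β, α), h3⟩, ⟨(γ, α'), h4⟩⟩⟩) : Frame X Y U V A B C D)} =
      cc (Σ s : Ses D E Q, {y : Y ⟶ E // d ≫ y = s.1.1 ∧ y ≫ s.1.2 = c ≫ kC} ×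
        {v : V ⟶ E // d' ≫ v = s.1.1 ∧ v ≫ s.1.2 = b ≫ kB}) := by
    intro E
    refine cc_congr (Equiv.symm ⟨fun z => ⟨⟨⟨(z.2.1.1, z.1.1.2 ≫ f), ?_⟩, ⟨(z.2.2.1, z.1.1.2 ≫ g), ?_⟩⟩, ?_⟩,
      fun z => ⟨⟨(d ≫ z.1.1.1.1, hQ.lift z.1.1.1.2 z.1.2.1.2 z.2.2.2.2),
        cross_ses_Q h1 h3 h4 hQ z.1.1.2 z.1.2.2 z.2.2.1 z.2.2.2.2⟩,
        ⟨z.1.1.1.1, rfl, ?_⟩, ⟨z.1.2.1.1, z.2.1.symm, ?_⟩⟩, ?_, ?_⟩)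
    · obtain ⟨⟨⟨ι, q⟩, h⟩, ⟨y, hy⟩, ⟨v, hv⟩⟩ := z
      dsimp only at *
      refine cross_ses_iff h1 h2 h3 h4 hQ h y hy.1 ?_ ?_
      · rw [reassoc_of% hy.2, kCf, comp_zero]
      · rw [reassoc_of% hy.2, kCg]
    · obtain ⟨⟨⟨ι, q⟩, h⟩, ⟨y, hy⟩, ⟨v, hv⟩⟩ := z
      dsimp only at *
      refine cross_ses_iff h2 h1 h4 h3 hQ.flip h v hv.1 ?_ ?_
      · rw [reassoc_of% hv.2, kBg, comp_zero]
      · rw [reassoc_of% hv.2, kBf]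
    · obtain ⟨⟨⟨ι, q⟩, h⟩, ⟨y, hy⟩, ⟨v, hv⟩⟩ := z
      dsimp only at *
      refine ⟨?_, ?_, ?_, ?_⟩
      · change d ≫ y = d' ≫ v
        rw [hy.1, hv.1]
      · change y ≫ q ≫ g = c ≫ γ
        rw [reassoc_of% hy.2, kCg]
      · change v ≫ q ≫ f = b ≫ β
        rw [reassoc_of% hv.2, kBf]
      · change (q ≫ f) ≫ α = (q ≫ g) ≫ α'
        rw [Category.assoc, hQ.w, Category.assoc]
    · obtain ⟨⟨⟨⟨y, x⟩, hx⟩, ⟨⟨v, u⟩, hu⟩⟩, k1, k2, k3, k4⟩ := z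
      simp only at *
      apply hQ.hom_ext
      · simp [kCf, hx.w]
      · simp [kCg, k2]
    · obtain ⟨⟨⟨⟨y, x⟩, hx⟩, ⟨⟨v, u⟩, hu⟩⟩, k1, k2, k3, k4⟩ := z
      simp only at *
      apply hQ.hom_ext
      · simp [kBf, k3]
      · simp [kBg, hu.w]
    · rintro ⟨⟨⟨ι, q⟩, h⟩, ⟨y, hy⟩, ⟨v, hv⟩⟩
      have aux : ∀ (ι' : D ⟶ E) (q' : E ⟶ Q) (h' : IsSES ι' q') (_ : ι' = ι) (_ : q' = q)
          (hy' : d ≫ y = ι' ∧ y ≫ q' = c ≫ kC) (hv' : d' ≫ v = ι' ∧ v ≫ q' = b ≫ kB),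
          (⟨⟨(ι', q'), h'⟩, (⟨y, hy'⟩, ⟨v, hv'⟩)⟩ : Σ s : Ses D E Q,
            {y : Y ⟶ E // d ≫ y = s.1.1 ∧ y ≫ s.1.2 = c ≫ kC} ×
            {v : V ⟶ E // d' ≫ v = s.1.1 ∧ v ≫ s.1.2 = b ≫ kB}) =
          ⟨⟨(ι, q), h⟩, (⟨y, hy⟩, ⟨v, hv⟩)⟩ := by
        intro ι' q' h' e1 e2 hy' hv'
        subst e1; subst e2; rfl
      exact aux _ _ _ hy.1 (hQ.hom_ext (by simp) (by simp)) _ _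
    · rintro ⟨⟨⟨⟨y, x⟩, hx⟩, ⟨⟨v, u⟩, hu⟩⟩, k1, k2, k3, k4⟩
      apply Subtype.ext
      refine Prod.ext (Subtype.ext (Prod.ext rfl ?_)) (Subtype.ext (Prod.ext rfl ?_))
      · exact hQ.lift_fst _ _ _
      · exact hQ.lift_snd _ _ _
  have step2 : ∀ (E : 𝓐) (s : Ses D E Q), cc ({y : Y ⟶ E // d ≫ y = s.1.1 ∧ y ≫ s.1.2 = c ≫ kC} ×
        {v : V ⟶ E // d' ≫ v = s.1.1 ∧ v ≫ s.1.2 = b ≫ kB}) = N s.2.cls := by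
    rintro E ⟨⟨ι, q⟩, h⟩
    dsimp only at *
    simp only [N]
    split_ifs with hc
    · have hc1 : (Ext.mk₀ kC).comp h.cls (zero_add 1) = h1.cls := congrArg Prod.fst hc
      have hc2 : (Ext.mk₀ kB).comp h.cls (zero_add 1) = h2.cls := congrArg Prod.snd hc
      rw [cc_prod, cc_eq, cc_eq, card_lift h1 h kC hc1, card_lift h2 h kB hc2, cc_eq, cc_eq]
    · apply cc_empty
      constructor
      rintro ⟨y, v⟩
      exact hc (Prod.ext ((lift_iff h1 h kC).1 ⟨y.1, y.2⟩) ((lift_iff h2 h kB).1 ⟨v.1, v.2⟩))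
  have step3 : ∀ E : 𝓐, ∑' s : Ses D E Q, N s.2.cls =
      ∑' ξ : Ext Q D 1, cc {s : Ses D E Q // s.2.cls = ξ} * N ξ := by
    intro E
    rw [← (Equiv.sigmaFiberEquiv (fun s : Ses D E Q => s.2.cls)).tsum_eq, ENNReal.tsum_sigma']
    congr 1; funext ξ
    rw [← tsum_const_cc]
    congr 1; funext s
    simp only [Equiv.sigmaFiberEquiv, Equiv.coe_fn_mk, s.2]
  have step4 : ∑' ξ : Ext Q D 1, N ξ =
      cc {ξ // ρ ξ = (h1.cls, h2.cls)} * (cc (C ⟶ D) * cc (B ⟶ D)) := by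
    rw [← tsum_const_cc,
      show (∑' _ : {ξ // ρ ξ = (h1.cls, h2.cls)}, (cc (C ⟶ D) * cc (B ⟶ D))) =
        ∑' _ : ({ξ | ρ ξ = (h1.cls, h2.cls)} : Set (Ext Q D 1)), (cc (C ⟶ D) * cc (B ⟶ D)) from rfl,
      tsum_subtype {ξ | ρ ξ = (h1.cls, h2.cls)} (fun _ => cc (C ⟶ D) * cc (B ⟶ D))]
    congr 1; funext ξ
    simp only [N, Set.indicator, Set.mem_ofPred_eq]
  simp_rw [step1, cc_sigma, step2, step3]
  simp_rw [← ENNReal.tsum_mul_right]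
  rw [ENNReal.tsum_comm]
  simp_rw [mul_right_comm _ _ (aE _)⁻¹, ENNReal.tsum_mul_right, ← div_eq_mul_inv, riedtmann]
  rw [ENNReal.tsum_mul_left, step4]
  have hcard := card_fiber_of_surj ρ hρ (h1.cls, h2.cls)
  rw [Nat.card_prod] at hcard
  have he := eN_left hCQ D
  rw [eN_left h3 D] at he
  have : (Nat.card {ξ // ρ ξ = (h1.cls, h2.cls)} : ℝ≥0) * ((Nat.card (Ext C D 1)) *
    (Nat.card (Ext B D 1))) = Nat.card (Ext Q D 1) := by exact_mod_cast hcard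
  have n1 := natCard_hom_ne Q D
  have n2 := natCard_ext_ne Q D
  have n3 := natCard_ext_ne C D
  have n4 := natCard_ext_ne B D
  have n5 := natCard_hom_ne C D
  have n6 := natCard_hom_ne B D
  have n7 := eN_ne A D
  have goal : (Nat.card (Q ⟶ D) : ℝ≥0)⁻¹ * (Nat.card {ξ // ρ ξ = (h1.cls, h2.cls)} *
      (Nat.card (C ⟶ D) * Nat.card (B ⟶ D))) = (eN A D)⁻¹ := by
    exact green_arith n1 n3 n4 n5 n6 n7 (left_ne_zero_of_mul (this ▸ n2)) he this
  rw [← goal, cc_eq, cc_eq, cc_eq, cc_eq]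
  rw [ENNReal.coe_mul, ENNReal.coe_inv n1]
  push_cast
  rfl

/-- Green's formula -/
lemma green (X Y U V : 𝓐) :
    ∑' E : IsoCl 𝓐, cc (Cross X Y U V E.out) * (aE E.out)⁻¹ =
    ∑' s : (IsoCl 𝓐 × IsoCl 𝓐 × IsoCl 𝓐 × IsoCl 𝓐),
      cc (Frame X Y U V s.1.out s.2.1.out s.2.2.1.out s.2.2.2.out) *
      (((aE s.1.out)⁻¹ * (aE s.2.1.out)⁻¹ * (aE s.2.2.1.out)⁻¹ * (aE s.2.2.2.out)⁻¹) *
        (((eN s.1.out s.2.2.2.out)⁻¹ : ℝ≥0) : ℝ≥0∞)) :=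
  double_count (fun E : IsoCl 𝓐 => Cross X Y U V E.out) _ _ _ _ (fun _ _ κ φ => GCompat κ φ)
    (fun _ κ => green_frames κ) (fun _ φ => green_crosses φ)

end Green2

set_option linter.unusedSectionVars false

section ProdSum

open scoped ENNReal

lemma prod_tsum (ι : Type) [Fintype ι] {C : Type} (F : ι → C → ℝ≥0∞) :
    ∏ i, ∑' a, F i a = ∑' a : ι → C, ∏ i, F i (a i) := by
  classical
  have key : ∀ (ι : Type) [Finite ι], ∀ [Fintype ι] (F : ι → C → ℝ≥0∞),
      ∏ i, ∑' a, F i a = ∑' a : ι → C, ∏ i, F i (a i) := by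
    intro ι _
    refine Finite.induction_empty_option (P := fun ι => ∀ [Fintype ι] (F : ι → C → ℝ≥0∞),
      ∏ i, ∑' a, F i a = ∑' a : ι → C, ∏ i, F i (a i)) ?_ ?_ ?_ ι
    · intro α β e h _ F
      have := Fintype.ofEquiv β e.symm
      rw [← e.prod_comp, h, ← (Equiv.arrowCongr e (Equiv.refl C)).tsum_eq]
      congr 1; funext a
      rw [← e.prod_comp]
      simp
    · intro _ F
      simp
    · intro α _ h inst F
      rw [Subsingleton.elim inst instFintypeOption]
      rw [Fintype.prod_option, h, ← (Equiv.piOptionEquivProd (β := fun _ : Option α => C)).symm.tsum_eq,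
        ENNReal.tsum_prod', ← ENNReal.tsum_mul_right]
      congr 1; funext a
      rw [← ENNReal.tsum_mul_left]
      congr 1; funext b
      rw [Fintype.prod_option]
      simp [Equiv.piOptionEquivProd]
  exact key ι F

end ProdSum

section Bet

open scoped NNReal

variable {C : Type} {t : ℕ} [NeZero t] (eu : C → C → ℝ≥0)

/-- the factor under the square root -/
def Bfac (f g : ZMod t → C) (i : ZMod t) : ℝ≥0 :=
  eu (f i) (g i) * ∏ k ∈ Finset.Icc 1 (t - 1), eu (f (i + (k : ZMod t))) (g i) ^ ((-1 : ℤ) ^ (k + 1))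

/-- the product of the square roots -/
def Bet (f g : ZMod t → C) : ℝ≥0 := ∏ i, NNReal.sqrt (Bfac eu f g i)

/-- logarithm -/
def lg (a b : C) : ℝ := Real.log (eu a b)

lemma Bfac_ne (hne : ∀ a b, eu a b ≠ 0) (f g : ZMod t → C) (i : ZMod t) : Bfac eu f g i ≠ 0 :=
  mul_ne_zero (hne _ _) (Finset.prod_ne_zero_iff.2 fun _ _ => zpow_ne_zero _ (hne _ _))

lemma Bet_ne (hne : ∀ a b, eu a b ≠ 0) (f g : ZMod t → C) : Bet eu f g ≠ 0 :=
  Finset.prod_ne_zero_iff.2 fun i _ => by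
    rw [ne_eq, NNReal.sqrt_eq_zero]; exact Bfac_ne eu hne f g i

lemma log_Bet (hne : ∀ a b, eu a b ≠ 0) (f g : ZMod t → C) : Real.log (Bet eu f g) = (1 / 2) * ∑ i, (lg eu (f i) (g i) +
    ∑ k ∈ Finset.Icc 1 (t - 1), (-1 : ℝ) ^ (k + 1) * lg eu (f (i + (k : ZMod t))) (g i)) := by
  have hne' : ∀ a b, (eu a b : ℝ) ≠ 0 := fun a b => by exact_mod_cast hne a b
  rw [Bet, NNReal.coe_prod, Real.log_prod, Finset.mul_sum]
  · refine Finset.sum_congr rfl fun i _ => ?_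
    rw [Real.coe_sqrt, Real.log_sqrt (NNReal.coe_nonneg _), Bfac, NNReal.coe_mul, Real.log_mul (hne' _ _),
      NNReal.coe_prod, Real.log_prod]
    · rw [div_eq_inv_mul, one_div]
      congr 2
      refine Finset.sum_congr rfl fun k _ => ?_
      rw [NNReal.coe_zpow, Real.log_zpow]
      push_cast
      rfl
    · intro k _
      rw [NNReal.coe_zpow]; exact zpow_ne_zero _ (hne' _ _)
    · rw [NNReal.coe_ne_zero]
      exact (Finset.prod_ne_zero_iff.2 fun _ _ => zpow_ne_zero _ (hne _ _))
  · intro i _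
    rw [NNReal.coe_ne_zero, ne_eq, NNReal.sqrt_eq_zero]
    exact Bfac_ne eu hne f g i

lemma tele (u : ℕ → ℝ) (n : ℕ) :
    ∑ k ∈ Finset.Icc 1 n, (-1 : ℝ) ^ (k + 1) * (u k + u (k + 1)) = u 1 + (-1) ^ (n + 1) * u (n + 1) := by
  induction n with
  | zero => simp
  | succ n ih =>
    rw [Finset.sum_Icc_succ_top (by omega), ih]
    ring

lemma tele' (u : ZMod t → ℝ) (ht : Odd t) (i : ZMod t) : u i + u (i + 1) +
    ∑ k ∈ Finset.Icc 1 (t - 1), (-1 : ℝ) ^ (k + 1) * (u (i + (k : ZMod t)) + u (i + 1 + (k : ZMod t))) =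
    2 * u (i + 1) := by
  have h := tele (fun k => u (i + (k : ZMod t))) (t - 1)
  have ht1 : t - 1 + 1 = t := Nat.succ_pred_eq_of_pos (NeZero.pos t)
  rw [ht1, ht.neg_one_pow] at h
  simp only [Nat.cast_add, Nat.cast_one, CharP.cast_eq_zero, add_zero] at h
  have e : ∀ k : ℕ, i + 1 + (k : ZMod t) = i + ((k : ZMod t) + 1) := fun k => by ring
  simp_rw [e, h]
  ring

lemma bet_left (hne : ∀ a b, eu a b ≠ 0) (ht : Odd t) (f g y S h : ZMod t → C)
    (hy : ∀ i Z, eu (y i) Z * eu (S i) Z * eu (S (i + 1)) Z = eu (f i) Z * eu (g i) Z) :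
    Bet eu y h * ∏ i, eu (S (i + 1)) (h i) = Bet eu f h * Bet eu g h := by
  have hne' : ∀ a b, (eu a b : ℝ) ≠ 0 := fun a b => by exact_mod_cast hne a b
  have hB : ∀ f g : ZMod t → C, (Bet eu f g : ℝ) ≠ 0 := fun f g => by exact_mod_cast Bet_ne eu hne f g
  have hP : ((∏ i, eu (S (i + 1)) (h i) : ℝ≥0) : ℝ) ≠ 0 := by
    exact_mod_cast Finset.prod_ne_zero_iff.2 fun i _ => hne _ _
  have hl : ∀ i Z, lg eu (y i) Z = lg eu (f i) Z + lg eu (g i) Z - lg eu (S i) Z - lg eu (S (i + 1)) Z := by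
    intro i Z
    have := congrArg (fun x : ℝ≥0 => Real.log x) (hy i Z)
    simp only [NNReal.coe_mul] at this
    rw [Real.log_mul (mul_ne_zero (hne' _ _) (hne' _ _)) (hne' _ _), Real.log_mul (hne' _ _) (hne' _ _),
      Real.log_mul (hne' _ _) (hne' _ _)] at this
    simp only [lg]
    linarith
  rw [← NNReal.coe_inj]
  apply Real.log_injOn_pos (by
    rw [Set.mem_Ioi]; exact lt_of_le_of_ne (NNReal.coe_nonneg _) (by push_cast at *; exact (mul_ne_zero (hB _ _) hP).symm))
    (by rw [Set.mem_Ioi]; exact lt_of_le_of_ne (NNReal.coe_nonneg _) (by push_cast; exact (mul_ne_zero (hB _ _) (hB _ _)).symm))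
  rw [NNReal.coe_mul, NNReal.coe_mul, Real.log_mul (hB _ _) hP, Real.log_mul (hB _ _) (hB _ _),
    log_Bet eu hne, log_Bet eu hne, log_Bet eu hne, NNReal.coe_prod, Real.log_prod (fun i _ => hne' _ _)]
  change _ + ∑ i, lg eu (S (i + 1)) (h i) = _
  have key : ∀ i, (lg eu (y i) (h i) +
      ∑ k ∈ Finset.Icc 1 (t - 1), (-1 : ℝ) ^ (k + 1) * lg eu (y (i + (k : ZMod t))) (h i)) =
      (lg eu (f i) (h i) +
      ∑ k ∈ Finset.Icc 1 (t - 1), (-1 : ℝ) ^ (k + 1) * lg eu (f (i + (k : ZMod t))) (h i)) +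
      (lg eu (g i) (h i) +
      ∑ k ∈ Finset.Icc 1 (t - 1), (-1 : ℝ) ^ (k + 1) * lg eu (g (i + (k : ZMod t))) (h i)) -
      2 * lg eu (S (i + 1)) (h i) := by
    intro i
    rw [← tele' (fun j => lg eu (S j) (h i)) ht i]
    have : ∑ k ∈ Finset.Icc 1 (t - 1), (-1 : ℝ) ^ (k + 1) * lg eu (y (i + (k : ZMod t))) (h i) =
      ∑ k ∈ Finset.Icc 1 (t - 1), (-1 : ℝ) ^ (k + 1) * lg eu (f (i + (k : ZMod t))) (h i) +
      ∑ k ∈ Finset.Icc 1 (t - 1), (-1 : ℝ) ^ (k + 1) * lg eu (g (i + (k : ZMod t))) (h i) -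
      ∑ k ∈ Finset.Icc 1 (t - 1), (-1 : ℝ) ^ (k + 1) * (lg eu (S (i + (k : ZMod t))) (h i) +
        lg eu (S (i + 1 + (k : ZMod t))) (h i)) := by
      rw [← Finset.sum_add_distrib, ← Finset.sum_sub_distrib]
      refine Finset.sum_congr rfl fun k _ => ?_
      rw [hl, add_right_comm i (k : ZMod t) 1]
      ring
    rw [this, hl]
    ring
  simp_rw [key]
  rw [Finset.sum_sub_distrib, Finset.sum_add_distrib, ← Finset.mul_sum]
  ring

lemma bet_right (hne : ∀ a b, eu a b ≠ 0) (ht : Odd t) (f g h z s : ZMod t → C)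
    (hz : ∀ i Z, eu Z (z i) * eu Z (s i) * eu Z (s (i + 1)) = eu Z (g i) * eu Z (h i)) :
    Bet eu f z * ∏ i, eu (f i) (s i) = Bet eu f g * Bet eu f h := by
  have hne' : ∀ a b, (eu a b : ℝ) ≠ 0 := fun a b => by exact_mod_cast hne a b
  have hB : ∀ f g : ZMod t → C, (Bet eu f g : ℝ) ≠ 0 := fun f g => by exact_mod_cast Bet_ne eu hne f g
  have hP : ((∏ i, eu (f i) (s i) : ℝ≥0) : ℝ) ≠ 0 := by
    exact_mod_cast Finset.prod_ne_zero_iff.2 fun i _ => hne _ _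
  have hl : ∀ i Z, lg eu Z (z i) = lg eu Z (g i) + lg eu Z (h i) - lg eu Z (s i) - lg eu Z (s (i + 1)) := by
    intro i Z
    have := congrArg (fun x : ℝ≥0 => Real.log x) (hz i Z)
    simp only [NNReal.coe_mul] at this
    rw [Real.log_mul (mul_ne_zero (hne' _ _) (hne' _ _)) (hne' _ _), Real.log_mul (hne' _ _) (hne' _ _),
      Real.log_mul (hne' _ _) (hne' _ _)] at this
    simp only [lg]
    linarith
  rw [← NNReal.coe_inj]
  apply Real.log_injOn_pos (by
    rw [Set.mem_Ioi]; exact lt_of_le_of_ne (NNReal.coe_nonneg _) (by push_cast at *; exact (mul_ne_zero (hB _ _) hP).symm))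
    (by rw [Set.mem_Ioi]; exact lt_of_le_of_ne (NNReal.coe_nonneg _) (by push_cast; exact (mul_ne_zero (hB _ _) (hB _ _)).symm))
  rw [NNReal.coe_mul, NNReal.coe_mul, Real.log_mul (hB _ _) hP, Real.log_mul (hB _ _) (hB _ _),
    log_Bet eu hne, log_Bet eu hne, log_Bet eu hne, NNReal.coe_prod, Real.log_prod (fun i _ => hne' _ _)]
  change _ + ∑ i, lg eu (f i) (s i) = _
  have key : ∀ i, (lg eu (f i) (z i) +
      ∑ k ∈ Finset.Icc 1 (t - 1), (-1 : ℝ) ^ (k + 1) * lg eu (f (i + (k : ZMod t))) (z i)) =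
      (lg eu (f i) (g i) +
      ∑ k ∈ Finset.Icc 1 (t - 1), (-1 : ℝ) ^ (k + 1) * lg eu (f (i + (k : ZMod t))) (g i)) +
      (lg eu (f i) (h i) +
      ∑ k ∈ Finset.Icc 1 (t - 1), (-1 : ℝ) ^ (k + 1) * lg eu (f (i + (k : ZMod t))) (h i)) -
      (lg eu (f i) (s i) +
      ∑ k ∈ Finset.Icc 1 (t - 1), (-1 : ℝ) ^ (k + 1) * lg eu (f (i + (k : ZMod t))) (s i)) -
      (lg eu (f i) (s (i + 1)) +
      ∑ k ∈ Finset.Icc 1 (t - 1), (-1 : ℝ) ^ (k + 1) * lg eu (f (i + (k : ZMod t))) (s (i + 1))) := by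
    intro i
    have : ∑ k ∈ Finset.Icc 1 (t - 1), (-1 : ℝ) ^ (k + 1) * lg eu (f (i + (k : ZMod t))) (z i) =
      ∑ k ∈ Finset.Icc 1 (t - 1), (-1 : ℝ) ^ (k + 1) * lg eu (f (i + (k : ZMod t))) (g i) +
      ∑ k ∈ Finset.Icc 1 (t - 1), (-1 : ℝ) ^ (k + 1) * lg eu (f (i + (k : ZMod t))) (h i) -
      ∑ k ∈ Finset.Icc 1 (t - 1), (-1 : ℝ) ^ (k + 1) * lg eu (f (i + (k : ZMod t))) (s i) -
      ∑ k ∈ Finset.Icc 1 (t - 1), (-1 : ℝ) ^ (k + 1) * lg eu (f (i + (k : ZMod t))) (s (i + 1)) := by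
      rw [← Finset.sum_add_distrib, ← Finset.sum_sub_distrib, ← Finset.sum_sub_distrib]
      refine Finset.sum_congr rfl fun k _ => ?_
      rw [hl]
      ring
    rw [this, hl]
    ring
  simp_rw [key]
  rw [Finset.sum_sub_distrib, Finset.sum_sub_distrib, Finset.sum_add_distrib]
  have e1 : ∑ i, (lg eu (f i) (s i) +
      ∑ k ∈ Finset.Icc 1 (t - 1), (-1 : ℝ) ^ (k + 1) * lg eu (f (i + (k : ZMod t))) (s i)) =
      ∑ i, (lg eu (f (i + 1)) (s (i + 1)) +
      ∑ k ∈ Finset.Icc 1 (t - 1), (-1 : ℝ) ^ (k + 1) * lg eu (f (i + 1 + (k : ZMod t))) (s (i + 1))) :=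
    (Equiv.sum_comp (Equiv.addRight (1 : ZMod t)) (fun i => (lg eu (f i) (s i) +
      ∑ k ∈ Finset.Icc 1 (t - 1), (-1 : ℝ) ^ (k + 1) * lg eu (f (i + (k : ZMod t))) (s i)))).symm
  have e3 : ∑ i, lg eu (f i) (s i) = ∑ i, lg eu (f (i + 1)) (s (i + 1)) :=
    (Equiv.sum_comp (Equiv.addRight (1 : ZMod t)) (fun i => lg eu (f i) (s i))).symm
  have e2 : ∑ i, (lg eu (f (i + 1)) (s (i + 1)) +
      ∑ k ∈ Finset.Icc 1 (t - 1), (-1 : ℝ) ^ (k + 1) * lg eu (f (i + 1 + (k : ZMod t))) (s (i + 1))) +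
      ∑ i, (lg eu (f i) (s (i + 1)) +
      ∑ k ∈ Finset.Icc 1 (t - 1), (-1 : ℝ) ^ (k + 1) * lg eu (f (i + (k : ZMod t))) (s (i + 1))) =
      2 * ∑ i, lg eu (f (i + 1)) (s (i + 1)) := by
    rw [← Finset.sum_add_distrib, Finset.mul_sum]
    refine Finset.sum_congr rfl fun i _ => ?_
    rw [← tele' (fun j => lg eu (f j) (s (i + 1))) ht i]
    simp only [mul_add, Finset.sum_add_distrib]
    ring
  rw [e1, e3]
  linarith

end Bet

set_option linter.unusedSectionVars false

section AbsAssoc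

open scoped NNReal ENNReal

lemma prod_shift {K : Type} [CommMonoid K] {τ : ℕ} [NeZero τ] (F : ZMod τ → K) : ∏ i, F (i + 1) = ∏ i, F i :=
  Equiv.prod_comp (Equiv.addRight (1 : ZMod τ)) F

lemma prod_shift_cancel {ι : Type} [Fintype ι] (P Q s s' : ι → ℝ≥0) (h : ∀ i, P i * s i = Q i * s' i)
    (hs : ∏ i, s i = ∏ i, s' i) (h0 : ∀ i, s i ≠ 0) : ∏ i, P i = ∏ i, Q i := by
  have h1 : (∏ i, P i) * ∏ i, s i = (∏ i, Q i) * ∏ i, s i := by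
    conv_rhs => rw [hs]
    rw [← Finset.prod_mul_distrib, ← Finset.prod_mul_distrib]
    exact Finset.prod_congr rfl fun i _ => h i
  exact mul_right_cancel₀ (Finset.prod_ne_zero_iff.2 fun i _ => h0 i) h1

variable {C : Type} {τ : ℕ} [NeZero τ] (hl : C → C → C → ℝ≥0) (au : C → ℝ≥0) (eu : C → C → ℝ≥0)

/-- local factor without the square root -/
def TC (f g x M N S : ZMod τ → C) (i : ZMod τ) : ℝ≥0 :=
  hl (N i) (S i) (g i) * hl (M i) (N i) (x i) * hl (S (i + 1)) (M i) (f i) *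
    (au (M i) * au (N i) * au (S i)) /
    (au (x i) * eu (f i) (S i) * eu (S (i + 1)) (N i))

/-- local factor -/
def TT (f g x M N S : ZMod τ → C) (i : ZMod τ) : ℝ≥0 :=
  TC hl au eu f g x M N S i * NNReal.sqrt (Bfac eu f g i)

lemma prod_TT (f g x M N S : ZMod τ → C) :
    ∏ i, TT hl au eu f g x M N S i = (∏ i, TC hl au eu f g x M N S i) * Bet eu f g := by
  simp only [TT, Bet, Finset.prod_mul_distrib]

/-- structure constants -/
def hE (f g x : ZMod τ → C) : ℝ≥0∞ :=
  ∑' p : (ZMod τ → C) × (ZMod τ → C) × (ZMod τ → C),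
    ((∏ i, TT hl au eu f g x p.1 p.2.1 p.2.2 i : ℝ≥0) : ℝ≥0∞)

/-- local coefficient for the left bracketing -/
def KL (f g h x M N S M' N' S' : ZMod τ → C) (i : ZMod τ) : ℝ≥0 :=
  hl (N i) (S i) (g i) * hl (S (i + 1)) (M i) (f i) * hl (N' i) (S' i) (h i) * hl (M' i) (N' i) (x i) *
    (au (M i) * au (N i) * au (S i) * au (M' i) * au (N' i) * au (S' (i + 1))) /
    (au (x i) * eu (f i) (S i) * eu (S (i + 1)) (N i) * eu (M i) (S' i) * eu (N i) (S' i) *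
      eu (S' (i + 1)) (N' i) * eu (S (i + 1)) (h i))

/-- local coefficient for the right bracketing -/
def KR (f g h x M N S M' N' S' : ZMod τ → C) (i : ZMod τ) : ℝ≥0 :=
  hl (N i) (S i) (h i) * hl (S (i + 1)) (M i) (g i) * hl (S' (i + 1)) (M' i) (f i) * hl (M' i) (N' i) (x i) *
    (au (M i) * au (N i) * au (S i) * au (M' i) * au (N' i) * au (S' i)) /
    (au (x i) * eu (g i) (S i) * eu (S (i + 1)) (N i) * eu (f i) (S' i) *
      eu (S' (i + 1)) (N' i) * eu (f i) (S i))

lemma stepL (ha : ∀ a, au a ≠ 0) (hne : ∀ a b, eu a b ≠ 0)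
    (hE1 : ∀ a b c Z, hl a b c ≠ 0 → eu c Z = eu a Z * eu b Z) (ht : Odd τ)
    (f g h x y M N S M' N' S' : ZMod τ → C) :
    (∏ i, TT hl au eu f g y M N S i) * (∏ i, TT hl au eu y h x M' N' S' i) =
      ((∏ i, KL hl au eu f g h x M N S M' N' S' i) * (Bet eu f g * Bet eu f h * Bet eu g h)) *
        ∏ i, (hl (M i) (N i) (y i) * hl (S' (i + 1)) (M' i) (y i) / au (y i)) := by
  by_cases h0 : ∀ i, hl (N i) (S i) (g i) ≠ 0 ∧ hl (M i) (N i) (y i) ≠ 0 ∧ hl (S (i + 1)) (M i) (f i) ≠ 0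
  · have hB := bet_left eu hne ht f g y S h (fun i Z => by
      rw [hE1 _ _ _ Z (h0 i).1, hE1 _ _ _ Z (h0 i).2.1, hE1 _ _ _ Z (h0 i).2.2]; ring)
    rw [prod_TT, prod_TT, mul_assoc (Bet eu f g), ← hB]
    have key : (∏ i, TC hl au eu f g y M N S i * TC hl au eu y h x M' N' S' i) =
        ∏ i, (KL hl au eu f g h x M N S M' N' S' i * eu (S (i + 1)) (h i) *
          (hl (M i) (N i) (y i) * hl (S' (i + 1)) (M' i) (y i) / au (y i))) := by
      refine prod_shift_cancel _ _ (fun i => au (S' (i + 1))) (fun i => au (S' i)) ?_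
        (prod_shift (fun i => au (S' i))) (fun i => ha _)
      intro i
      have e := hE1 _ _ _ (S' i) (h0 i).2.1
      have a1 := ha (y i)
      have a2 := ha (x i)
      have a3 := hne (f i) (S i)
      have a4 := hne (S (i + 1)) (N i)
      have a5 := hne (M i) (S' i)
      have a6 := hne (N i) (S' i)
      have a7 := hne (S' (i + 1)) (N' i)
      have a8 := hne (S (i + 1)) (h i)
      simp only [TC, KL, e]
      simp only [div_mul_eq_mul_div, mul_div_assoc', div_div]
      rw [div_eq_div_iff (by repeat' apply mul_ne_zero
                             all_goals first | exact ha _ | exact hne _ _)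
        (by repeat' apply mul_ne_zero
            all_goals first | exact ha _ | exact hne _ _)]
      ring
    simp only [Finset.prod_mul_distrib] at key ⊢
    calc _ = (∏ i, TC hl au eu f g y M N S i) * (∏ i, TC hl au eu y h x M' N' S' i) *
          (Bet eu f g * Bet eu y h) := by ring
      _ = _ := by rw [key]; ring
  · push Not at h0
    obtain ⟨i, hi⟩ := h0
    have hT : TT hl au eu f g y M N S i = 0 := by
      by_cases h1 : hl (N i) (S i) (g i) = 0
      · simp [TT, TC, h1]
      by_cases h2 : hl (M i) (N i) (y i) = 0
      · simp [TT, TC, h2]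
      simp [TT, TC, hi h1 h2]
    rw [Finset.prod_eq_zero (Finset.mem_univ i) hT, zero_mul]
    symm
    by_cases h1 : hl (N i) (S i) (g i) = 0
    · rw [Finset.prod_eq_zero (Finset.mem_univ i)]
      · simp
      · simp [KL, h1]
    by_cases h2 : hl (M i) (N i) (y i) = 0
    · apply mul_eq_zero_of_right
      rw [Finset.prod_eq_zero (Finset.mem_univ i)]
      simp [h2]
    · rw [Finset.prod_eq_zero (Finset.mem_univ i)]
      · simp
      · simp [KL, hi h1 h2]

lemma stepR (ha : ∀ a, au a ≠ 0) (hne : ∀ a b, eu a b ≠ 0)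
    (hE2 : ∀ a b c Z, hl a b c ≠ 0 → eu Z c = eu Z a * eu Z b) (ht : Odd τ)
    (f g h x z M N S M' N' S' : ZMod τ → C) :
    (∏ i, TT hl au eu g h z M N S i) * (∏ i, TT hl au eu f z x M' N' S' i) =
      ((∏ i, KR hl au eu f g h x M N S M' N' S' i) * (Bet eu f g * Bet eu f h * Bet eu g h)) *
        ∏ i, (hl (M i) (N i) (z i) * hl (N' i) (S' i) (z i) / au (z i)) := by
  by_cases h0 : ∀ i, hl (N i) (S i) (h i) ≠ 0 ∧ hl (M i) (N i) (z i) ≠ 0 ∧ hl (S (i + 1)) (M i) (g i) ≠ 0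
  · have hB := bet_right eu hne ht f g h z S (fun i Z => by
      rw [hE2 _ _ _ Z (h0 i).1, hE2 _ _ _ Z (h0 i).2.1, hE2 _ _ _ Z (h0 i).2.2]; ring)
    rw [prod_TT, prod_TT, ← hB]
    have key : (∏ i, TC hl au eu g h z M N S i * TC hl au eu f z x M' N' S' i) =
        ∏ i, (KR hl au eu f g h x M N S M' N' S' i * eu (f i) (S i) *
          (hl (M i) (N i) (z i) * hl (N' i) (S' i) (z i) / au (z i))) := by
      refine Finset.prod_congr rfl fun i _ => ?_
      have a1 := ha (z i)
      have a2 := ha (x i)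
      have a3 := hne (g i) (S i)
      have a4 := hne (S (i + 1)) (N i)
      have a5 := hne (f i) (S' i)
      have a7 := hne (S' (i + 1)) (N' i)
      have a8 := hne (f i) (S i)
      simp only [TC, KR]
      simp only [div_mul_eq_mul_div, mul_div_assoc', div_div]
      rw [div_eq_div_iff (by repeat' apply mul_ne_zero
                             all_goals first | exact ha _ | exact hne _ _)
        (by repeat' apply mul_ne_zero
            all_goals first | exact ha _ | exact hne _ _)]
      ring
    simp only [Finset.prod_mul_distrib] at key ⊢
    calc _ = (∏ i, TC hl au eu g h z M N S i) * (∏ i, TC hl au eu f z x M' N' S' i) *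
          (Bet eu g h * Bet eu f z) := by ring
      _ = _ := by rw [key]; ring
  · push Not at h0
    obtain ⟨i, hi⟩ := h0
    have hT : TT hl au eu g h z M N S i = 0 := by
      by_cases h1 : hl (N i) (S i) (h i) = 0
      · simp [TT, TC, h1]
      by_cases h2 : hl (M i) (N i) (z i) = 0
      · simp [TT, TC, h2]
      simp [TT, TC, hi h1 h2]
    rw [Finset.prod_eq_zero (Finset.mem_univ i) hT, zero_mul]
    symm
    by_cases h1 : hl (N i) (S i) (h i) = 0
    · rw [Finset.prod_eq_zero (Finset.mem_univ i)]
      · simp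
      · simp [KR, h1]
    by_cases h2 : hl (M i) (N i) (z i) = 0
    · apply mul_eq_zero_of_right
      rw [Finset.prod_eq_zero (Finset.mem_univ i)]
      simp [h2]
    · rw [Finset.prod_eq_zero (Finset.mem_univ i)]
      · simp
      · simp [KR, hi h1 h2]

/-- right side of Green's formula -/
def GRS (X Y U V : C) (q : C × C × C × C) : ℝ≥0 :=
  hl q.1 q.2.1 X * hl q.2.2.1 q.2.2.2 Y * hl q.1 q.2.2.1 U * hl q.2.1 q.2.2.2 V *
    (au q.1 * au q.2.1 * au q.2.2.1 * au q.2.2.2) /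
    (eu q.1 q.2.2.2 * (au X * au Y * au U * au V))

/-- canonical local coefficient -/
def K2 (f x : ZMod τ → C) (S N' A B P D : ZMod τ → C) (i : ZMod τ) : ℝ≥0 :=
  (au (S i) * au (N' i) * au (A i) * au (B i) * au (P i) * au (D i)) / au (x i) /
    (eu (f i) (S i) * eu (S (i + 1)) (D i) * eu (A i) (N' i) * eu (P i) (N' i) * eu (A i) (D i) *
      eu (S (i + 1)) (N' i) * eu (S (i + 1)) (P i) *
      (eu (A i) (A (i - 1)) * eu (B i) (A (i - 1)) * eu (P i) (A (i - 1)) * eu (D i) (A (i - 1)) *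
        eu (S (i + 1)) (A (i - 1))) *
      (eu (A i) (P (i - 1)) * eu (B i) (P (i - 1)) * eu (P i) (P (i - 1)) * eu (D i) (P (i - 1)) *
        eu (S (i + 1)) (P (i - 1))))

lemma coefL (ha : ∀ a, au a ≠ 0) (hne : ∀ a b, eu a b ≠ 0)
    (hE1 : ∀ a b c Z, hl a b c ≠ 0 → eu c Z = eu a Z * eu b Z)
    (hE2 : ∀ a b c Z, hl a b c ≠ 0 → eu Z c = eu Z a * eu Z b)
    (f g h x M N S M' N' S' A B P D : ZMod τ → C) :
    (∏ i, KL hl au eu f g h x M N S M' N' S' i) *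
      (∏ i, GRS hl au eu (M i) (N i) (S' (i + 1)) (M' i) (A i, B i, P i, D i)) =
    (∏ i, K2 au eu f x S N' A B P D i) *
      ∏ i, ((hl (S (i + 1)) (M i) (f i) * hl (A i) (B i) (M i)) *
        (hl (N i) (S i) (g i) * hl (P i) (D i) (N i)) *
        (hl (N' i) (S' i) (h i) * hl (A (i - 1)) (P (i - 1)) (S' i)) *
        (hl (M' i) (N' i) (x i) * hl (B i) (D i) (M' i))) := by
  have sh : ∏ i, hl (A i) (P i) (S' (i + 1)) = ∏ i, hl (A (i - 1)) (P (i - 1)) (S' i) := by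
    rw [← prod_shift (fun i => hl (A (i - 1)) (P (i - 1)) (S' i))]
    simp
  have e1 : ∏ i, ((hl (S (i + 1)) (M i) (f i) * hl (A i) (B i) (M i)) *
        (hl (N i) (S i) (g i) * hl (P i) (D i) (N i)) *
        (hl (N' i) (S' i) (h i) * hl (A (i - 1)) (P (i - 1)) (S' i)) *
        (hl (M' i) (N' i) (x i) * hl (B i) (D i) (M' i))) =
      ∏ i, ((hl (S (i + 1)) (M i) (f i) * hl (A i) (B i) (M i)) *
        (hl (N i) (S i) (g i) * hl (P i) (D i) (N i)) *
        (hl (N' i) (S' i) (h i) * hl (A i) (P i) (S' (i + 1))) *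
        (hl (M' i) (N' i) (x i) * hl (B i) (D i) (M' i))) := by
    simp only [Finset.prod_mul_distrib, sh]
  rw [e1, ← Finset.prod_mul_distrib, ← Finset.prod_mul_distrib]
  by_cases h0 : ∀ i, ((hl (S (i + 1)) (M i) (f i) * hl (A i) (B i) (M i)) *
        (hl (N i) (S i) (g i) * hl (P i) (D i) (N i)) *
        (hl (N' i) (S' i) (h i) * hl (A i) (P i) (S' (i + 1))) *
        (hl (M' i) (N' i) (x i) * hl (B i) (D i) (M' i))) ≠ 0
  · refine Finset.prod_congr rfl fun i _ => ?_
    have hi := h0 i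
    have hj := h0 (i - 1)
    simp only [mul_ne_zero_iff, sub_add_cancel] at hi hj
    obtain ⟨⟨⟨⟨b1, b2⟩, b3, b4⟩, b5, b6⟩, b7, b8⟩ := hi
    have c6 := hj.1.2.2
    have d1 : eu (S (i + 1)) (N i) = _ := hE2 _ _ _ _ b4
    have d2 : ∀ Z, eu Z (S' i) = _ := fun Z => hE2 _ _ _ _ c6
    have d3 : ∀ Z, eu (M i) Z = _ := fun Z => hE1 _ _ _ _ b2
    have d4 : ∀ Z, eu (N i) Z = _ := fun Z => hE1 _ _ _ _ b4
    have d5 : eu (S' (i + 1)) (N' i) = _ := hE1 _ _ _ _ b6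
    have d6 : ∀ Z, eu Z (h i) = _ := fun Z => hE2 _ _ _ _ b5
    have h1 : ∀ a b, (eu a b)⁻¹ * eu a b = 1 := fun a b => inv_mul_cancel₀ (hne _ _)
    have k1 := ha (M i)
    have k2 := ha (N i)
    have k3 := ha (M' i)
    have k4 := ha (S' (i + 1))
    simp only [KL, GRS, K2]
    rw [d1, d3, d4, d5, d6]
    simp only [d2]
    simp only [div_mul_eq_mul_div, mul_div_assoc', div_div]
    rw [div_eq_div_iff (by repeat' apply mul_ne_zero
                           all_goals first | exact ha _ | exact hne _ _)
      (by repeat' apply mul_ne_zero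
          all_goals first | exact ha _ | exact hne _ _)]
    ring
  · push Not at h0
    obtain ⟨i, hi⟩ := h0
    rw [Finset.prod_eq_zero (Finset.mem_univ i), Finset.prod_eq_zero (Finset.mem_univ i)]
    · rw [hi, mul_zero]
    · simp only [mul_eq_zero] at hi
      simp only [KL, GRS]
      rcases hi with (((hi | hi) | hi | hi) | hi | hi) | hi | hi <;> simp [hi]

lemma coefR (ha : ∀ a, au a ≠ 0) (hne : ∀ a b, eu a b ≠ 0)
    (hE1 : ∀ a b c Z, hl a b c ≠ 0 → eu c Z = eu a Z * eu b Z)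
    (hE2 : ∀ a b c Z, hl a b c ≠ 0 → eu Z c = eu Z a * eu Z b)
    (f g h x M N N' S' S T A B P D : ZMod τ → C) :
    (∏ i, KR hl au eu f g h x M N (fun i => P (i - 1)) B N' S' i) *
      (∏ i, GRS hl au eu (M i) (N i) (N' i) (S' i) (D i, S i, T i, A (i - 1))) =
    (∏ i, K2 au eu f x S T A B P D i) *
      ∏ i, ((hl (S' (i + 1)) (B i) (f i) * hl (S (i + 1)) (A i) (S' (i + 1))) *
        (hl (P i) (M i) (g i) * hl (D i) (S i) (M i)) *
        (hl (N i) (P (i - 1)) (h i) * hl (T i) (A (i - 1)) (N i)) *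
        (hl (B i) (N' i) (x i) * hl (D i) (T i) (N' i))) := by
  have sh : ∏ i, hl (S (i + 1)) (A i) (S' (i + 1)) = ∏ i, hl (S i) (A (i - 1)) (S' i) := by
    rw [← prod_shift (fun i => hl (S i) (A (i - 1)) (S' i))]
    simp
  have e1 : ∏ i, ((hl (S' (i + 1)) (B i) (f i) * hl (S (i + 1)) (A i) (S' (i + 1))) *
        (hl (P i) (M i) (g i) * hl (D i) (S i) (M i)) *
        (hl (N i) (P (i - 1)) (h i) * hl (T i) (A (i - 1)) (N i)) *
        (hl (B i) (N' i) (x i) * hl (D i) (T i) (N' i))) =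
      ∏ i, ((hl (S' (i + 1)) (B i) (f i) * hl (S i) (A (i - 1)) (S' i)) *
        (hl (P i) (M i) (g i) * hl (D i) (S i) (M i)) *
        (hl (N i) (P (i - 1)) (h i) * hl (T i) (A (i - 1)) (N i)) *
        (hl (B i) (N' i) (x i) * hl (D i) (T i) (N' i))) := by
    simp only [Finset.prod_mul_distrib, sh]
  rw [e1, ← Finset.prod_mul_distrib, ← Finset.prod_mul_distrib]
  by_cases h0 : ∀ i, ((hl (S' (i + 1)) (B i) (f i) * hl (S i) (A (i - 1)) (S' i)) *
        (hl (P i) (M i) (g i) * hl (D i) (S i) (M i)) *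
        (hl (N i) (P (i - 1)) (h i) * hl (T i) (A (i - 1)) (N i)) *
        (hl (B i) (N' i) (x i) * hl (D i) (T i) (N' i))) ≠ 0
  · refine prod_shift_cancel _ _
      (fun i => eu (S i) (P (i - 1)) * au (A i) * au (P i))
      (fun i => eu (S (i + 1)) (P i) * au (A (i - 1)) * au (P (i - 1))) ?_ ?_
      (fun i => mul_ne_zero (mul_ne_zero (hne _ _) (ha _)) (ha _))
    · intro i
      have hi := h0 i
      have hj := h0 (i + 1)
      simp only [mul_ne_zero_iff, add_sub_cancel_right] at hi hj
      obtain ⟨⟨⟨⟨b1, b2⟩, b3, b4⟩, b5, b6⟩, b7, b8⟩ := hi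
      have c2 := hj.1.1.1.2
      have d1 : ∀ Z, eu (f i) Z = _ := fun Z => hE1 _ _ _ _ b1
      have d2 : ∀ Z, eu (S' (i + 1)) Z = _ := fun Z => hE1 _ _ _ _ c2
      have d3 : ∀ Z, eu (g i) Z = _ := fun Z => hE1 _ _ _ _ b3
      have d4 : ∀ Z, eu (M i) Z = _ := fun Z => hE1 _ _ _ _ b4
      have d5 : ∀ Z, eu Z (N i) = _ := fun Z => hE2 _ _ _ _ b6
      have d6 : ∀ Z, eu Z (N' i) = _ := fun Z => hE2 _ _ _ _ b8
      have d7 : ∀ Z, eu Z (S' i) = _ := fun Z => hE2 _ _ _ _ b2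
      have k1 := ha (M i)
      have k2 := ha (N i)
      have k3 := ha (S' i)
      have k4 := ha (N' i)
      simp only [KR, GRS, K2, add_sub_cancel_right]
      simp only [d7, d6, d5, d3, d4, d1, d2]
      simp only [div_mul_eq_mul_div, mul_div_assoc', div_div]
      rw [div_eq_div_iff (by repeat' apply mul_ne_zero
                             all_goals first | exact ha _ | exact hne _ _)
        (by repeat' apply mul_ne_zero
            all_goals first | exact ha _ | exact hne _ _)]
      ring
    · have s1 := prod_shift (fun i => eu (S i) (P (i - 1)))
      have s2 := prod_shift (fun i => au (A (i - 1)))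
      have s3 := prod_shift (fun i => au (P (i - 1)))
      simp only [add_sub_cancel_right] at s1 s2 s3
      simp only [Finset.prod_mul_distrib, s1, s2, s3]
  · push Not at h0
    obtain ⟨i, hi⟩ := h0
    rw [Finset.prod_eq_zero (Finset.mem_univ i), Finset.prod_eq_zero (Finset.mem_univ i)]
    · rw [hi, mul_zero]
    · simp only [mul_eq_zero] at hi
      simp only [KR, GRS, add_sub_cancel_right]
      rcases hi with (((hi | hi) | hi | hi) | hi | hi) | hi | hi <;> simp [hi]

end AbsAssoc

set_option linter.unusedSectionVars false

section AbsAssoc2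

open scoped NNReal ENNReal

lemma tsum_perm7L {a1 a2 a3 a4 a5 a6 a7 : Type} (F : a1 → a2 → a3 → a4 → a5 → a6 → a7 → ℝ≥0∞) :
    ∑' p : a1 × a2 × a3, ∑' p' : a4 × a5 × a6, ∑' q, F p.1 p.2.1 p.2.2 p'.1 p'.2.1 p'.2.2 q =
      ∑' r : a3 × a5 × a7, ∑' u : a1 × a2 × a6 × a4, F u.1 u.2.1 r.1 u.2.2.2 r.2.1 u.2.2.1 r.2.2 := by
  simp only [← ENNReal.tsum_prod]
  let e : ((a3 × a5 × a7) × (a1 × a2 × a6 × a4)) ≃ ((a1 × a2 × a3) × ((a4 × a5 × a6) × a7)) :=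
    { toFun := fun x => ((x.2.1, x.2.2.1, x.1.1), ((x.2.2.2.2, x.1.2.1, x.2.2.2.1), x.1.2.2))
      invFun := fun y => ((y.1.2.2, y.2.1.2.1, y.2.2), (y.1.1, y.1.2.1, y.2.1.2.2, y.2.1.1))
      left_inv := fun _ => rfl
      right_inv := fun _ => rfl }
  rw [← e.tsum_eq]
  rfl

lemma tsum_perm7R {a1 a2 a3 a4 a5 a6 a7 : Type} (F : a1 → a2 → a3 → a4 → a5 → a6 → a7 → ℝ≥0∞) :
    ∑' p : a1 × a2 × a3, ∑' p' : a4 × a5 × a6, ∑' q, F p.1 p.2.1 p.2.2 p'.1 p'.2.1 p'.2.2 q =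
      ∑' r : a3 × a4 × a7, ∑' u : a6 × a1 × a2 × a5, F u.2.1 u.2.2.1 r.1 r.2.1 u.2.2.2 u.1 r.2.2 := by
  simp only [← ENNReal.tsum_prod]
  let e : ((a3 × a4 × a7) × (a6 × a1 × a2 × a5)) ≃ ((a1 × a2 × a3) × ((a4 × a5 × a6) × a7)) :=
    { toFun := fun x => ((x.2.2.1, x.2.2.2.1, x.1.1), ((x.1.2.1, x.2.2.2.2, x.2.1), x.1.2.2))
      invFun := fun y => ((y.1.2.2, y.2.1.1, y.2.2), (y.2.1.2.2, y.1.1, y.1.2.1, y.2.1.2.1))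
      left_inv := fun _ => rfl
      right_inv := fun _ => rfl }
  rw [← e.tsum_eq]
  rfl

lemma fac4 {ι C : Type} [Fintype ι] (k : ℝ≥0) (a b c d : ι → C → ℝ≥0) :
    ∑' u : (ι → C) × (ι → C) × (ι → C) × (ι → C),
      ((k * ∏ i, (a i (u.1 i) * b i (u.2.1 i) * c i (u.2.2.1 i) * d i (u.2.2.2 i)) : ℝ≥0) : ℝ≥0∞) =
    k * ((∏ i, ∑' m, (a i m : ℝ≥0∞)) * (∏ i, ∑' m, (b i m : ℝ≥0∞)) * (∏ i, ∑' m, (c i m : ℝ≥0∞)) *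
      (∏ i, ∑' m, (d i m : ℝ≥0∞))) := by
  simp only [prod_tsum, ENNReal.coe_mul, Finset.prod_mul_distrib, ENNReal.ofNNReal_finsetProd]
  rw [ENNReal.tsum_mul_left]
  congr 1
  simp only [ENNReal.tsum_prod', ENNReal.tsum_mul_left, ENNReal.tsum_mul_right, mul_assoc]

variable {C : Type} {τ : ℕ} [NeZero τ] (hl : C → C → C → ℝ≥0) (au : C → ℝ≥0) (eu : C → C → ℝ≥0)

lemma expand_left (Z Y : (ZMod τ → C) → ((ZMod τ → C) × (ZMod τ → C) × (ZMod τ → C)) → ℝ≥0)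
    (K : ((ZMod τ → C) × (ZMod τ → C) × (ZMod τ → C)) → ((ZMod τ → C) × (ZMod τ → C) × (ZMod τ → C)) → ℝ≥0)
    (w : ((ZMod τ → C) × (ZMod τ → C) × (ZMod τ → C)) → ((ZMod τ → C) × (ZMod τ → C) × (ZMod τ → C)) →
      ZMod τ → C → ℝ≥0)
    (G : ((ZMod τ → C) × (ZMod τ → C) × (ZMod τ → C)) → ((ZMod τ → C) × (ZMod τ → C) × (ZMod τ → C)) →
      ZMod τ → C × C × C × C → ℝ≥0)
    (h1 : ∀ y p p', Z y p * Y y p' = K p p' * ∏ i, w p p' i (y i))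
    (h2 : ∀ p p' i, ∑' e, (w p p' i e : ℝ≥0∞) = ∑' q, (G p p' i q : ℝ≥0∞)) :
    ∑' y, (∑' p, (Z y p : ℝ≥0∞)) * (∑' p, (Y y p : ℝ≥0∞)) =
      ∑' p, ∑' p', ∑' q : ZMod τ → C × C × C × C, ((K p p' * ∏ i, G p p' i (q i) : ℝ≥0) : ℝ≥0∞) := by
  simp only [← ENNReal.tsum_mul_left, ← ENNReal.tsum_mul_right]
  rw [ENNReal.tsum_comm]
  conv_lhs => enter [1, p]; rw [ENNReal.tsum_comm]
  rw [ENNReal.tsum_comm]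
  congr 1; funext p; congr 1; funext p'
  simp only [← ENNReal.coe_mul, h1]
  simp only [ENNReal.coe_mul, ENNReal.tsum_mul_left, ENNReal.ofNNReal_finsetProd]
  rw [← prod_tsum (ZMod τ) (fun i e => (w p p' i e : ℝ≥0∞)),
    ← prod_tsum (ZMod τ) (fun i q => (G p p' i q : ℝ≥0∞))]
  simp only [h2]

/-- three term sum -/
def H3 (F P Q R : C) : ℝ≥0∞ := ∑' M, ((hl P M F * hl Q R M : ℝ≥0) : ℝ≥0∞)

/-- the canonical form of the triple product -/
def canon (f g h x S T : ZMod τ → C) (q : ZMod τ → C × C × C × C) : ℝ≥0∞ :=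
  (((∏ i, K2 au eu f x S T (fun i => (q i).1) (fun i => (q i).2.1) (fun i => (q i).2.2.1)
      (fun i => (q i).2.2.2) i) * (Bet eu f g * Bet eu f h * Bet eu g h) : ℝ≥0) : ℝ≥0∞) *
    ((∏ i, H3 hl (f i) (S (i + 1)) (q i).1 (q i).2.1) * (∏ i, H3 hl (g i) (q i).2.2.1 (q i).2.2.2 (S i)) *
      (∏ i, H3 hl (h i) (T i) (q (i - 1)).1 (q (i - 1)).2.2.1) *
      (∏ i, H3 hl (x i) (q i).2.1 (q i).2.2.2 (T i)))

lemma assocL (ha : ∀ a, au a ≠ 0) (hne : ∀ a b, eu a b ≠ 0)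
    (hE1 : ∀ a b c Z, hl a b c ≠ 0 → eu c Z = eu a Z * eu b Z)
    (hE2 : ∀ a b c Z, hl a b c ≠ 0 → eu Z c = eu Z a * eu Z b) (ht : Odd τ)
    (hG : ∀ X Y U V, ∑' E, ((hl X Y E * hl U V E / au E : ℝ≥0) : ℝ≥0∞) =
      ∑' q : C × C × C × C, (GRS hl au eu X Y U V q : ℝ≥0∞))
    (hA : ∀ F P Q R, H3 hl F P Q R = ∑' M, ((hl M R F * hl P Q M : ℝ≥0) : ℝ≥0∞))
    (f g h x : ZMod τ → C) :
    ∑' y, hE hl au eu f g y * hE hl au eu y h x =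
      ∑' r : (ZMod τ → C) × (ZMod τ → C) × (ZMod τ → C × C × C × C),
        canon hl au eu f g h x r.1 r.2.1 r.2.2 := by
  simp only [hE]
  rw [expand_left _ _
    (fun p p' => (∏ i, KL hl au eu f g h x p.1 p.2.1 p.2.2 p'.1 p'.2.1 p'.2.2 i) *
      (Bet eu f g * Bet eu f h * Bet eu g h))
    (fun p p' i e => hl (p.1 i) (p.2.1 i) e * hl (p'.2.2 (i + 1)) (p'.1 i) e / au e)
    (fun p p' i q => GRS hl au eu (p.1 i) (p.2.1 i) (p'.2.2 (i + 1)) (p'.1 i) q)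
    (fun y p p' => stepL hl au eu ha hne hE1 ht f g h x y _ _ _ _ _ _)
    (fun p p' i => hG _ _ _ _)]
  rw [tsum_perm7L (fun M N S M' N' S' (q : ZMod τ → C × C × C × C) => (((∏ i, KL hl au eu f g h x M N S M' N' S' i) *
      (Bet eu f g * Bet eu f h * Bet eu g h) *
      ∏ i, GRS hl au eu (M i) (N i) (S' (i + 1)) (M' i) (q i) : ℝ≥0) : ℝ≥0∞))]
  congr 1; funext r
  obtain ⟨S, T, q⟩ := r
  simp only [canon, H3]
  have hA' : ∀ F P Q R, _ := fun F P Q R => hA F P Q R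
  have e1 : ∀ i, H3 hl (g i) (q i).2.2.1 (q i).2.2.2 (S i) = _ := fun i => hA _ _ _ _
  have e2 : ∀ i, H3 hl (x i) (q i).2.1 (q i).2.2.2 (T i) = _ := fun i => hA _ _ _ _
  simp only [H3] at e1 e2
  simp only [e1, e2]
  rw [← fac4]
  congr 1; funext u
  congr 1
  have := coefL hl au eu ha hne hE1 hE2 f g h x u.1 u.2.1 S u.2.2.2 T u.2.2.1 (fun i => (q i).1)
    (fun i => (q i).2.1) (fun i => (q i).2.2.1) (fun i => (q i).2.2.2)
  rw [mul_right_comm, this]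
  rw [mul_right_comm]

/-- reindexing -/
def reidx : ((ZMod τ → C) × (ZMod τ → C) × (ZMod τ → C × C × C × C)) ≃
    ((ZMod τ → C) × (ZMod τ → C) × (ZMod τ → C × C × C × C)) where
  toFun r := (fun i => (r.2.2 (i - 1)).2.2.1, fun i => (r.2.2 i).2.1,
    fun i => ((r.2.2 i).2.2.2, r.1 i, r.2.1 i, (r.2.2 (i - 1)).1))
  invFun r := (fun i => (r.2.2 i).2.1, fun i => (r.2.2 i).2.2.1,
    fun i => ((r.2.2 (i + 1)).2.2.2, r.2.1 i, r.1 (i + 1), (r.2.2 i).1))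
  left_inv r := by simp
  right_inv r := by simp

lemma assocR (ha : ∀ a, au a ≠ 0) (hne : ∀ a b, eu a b ≠ 0)
    (hE1 : ∀ a b c Z, hl a b c ≠ 0 → eu c Z = eu a Z * eu b Z)
    (hE2 : ∀ a b c Z, hl a b c ≠ 0 → eu Z c = eu Z a * eu Z b) (ht : Odd τ)
    (hG : ∀ X Y U V, ∑' E, ((hl X Y E * hl U V E / au E : ℝ≥0) : ℝ≥0∞) =
      ∑' q : C × C × C × C, (GRS hl au eu X Y U V q : ℝ≥0∞))
    (hA : ∀ F P Q R, H3 hl F P Q R = ∑' M, ((hl M R F * hl P Q M : ℝ≥0) : ℝ≥0∞))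
    (f g h x : ZMod τ → C) :
    ∑' z, hE hl au eu g h z * hE hl au eu f z x =
      ∑' r : (ZMod τ → C) × (ZMod τ → C) × (ZMod τ → C × C × C × C),
        canon hl au eu f g h x r.1 r.2.1 r.2.2 := by
  simp only [hE]
  rw [expand_left _ _
    (fun p p' => (∏ i, KR hl au eu f g h x p.1 p.2.1 p.2.2 p'.1 p'.2.1 p'.2.2 i) *
      (Bet eu f g * Bet eu f h * Bet eu g h))
    (fun p p' i e => hl (p.1 i) (p.2.1 i) e * hl (p'.2.1 i) (p'.2.2 i) e / au e)
    (fun p p' i q => GRS hl au eu (p.1 i) (p.2.1 i) (p'.2.1 i) (p'.2.2 i) q)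
    (fun y p p' => stepR hl au eu ha hne hE2 ht f g h x y _ _ _ _ _ _)
    (fun p p' i => hG _ _ _ _)]
  rw [tsum_perm7R (fun M N S M' N' S' (q : ZMod τ → C × C × C × C) => (((∏ i, KR hl au eu f g h x M N S M' N' S' i) *
      (Bet eu f g * Bet eu f h * Bet eu g h) *
      ∏ i, GRS hl au eu (M i) (N i) (N' i) (S' i) (q i) : ℝ≥0) : ℝ≥0∞))]
  rw [← reidx.tsum_eq]
  congr 1; funext r
  obtain ⟨S, T, q⟩ := r
  simp only [canon, reidx, Equiv.coe_fn_mk]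
  have e1 : ∏ i, H3 hl (f i) (S (i + 1)) (q i).1 (q i).2.1 =
      ∏ i, H3 hl (f (i - 1)) (S i) (q (i - 1)).1 (q (i - 1)).2.1 := by
    rw [← prod_shift (fun i => H3 hl (f (i - 1)) (S i) (q (i - 1)).1 (q (i - 1)).2.1)]
    simp
  have e2 : ∀ i, H3 hl (f (i - 1)) (S i) (q (i - 1)).1 (q (i - 1)).2.1 = _ := fun i => hA _ _ _ _
  have e3 : ∀ i, H3 hl (h i) (T i) (q (i - 1)).1 (q (i - 1)).2.2.1 = _ := fun i => hA _ _ _ _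
  rw [e1]
  simp only [e2, e3]
  simp only [H3]
  rw [← fac4]
  congr 1; funext u
  congr 1
  have := coefR hl au eu ha hne hE1 hE2 f g h x u.2.1 u.2.2.1 u.2.2.2 u.1 S T (fun i => (q i).1)
    (fun i => (q i).2.1) (fun i => (q i).2.2.1) (fun i => (q i).2.2.2)
  rw [mul_right_comm, this, mul_right_comm]
  congr 1
  simp only [Finset.prod_mul_distrib]
  congr 4
  · rw [← prod_shift (fun i => hl (u.1 i) (q (i - 1)).2.1 (f (i - 1)))]
    simp
  · rw [← prod_shift (fun i => hl (S i) (q (i - 1)).1 (u.1 i))]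
    simp

theorem assoc_abs (ha : ∀ a, au a ≠ 0) (hne : ∀ a b, eu a b ≠ 0)
    (hE1 : ∀ a b c Z, hl a b c ≠ 0 → eu c Z = eu a Z * eu b Z)
    (hE2 : ∀ a b c Z, hl a b c ≠ 0 → eu Z c = eu Z a * eu Z b) (ht : Odd τ)
    (hG : ∀ X Y U V, ∑' E, ((hl X Y E * hl U V E / au E : ℝ≥0) : ℝ≥0∞) =
      ∑' q : C × C × C × C, (GRS hl au eu X Y U V q : ℝ≥0∞))
    (hA : ∀ F P Q R, H3 hl F P Q R = ∑' M, ((hl M R F * hl P Q M : ℝ≥0) : ℝ≥0∞))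
    (f g h x : ZMod τ → C) :
    ∑' y, hE hl au eu f g y * hE hl au eu y h x = ∑' z, hE hl au eu g h z * hE hl au eu f z x := by
  rw [assocL hl au eu ha hne hE1 hE2 ht hG hA, assocR hl au eu ha hne hE1 hE2 ht hG hA]

end AbsAssoc2

set_option linter.unusedSectionVars false

section Inst

open scoped NNReal ENNReal

variable {𝓐 : Type} [SmallCategory 𝓐] [Abelian 𝓐] [HasExt.{0} 𝓐]
  [hF : ∀ X Y : 𝓐, Finite (X ⟶ Y)] [hFE : ∀ X Y : 𝓐, Finite (Abelian.Ext X Y 1)]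
  [hH : ∀ X Y : 𝓐, Subsingleton (Abelian.Ext X Y 2)]

variable (𝓐) in
/-- Hall numbers of classes -/
def hlC (a b c : IsoCl 𝓐) : ℝ≥0 := (hall a.out b.out c.out : ℝ≥0)

variable (𝓐) in
/-- automorphism numbers of classes -/
def auC (a : IsoCl 𝓐) : ℝ≥0 := aN a.out

variable (𝓐) in
/-- Euler form of classes -/
def euC (a b : IsoCl 𝓐) : ℝ≥0 := eN a.out b.out

lemma hall_ne {a b c : 𝓐} : hall a b c ≠ 0 ↔ Nonempty (Ses b c a) := by
  have h := cc_ses b c a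
  constructor
  · intro h0
    by_contra hn
    rw [cc_empty (not_nonempty_iff.1 hn)] at h
    have := mul_ne_zero (mul_ne_zero (Nat.cast_ne_zero (R := ℝ≥0∞).2 h0) (aE_pos a)) (aE_pos b)
    exact this h.symm
  · intro hn h0
    have := cc_pos (Ses b c a)
    rw [h, h0] at this
    simp at this

lemma hlC_ne {a b c : IsoCl 𝓐} : hlC 𝓐 a b c ≠ 0 ↔ Nonempty (Ses b.out c.out a.out) := by
  rw [← hall_ne, hlC, Nat.cast_ne_zero]

lemma auC_ne (a : IsoCl 𝓐) : auC 𝓐 a ≠ 0 := aN_ne _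

lemma euC_ne (a b : IsoCl 𝓐) : euC 𝓐 a b ≠ 0 := eN_ne _ _

lemma euC_left (a b c Z : IsoCl 𝓐) (h : hlC 𝓐 a b c ≠ 0) :
    euC 𝓐 c Z = euC 𝓐 a Z * euC 𝓐 b Z := by
  obtain ⟨s⟩ := hlC_ne.1 h
  exact eN_left s.2 _

lemma euC_right (a b c Z : IsoCl 𝓐) (h : hlC 𝓐 a b c ≠ 0) :
    euC 𝓐 Z c = euC 𝓐 Z a * euC 𝓐 Z b := by
  obtain ⟨s⟩ := hlC_ne.1 h
  exact eN_right s.2 _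

lemma assocC (F P Q R : IsoCl 𝓐) : H3 (hlC 𝓐) F P Q R =
    ∑' M, ((hlC 𝓐 M R F * hlC 𝓐 P Q M : ℝ≥0) : ℝ≥0∞) := by
  have := hall_assoc F.out P.out Q.out R.out
  simpa [H3, hlC] using this

lemma greenC (X Y U V : IsoCl 𝓐) :
    ∑' E, ((hlC 𝓐 X Y E * hlC 𝓐 U V E / auC 𝓐 E : ℝ≥0) : ℝ≥0∞) =
      ∑' q : IsoCl 𝓐 × IsoCl 𝓐 × IsoCl 𝓐 × IsoCl 𝓐, (GRS (hlC 𝓐) (auC 𝓐) (euC 𝓐) X Y U V q : ℝ≥0∞) := by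
  have h := green X.out Y.out U.out V.out
  simp only [Cross, Frame, cc_prod, cc_ses, aE_coe] at h
  have hk : auC 𝓐 X * auC 𝓐 Y * auC 𝓐 U * auC 𝓐 V ≠ 0 :=
    mul_ne_zero (mul_ne_zero (mul_ne_zero (auC_ne _) (auC_ne _)) (auC_ne _)) (auC_ne _)
  have hk' : ((auC 𝓐 X * auC 𝓐 Y * auC 𝓐 U * auC 𝓐 V : ℝ≥0) : ℝ≥0∞) ≠ 0 := ENNReal.coe_ne_zero.2 hk
  rw [← ENNReal.mul_right_inj hk' ENNReal.coe_ne_top, ← ENNReal.tsum_mul_left, ← ENNReal.tsum_mul_left]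
  refine Eq.trans ?_ (h.trans ?_)
  · congr 1; funext E
    rw [← ENNReal.coe_mul, ← ENNReal.coe_natCast, ← ENNReal.coe_natCast, ← ENNReal.coe_inv (aN_ne _)]
    simp only [← ENNReal.coe_mul]
    congr 1
    simp only [hlC, auC, div_eq_mul_inv]
    push_cast
    ring
  · congr 1; funext q
    rw [← ENNReal.coe_mul]
    rw [← ENNReal.coe_inv (aN_ne _), ← ENNReal.coe_inv (aN_ne _), ← ENNReal.coe_inv (aN_ne _),
      ← ENNReal.coe_inv (aN_ne _)]
    simp only [← ENNReal.coe_natCast, ← ENNReal.coe_mul]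
    congr 1
    have e1 : ∀ a : 𝓐, (aN a)⁻¹ * aN a = 1 := fun a => inv_mul_cancel₀ (aN_ne a)
    have b1 := aN_ne q.1.out
    have b2 := aN_ne q.2.1.out
    have b3 := aN_ne q.2.2.1.out
    have b4 := aN_ne q.2.2.2.out
    have b5 := eN_ne q.1.out q.2.2.2.out
    have b6 := aN_ne X.out
    have b7 := aN_ne Y.out
    have b8 := aN_ne U.out
    have b9 := aN_ne V.out
    simp only [hlC, auC, euC, GRS]
    push_cast
    generalize aN q.1.out = x1 at *
    generalize aN q.2.1.out = x2 at *
    generalize aN q.2.2.1.out = x3 at *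
    generalize aN q.2.2.2.out = x4 at *
    generalize eN q.1.out q.2.2.2.out = x5 at *
    generalize aN X.out = x6 at *
    generalize aN Y.out = x7 at *
    generalize aN U.out = x8 at *
    generalize aN V.out = x9 at *
    simp only [← div_eq_mul_inv, ← one_div, div_mul_div_comm, one_mul, div_mul_eq_mul_div, mul_div_assoc', div_div, mul_one]
    rw [div_eq_div_iff (by repeat' apply mul_ne_zero
                           all_goals assumption)
      (by repeat' apply mul_ne_zero
          all_goals assumption)]
    ring

variable {τ : ℕ} [NeZero τ]

variable (𝓐) in
/-- extended structure constants -/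
abbrev hEC (f g x : ZMod τ → IsoCl 𝓐) : ℝ≥0∞ := hE (hlC 𝓐) (auC 𝓐) (euC 𝓐) f g x

lemma assoc_hEC (ht : Odd τ) (f g h x : ZMod τ → IsoCl 𝓐) :
    ∑' y, hEC 𝓐 f g y * hEC 𝓐 y h x = ∑' z, hEC 𝓐 g h z * hEC 𝓐 f z x :=
  assoc_abs (hlC 𝓐) (auC 𝓐) (euC 𝓐) auC_ne euC_ne euC_left euC_right ht greenC assocC f g h x

lemma fin_ext (a b : IsoCl 𝓐) : {c : IsoCl 𝓐 | hlC 𝓐 a b c ≠ 0}.Finite := by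
  let Φ : Abelian.Ext a.out b.out 1 → IsoCl 𝓐 := fun α => cl (exists_isSES α).choose
  refine (Set.finite_range Φ).subset ?_
  intro c hc
  obtain ⟨s⟩ := hlC_ne.1 hc
  refine ⟨s.2.cls, ?_⟩
  obtain ⟨i, p, h, hh⟩ := (exists_isSES s.2.cls).choose_spec
  obtain ⟨y, hy1, hy2⟩ := (lift_iff s.2 h (𝟙 _)).2 (by rw [hh]; simp)
  have : IsIso y := isIso_of_lift s.2 h y hy1 (by simpa using hy2)
  exact (out_cl_eq ⟨(asIso y).symm⟩).symm

lemma fin_img (f g : IsoCl 𝓐) :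
    {q : IsoCl 𝓐 × IsoCl 𝓐 × IsoCl 𝓐 | hlC 𝓐 q.1 q.2.1 f ≠ 0 ∧ hlC 𝓐 q.2.2 q.1 g ≠ 0}.Finite := by
  let Φ : (f.out ⟶ g.out) → IsoCl 𝓐 × IsoCl 𝓐 × IsoCl 𝓐 :=
    fun φ => (cl (Abelian.image φ), cl (kernel φ), cl (cokernel φ))
  refine (Set.finite_range Φ).subset ?_
  rintro ⟨s, m, n⟩ ⟨h1, h2⟩
  obtain ⟨u⟩ := hlC_ne.1 h1
  obtain ⟨v⟩ := hlC_ne.1 h2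
  have hu := u.2
  have hv := v.2
  have := hu.epi
  have := hu.mono
  have := hv.epi
  have := hv.mono
  refine ⟨u.1.2 ≫ v.1.1, ?_⟩
  have k1 : IsSES u.1.1 u.1.2 := hu
  have c1 : IsSES v.1.1 v.1.2 := hv
  have kk : IsSES (kernel.ι (u.1.2 ≫ v.1.1)) u.1.2 := by
    refine IsSES.mk_of_lift ?_ inferInstance inferInstance ?_
    · rw [← cancel_mono v.1.1]; simp
    · intro W k hk
      exact ⟨kernel.lift _ k (by rw [reassoc_of% hk, zero_comp]), by simp⟩
  have cc' : IsSES v.1.1 (cokernel.π (u.1.2 ≫ v.1.1)) := by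
    refine IsSES.mk_of_desc ?_ inferInstance inferInstance ?_
    · rw [← cancel_epi u.1.2]; rw [← Category.assoc, cokernel.condition, comp_zero]
    · intro W k hk
      exact ⟨cokernel.desc _ k (by simp [hk]), by simp⟩
  have ii : IsSES (Abelian.image.ι (u.1.2 ≫ v.1.1)) (cokernel.π (u.1.2 ≫ v.1.1)) :=
    IsSES.of_epi _
  obtain ⟨e1, _⟩ := kk.unique k1 kk.w k1.w
  obtain ⟨_, e2, _⟩ := cc'.unique c1 c1.w cc'.w
  obtain ⟨e3, _⟩ := ii.unique cc' ii.w cc'.w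
  refine Prod.ext ?_ (Prod.ext ?_ ?_)
  · exact (out_cl_eq ⟨e3⟩).symm
  · exact (out_cl_eq ⟨e1⟩).symm
  · exact (out_cl_eq ⟨e2⟩).symm

variable (𝓐) in
/-- triples of functions -/
abbrev Tri (τ : ℕ) := (ZMod τ → IsoCl 𝓐) × (ZMod τ → IsoCl 𝓐) × (ZMod τ → IsoCl 𝓐)

variable (𝓐) in
/-- terms -/
abbrev tm (f g x : ZMod τ → IsoCl 𝓐) (p : Tri 𝓐 τ) : ℝ≥0 :=
  ∏ i, TT (hlC 𝓐) (auC 𝓐) (euC 𝓐) f g x p.1 p.2.1 p.2.2 i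

lemma tm_ne {f g x : ZMod τ → IsoCl 𝓐} {p : Tri 𝓐 τ} (h : tm 𝓐 f g x p ≠ 0) (i : ZMod τ) :
    hlC 𝓐 (p.2.1 i) (p.2.2 i) (g i) ≠ 0 ∧ hlC 𝓐 (p.1 i) (p.2.1 i) (x i) ≠ 0 ∧
      hlC 𝓐 (p.2.2 (i + 1)) (p.1 i) (f i) ≠ 0 := by
  have := Finset.prod_ne_zero_iff.1 h i (Finset.mem_univ i)
  refine ⟨?_, ?_, ?_⟩ <;>
  · intro h0
    apply this
    simp [TT, TC, h0]

lemma fin_tri (f g : ZMod τ → IsoCl 𝓐) :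
    {p : Tri 𝓐 τ | ∃ x, tm 𝓐 f g x p ≠ 0}.Finite := by
  let Ψ : Tri 𝓐 τ → (ZMod τ → IsoCl 𝓐 × IsoCl 𝓐 × IsoCl 𝓐) :=
    fun p i => (p.2.2 (i + 1), p.1 i, p.2.1 (i + 1))
  have hΨ : Function.Injective Ψ := by
    rintro ⟨a, b, c⟩ ⟨a', b', c'⟩ h
    have h' : ∀ i, (c (i + 1), a i, b (i + 1)) = (c' (i + 1), a' i, b' (i + 1)) := fun i => congrFun h i
    simp only [Prod.mk.injEq] at h'
    refine Prod.ext (funext fun i => (h' i).2.1) (Prod.ext (funext fun i => ?_) (funext fun i => ?_))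
    · have := (h' (i - 1)).2.2; simpa using this
    · have := (h' (i - 1)).1; simpa using this
  have := Set.Finite.pi' (fun i : ZMod τ => fin_img (f i) (g (i + 1)))
  refine (this.preimage (hΨ.injOn)).subset ?_
  rintro p ⟨x, hx⟩ i
  exact ⟨(tm_ne hx i).2.2, (tm_ne hx (i + 1)).1⟩

lemma fin_supp (f g : ZMod τ → IsoCl 𝓐) : {x | ∃ p : Tri 𝓐 τ, tm 𝓐 f g x p ≠ 0}.Finite := by
  have : {x | ∃ p : Tri 𝓐 τ, tm 𝓐 f g x p ≠ 0} ⊆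
      ⋃ p ∈ {p : Tri 𝓐 τ | ∃ x, tm 𝓐 f g x p ≠ 0}, {x | ∀ i, x i ∈ {c | hlC 𝓐 (p.1 i) (p.2.1 i) c ≠ 0}} := by
    rintro x ⟨p, hp⟩
    refine Set.mem_biUnion (x := p) ⟨x, hp⟩ ?_
    intro i
    exact (tm_ne hp i).2.1
  refine Set.Finite.subset ?_ this
  exact (fin_tri f g).biUnion fun p _ => Set.Finite.pi' fun i => fin_ext _ _

lemma hEC_ne_top (f g x : ZMod τ → IsoCl 𝓐) : hEC 𝓐 f g x ≠ ⊤ := by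
  have h := (fin_tri f g).subset (t := {p | tm 𝓐 f g x p ≠ 0}) (fun p hp => ⟨x, hp⟩)
  have : hEC 𝓐 f g x = ∑ p ∈ h.toFinset, (tm 𝓐 f g x p : ℝ≥0∞) := by
    refine tsum_eq_sum fun p hp => ?_
    have h0 : tm 𝓐 f g x p = 0 := by
      by_contra hc
      exact hp (h.mem_toFinset.2 hc)
    change ((tm 𝓐 f g x p : ℝ≥0) : ℝ≥0∞) = 0
    rw [h0]; rfl
  rw [this]
  exact ENNReal.sum_ne_top.2 fun _ _ => ENNReal.coe_ne_top

lemma hEC_supp (f g : ZMod τ → IsoCl 𝓐) : {x | hEC 𝓐 f g x ≠ 0}.Finite := by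
  refine (fin_supp f g).subset ?_
  intro x hx
  by_contra hn
  apply hx
  simp only [Set.mem_setOf_eq, not_exists, not_not] at hn
  exact ENNReal.tsum_eq_zero.2 fun p => by exact_mod_cast hn p

lemma hconstR_eq (f g x : ZMod τ → IsoCl 𝓐) : hconstR f g x = (hEC 𝓐 f g x).toReal := by
  have hfin := (fin_tri f g).subset (t := {p | tm 𝓐 f g x p ≠ 0}) (fun p hp => ⟨x, hp⟩)
  have hs : (Function.support fun p : Tri 𝓐 τ => ((tm 𝓐 f g x p : ℝ≥0) : ℝ)).Finite := by
    refine hfin.subset fun p hp h0 => hp ?_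
    change ((tm 𝓐 f g x p : ℝ≥0) : ℝ) = 0
    rw [h0]; rfl
  rw [hEC, hE, ENNReal.tsum_toReal_eq (fun _ => ENNReal.coe_ne_top)]
  simp only [ENNReal.coe_toReal]
  rw [tsum_eq_finsum hs, finsum_curry _ hs, hconstR]
  refine finsum_congr fun M => ?_
  rw [finsum_curry]
  · refine finsum_congr fun N => finsum_congr fun S => ?_
    rw [NNReal.coe_prod]
    refine Finset.prod_congr rfl fun i _ => ?_
    simp only [TT, TC, Bfac, hlC, auC, euC, aN, ← eN_coe]
    push_cast
    rfl
  · have : Function.Injective (fun q : (ZMod τ → IsoCl 𝓐) × (ZMod τ → IsoCl 𝓐) => ((M, q) : Tri 𝓐 τ)) :=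
      fun a b h => (Prod.ext_iff.1 h).2
    exact hs.preimage this.injOn

theorem assoc_hconst (ht : Odd τ) (f g h x : ZMod τ → IsoCl 𝓐) :
    ∑ᶠ y, hconstR f g y * hconstR y h x = ∑ᶠ z, hconstR g h z * hconstR f z x := by
  have h1 := congrArg ENNReal.toReal (assoc_hEC ht f g h x)
  rw [ENNReal.tsum_toReal_eq (fun _ => ENNReal.mul_ne_top (hEC_ne_top _ _ _) (hEC_ne_top _ _ _)),
    ENNReal.tsum_toReal_eq (fun _ => ENNReal.mul_ne_top (hEC_ne_top _ _ _) (hEC_ne_top _ _ _))] at h1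
  rw [tsum_eq_finsum, tsum_eq_finsum] at h1
  · simpa only [ENNReal.toReal_mul, ← hconstR_eq] using h1
  · refine (hEC_supp g h).subset fun z hz => ?_
    intro h0
    apply hz
    simp [h0]
  · refine (hEC_supp f g).subset fun z hz => ?_
    intro h0
    apply hz
    simp [h0]

lemma hconst_supp (f g : ZMod τ → IsoCl 𝓐) : (Function.support (hconstR f g)).Finite := by
  refine (hEC_supp f g).subset fun z hz => ?_
  intro h0
  apply hz
  rw [hconstR_eq, h0]; simp

end Inst

set_option linter.unusedSectionVars false

section UnitPart

open scoped NNReal ENNReal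

variable {𝓐 : Type} [SmallCategory 𝓐] [Abelian 𝓐] [HasExt.{0} 𝓐]
  [hF : ∀ X Y : 𝓐, Finite (X ⟶ Y)] [hFE : ∀ X Y : 𝓐, Finite (Abelian.Ext X Y 1)]
  [hH : ∀ X Y : 𝓐, Subsingleton (Abelian.Ext X Y 2)]

lemma hall_zero_sub {b c : 𝓐} (hb : IsZero b) : hall c b c = 1 := by
  rw [hall, Nat.card_eq_one_iff_unique]
  refine ⟨⟨?_⟩, ⟨⟨⊥, ?_⟩⟩⟩
  · rintro ⟨S, ⟨e⟩, -⟩ ⟨T, ⟨e'⟩, -⟩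
    have h : ∀ S : Subobject c, Nonempty ((S : 𝓐) ≅ b) → S = ⊥ := by
      rintro S ⟨e⟩
      have : S.arrow = 0 := (hb.of_iso e).eq_of_src _ _
      rw [← Subobject.mk_arrow S, Subobject.mk_eq_bot_iff_zero]
      exact this
    exact Subtype.ext ((h S ⟨e⟩).trans (h T ⟨e'⟩).symm)
  · refine ⟨⟨Subobject.botCoeIsoZero ≪≫ (hb.iso (isZero_zero 𝓐)).symm⟩, ⟨?_⟩⟩
    exact cokernelIsoOfEq (Subobject.bot_arrow) ≪≫ cokernelZeroIsoTarget

lemma hall_zero_quot {a c : 𝓐} (ha : IsZero a) : hall a c c = 1 := by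
  rw [hall, Nat.card_eq_one_iff_unique]
  refine ⟨⟨?_⟩, ⟨⟨⊤, ?_⟩⟩⟩
  · rintro ⟨S, -, ⟨e⟩⟩ ⟨T, -, ⟨e'⟩⟩
    have h : ∀ S : Subobject c, Nonempty (cokernel S.arrow ≅ a) → S = ⊤ := by
      rintro S ⟨e⟩
      have : cokernel.π S.arrow = 0 := (ha.of_iso e).eq_of_tgt _ _
      have : Epi S.arrow := Preadditive.epi_of_cokernel_zero this
      have : IsIso S.arrow := isIso_of_mono_of_epi _
      exact Subobject.eq_top_of_isIso_arrow _
    exact Subtype.ext ((h S ⟨e⟩).trans (h T ⟨e'⟩).symm)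
  · refine ⟨⟨asIso (⊤ : Subobject c).arrow⟩, ⟨?_⟩⟩
    exact (IsZero.of_epi_eq_zero (cokernel.π (⊤ : Subobject c).arrow) (by
      rw [← cancel_epi (⊤ : Subobject c).arrow]; simp)).iso ha

variable (𝓐) in
/-- class of zero -/
abbrev oC : IsoCl 𝓐 := cl (0 : 𝓐)

lemma oC_zero : IsZero (oC 𝓐).out := by
  obtain ⟨e⟩ := out_iso (0 : 𝓐)
  exact (isZero_zero 𝓐).of_iso e

lemma eq_oC {a : IsoCl 𝓐} (h : IsZero a.out) : a = oC 𝓐 :=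
  out_cl_eq ⟨((isZero_zero 𝓐).iso h)⟩

lemma hlC_sub (c : IsoCl 𝓐) : hlC 𝓐 c (oC 𝓐) c = 1 := by
  rw [hlC, hall_zero_sub oC_zero]; simp

lemma hlC_quot (c : IsoCl 𝓐) : hlC 𝓐 (oC 𝓐) c c = 1 := by
  rw [hlC, hall_zero_quot oC_zero]; simp

lemma hlC_sub_ne {a c : IsoCl 𝓐} (h : hlC 𝓐 a (oC 𝓐) c ≠ 0) : a = c := by
  obtain ⟨⟨i, p⟩, hs⟩ := hlC_ne.1 h
  have hs : IsSES i p := hs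
  have := hs.epi
  have : Mono p := by
    refine Preadditive.mono_of_cancel_zero _ fun k hk => ?_
    obtain ⟨l, hl⟩ := hs.lift k hk
    rw [← hl, oC_zero.eq_of_tgt l 0, zero_comp]
  have : IsIso p := isIso_of_mono_of_epi _
  rw [← cl_out a, ← cl_out c]
  exact cl_eq_iff.2 ⟨(asIso p).symm⟩

lemma hlC_quot_ne {b c : IsoCl 𝓐} (h : hlC 𝓐 (oC 𝓐) b c ≠ 0) : b = c := by
  obtain ⟨⟨i, p⟩, hs⟩ := hlC_ne.1 h
  have hs : IsSES i p := hs
  have := hs.mono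
  have : Epi i := by
    refine Preadditive.epi_of_cancel_zero _ fun k hk => ?_
    obtain ⟨l, hl⟩ := hs.desc k hk
    rw [← hl, oC_zero.eq_of_src l 0, comp_zero]
  have : IsIso i := isIso_of_mono_of_epi _
  rw [← cl_out b, ← cl_out c]
  exact cl_eq_iff.2 ⟨(asIso i)⟩

lemma hlC_mid_ne {a b : IsoCl 𝓐} (h : hlC 𝓐 a b (oC 𝓐) ≠ 0) : a = oC 𝓐 ∧ b = oC 𝓐 := by
  obtain ⟨⟨i, p⟩, hs⟩ := hlC_ne.1 h
  have hs : IsSES i p := hs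
  have := hs.mono
  have := hs.epi
  exact ⟨eq_oC (IsZero.of_epi p oC_zero), eq_oC (IsZero.of_mono i oC_zero)⟩

lemma auC_o : auC 𝓐 (oC 𝓐) = 1 := by
  have : autCard (oC 𝓐).out = 1 := by
    rw [autCard, Nat.card_eq_one_iff_unique]
    exact ⟨⟨fun a b => Iso.ext (oC_zero.eq_of_src _ _)⟩, ⟨Iso.refl _⟩⟩
  rw [auC, aN, this]; simp

lemma euC_o_left (c : IsoCl 𝓐) : euC 𝓐 (oC 𝓐) c = 1 := by
  have := euC_left (oC 𝓐) (oC 𝓐) (oC 𝓐) c (by rw [hlC_sub]; exact one_ne_zero)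
  have h0 := euC_ne (oC 𝓐) c
  exact (mul_eq_left₀ h0).1 this.symm

lemma euC_o_right (c : IsoCl 𝓐) : euC 𝓐 c (oC 𝓐) = 1 := by
  have := euC_right (oC 𝓐) (oC 𝓐) (oC 𝓐) c (by rw [hlC_sub]; exact one_ne_zero)
  have h0 := euC_ne c (oC 𝓐)
  exact (mul_eq_left₀ h0).1 this.symm

variable {τ : ℕ} [NeZero τ]

lemma unit_hEC_left (f x : ZMod τ → IsoCl 𝓐) [Decidable (x = f)] :
    hEC 𝓐 (fun _ => oC 𝓐) f x = if x = f then 1 else 0 := by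
  have key : ∀ p : Tri 𝓐 τ, tm 𝓐 (fun _ => oC 𝓐) f x p ≠ 0 →
      p = (fun _ => oC 𝓐, f, fun _ => oC 𝓐) ∧ x = f := by
    rintro ⟨M, N, S⟩ hp
    have h := tm_ne hp
    simp only at h
    have hS : S = fun _ => oC 𝓐 := funext fun i => by
      have := (hlC_mid_ne (h (i - 1)).2.2).1; simpa using this
    have hM : M = fun _ => oC 𝓐 := funext fun i => (hlC_mid_ne (h i).2.2).2
    subst hS hM
    have hN : N = f := funext fun i => hlC_sub_ne (h i).1
    have hx : N = x := funext fun i => hlC_quot_ne (h i).2.1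
    exact ⟨by rw [hN], by rw [← hx, hN]⟩
  split_ifs with hx
  · subst hx
    rw [hEC, hE, tsum_eq_single ((fun _ => oC 𝓐, x, fun _ => oC 𝓐) : Tri 𝓐 τ)]
    · have : ∀ i, TT (hlC 𝓐) (auC 𝓐) (euC 𝓐) (fun _ => oC 𝓐) x x (fun _ => oC 𝓐) x (fun _ => oC 𝓐) i = 1 := by
        intro i
        simp [TT, TC, Bfac, hlC_sub, hlC_quot, auC_o, euC_o_left, euC_o_right, div_self (auC_ne _)]
      simp [this]
    · intro p hp
      by_contra hc
      exact hp (key p (fun h0 => hc (by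
        change ((tm 𝓐 (fun _ => oC 𝓐) x x p : ℝ≥0) : ℝ≥0∞) = 0
        rw [h0]; rfl))).1
  · refine ENNReal.tsum_eq_zero.2 fun p => ?_
    by_contra hc
    exact hx (key p (fun h0 => hc (by
        change ((tm 𝓐 (fun _ => oC 𝓐) f x p : ℝ≥0) : ℝ≥0∞) = 0
        rw [h0]; rfl))).2

lemma unit_hEC_right (f x : ZMod τ → IsoCl 𝓐) [Decidable (x = f)] :
    hEC 𝓐 f (fun _ => oC 𝓐) x = if x = f then 1 else 0 := by
  have key : ∀ p : Tri 𝓐 τ, tm 𝓐 f (fun _ => oC 𝓐) x p ≠ 0 →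
      p = (f, fun _ => oC 𝓐, fun _ => oC 𝓐) ∧ x = f := by
    rintro ⟨M, N, S⟩ hp
    have h := tm_ne hp
    simp only at h
    have hS : S = fun _ => oC 𝓐 := funext fun i => (hlC_mid_ne (h i).1).2
    have hN : N = fun _ => oC 𝓐 := funext fun i => (hlC_mid_ne (h i).1).1
    subst hS hN
    have hM : M = f := funext fun i => hlC_quot_ne (h i).2.2
    have hx : M = x := funext fun i => hlC_sub_ne (h i).2.1
    exact ⟨by rw [hM], by rw [← hx, hM]⟩
  split_ifs with hx
  · subst hx
    rw [hEC, hE, tsum_eq_single ((x, fun _ => oC 𝓐, fun _ => oC 𝓐) : Tri 𝓐 τ)]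
    · have : ∀ i, TT (hlC 𝓐) (auC 𝓐) (euC 𝓐) x (fun _ => oC 𝓐) x x (fun _ => oC 𝓐) (fun _ => oC 𝓐) i = 1 := by
        intro i
        simp [TT, TC, Bfac, hlC_sub, hlC_quot, auC_o, euC_o_left, euC_o_right, div_self (auC_ne _)]
      simp [this]
    · intro p hp
      by_contra hc
      exact hp (key p (fun h0 => hc (by
        change ((tm 𝓐 x (fun _ => oC 𝓐) x p : ℝ≥0) : ℝ≥0∞) = 0
        rw [h0]; rfl))).1
  · refine ENNReal.tsum_eq_zero.2 fun p => ?_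
    by_contra hc
    exact hx (key p (fun h0 => hc (by
        change ((tm 𝓐 f (fun _ => oC 𝓐) x p : ℝ≥0) : ℝ≥0∞) = 0
        rw [h0]; rfl))).2

lemma unit_left (f x : ZMod τ → IsoCl 𝓐) [Decidable (x = f)] :
    hconstR (fun _ => oC 𝓐) f x = if x = f then 1 else 0 := by
  rw [hconstR_eq, unit_hEC_left]; split_ifs <;> simp

lemma unit_right (f x : ZMod τ → IsoCl 𝓐) [Decidable (x = f)] :
    hconstR f (fun _ => oC 𝓐) x = if x = f then 1 else 0 := by
  rw [hconstR_eq, unit_hEC_right]; split_ifs <;> simp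

end UnitPart

set_option linter.unusedSectionVars false

section Qis

variable {𝓐 : Type} [SmallCategory 𝓐] [Abelian 𝓐] {τ : ℕ} [NeZero τ]

lemma prel (i : ZMod τ) : (pShape τ).Rel i (i + 1) := rfl

/-- a quasi-isomorphism criterion -/
def QInj {K M : Ct 𝓐 τ} (φ : K ⟶ M) : Prop :=
  ∀ (i : ZMod τ) (A : 𝓐) (x : A ⟶ K.X (i + 1)) (_ : x ≫ K.d (i + 1) (i + 1 + 1) = 0) (y : A ⟶ M.X i)
    (_ : x ≫ φ.f (i + 1) = y ≫ M.d i (i + 1)),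
    ∃ (A' : 𝓐) (π : A' ⟶ A) (_ : Epi π) (x₁ : A' ⟶ K.X i), π ≫ x = x₁ ≫ K.d i (i + 1)

/-- a quasi-isomorphism criterion -/
def QSur {K M : Ct 𝓐 τ} (φ : K ⟶ M) : Prop :=
  ∀ (i : ZMod τ) (A : 𝓐) (y : A ⟶ M.X (i + 1)) (_ : y ≫ M.d (i + 1) (i + 1 + 1) = 0),
    ∃ (A' : 𝓐) (π : A' ⟶ A) (_ : Epi π) (x : A' ⟶ K.X (i + 1)) (_ : x ≫ K.d (i + 1) (i + 1 + 1) = 0)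
      (y₁ : A' ⟶ M.X i), π ≫ y = x ≫ φ.f (i + 1) + y₁ ≫ M.d i (i + 1)

lemma qis_iff {K M : Ct 𝓐 τ} (φ : K ⟶ M) : QuasiIso φ ↔ QInj φ ∧ QSur φ := by
  have hp : ∀ i : ZMod τ, (pShape τ).prev (i + 1) = i := fun i => (pShape τ).prev_eq' (prel i)
  have hn : ∀ i : ZMod τ, (pShape τ).next (i + 1) = i + 1 + 1 := fun i => (pShape τ).next_eq' (prel (i + 1))
  constructor
  · intro h
    refine ⟨fun i => ?_, fun i => ?_⟩
    · exact (HomologicalComplex.mono_homologyMap_iff_up_to_refinements φ i (i + 1) (i + 1 + 1) (hp i) (hn i)).1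
        inferInstance
    · exact (HomologicalComplex.epi_homologyMap_iff_up_to_refinements φ i (i + 1) (i + 1 + 1) (hp i) (hn i)).1
        inferInstance
  · rintro ⟨h1, h2⟩
    refine ⟨fun j => ?_⟩
    obtain ⟨i, rfl⟩ : ∃ i, i + 1 = j := ⟨j - 1, by simp⟩
    rw [quasiIsoAt_iff_isIso_homologyMap]
    have := (HomologicalComplex.mono_homologyMap_iff_up_to_refinements φ i (i + 1) (i + 1 + 1) (hp i) (hn i)).2 (h1 i)
    have := (HomologicalComplex.epi_homologyMap_iff_up_to_refinements φ i (i + 1) (i + 1 + 1) (hp i) (hn i)).2 (h2 i)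
    exact isIso_of_mono_of_epi _

/-- make a morphism -/
def mkHom {K M : Ct 𝓐 τ} (f : ∀ i, K.X i ⟶ M.X i)
    (h : ∀ i, f i ≫ M.d i (i + 1) = K.d i (i + 1) ≫ f (i + 1)) : K ⟶ M where
  f := f
  comm' := by rintro i _ rfl; exact h i

/-- cone-like complexes -/
def coneC (F G : ZMod τ → 𝓐) (j : ∀ i, G i ⟶ F (i + 1)) : Ct 𝓐 τ :=
  CochainComplex.of (fun i => F i ⊞ G i) (fun i => biprod.snd ≫ j i ≫ biprod.inl) (by intro; simp)

/-- first inclusion -/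
def cI (F G : ZMod τ → 𝓐) (j : ∀ i, G i ⟶ F (i + 1)) (i : ZMod τ) : F i ⟶ (coneC F G j).X i :=
  biprod.inl (X := F i) (Y := G i)

/-- second inclusion -/
def cJ (F G : ZMod τ → 𝓐) (j : ∀ i, G i ⟶ F (i + 1)) (i : ZMod τ) : G i ⟶ (coneC F G j).X i :=
  biprod.inr (X := F i) (Y := G i)

/-- first projection -/
def cP (F G : ZMod τ → 𝓐) (j : ∀ i, G i ⟶ F (i + 1)) (i : ZMod τ) : (coneC F G j).X i ⟶ F i :=
  biprod.fst (X := F i) (Y := G i)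

/-- second projection -/
def cQ (F G : ZMod τ → 𝓐) (j : ∀ i, G i ⟶ F (i + 1)) (i : ZMod τ) : (coneC F G j).X i ⟶ G i :=
  biprod.snd (X := F i) (Y := G i)

section
variable (F G : ZMod τ → 𝓐) (j : ∀ i, G i ⟶ F (i + 1)) (i : ZMod τ)

@[simp]
lemma cIP : cI F G j i ≫ cP F G j i = 𝟙 _ := biprod.inl_fst (X := F i) (Y := G i)

@[simp]
lemma cIP_assoc {A : 𝓐} (k : F i ⟶ A) : cI F G j i ≫ cP F G j i ≫ k = k := by
  rw [← Category.assoc, cIP, Category.id_comp]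

@[simp]
lemma cIQ : cI F G j i ≫ cQ F G j i = 0 := biprod.inl_snd (X := F i) (Y := G i)

@[simp]
lemma cIQ_assoc {A : 𝓐} (k : G i ⟶ A) : cI F G j i ≫ cQ F G j i ≫ k = 0 := by
  rw [← Category.assoc, cIQ, zero_comp]

@[simp]
lemma cJP : cJ F G j i ≫ cP F G j i = 0 := biprod.inr_fst (X := F i) (Y := G i)

@[simp]
lemma cJP_assoc {A : 𝓐} (k : F i ⟶ A) : cJ F G j i ≫ cP F G j i ≫ k = 0 := by
  rw [← Category.assoc, cJP, zero_comp]

@[simp]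
lemma cJQ : cJ F G j i ≫ cQ F G j i = 𝟙 _ := biprod.inr_snd (X := F i) (Y := G i)

@[simp]
lemma cJQ_assoc {A : 𝓐} (k : G i ⟶ A) : cJ F G j i ≫ cQ F G j i ≫ k = k := by
  rw [← Category.assoc, cJQ, Category.id_comp]

lemma c_total : cP F G j i ≫ cI F G j i + cQ F G j i ≫ cJ F G j i = 𝟙 _ :=
  biprod.total (X := F i) (Y := G i)

lemma c_ext {A : 𝓐} {a b : (coneC F G j).X i ⟶ A} (h1 : cI F G j i ≫ a = cI F G j i ≫ b)
    (h2 : cJ F G j i ≫ a = cJ F G j i ≫ b) : a = b :=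
  biprod.hom_ext' (X := F i) (Y := G i) a b h1 h2

lemma coneC_d : (coneC F G j).d i (i + 1) = cQ F G j i ≫ j i ≫ cI F G j (i + 1) :=
  CochainComplex.of_d (fun i => F i ⊞ G i) (fun i => biprod.snd ≫ j i ≫ biprod.inl) i

end

/-- morphism out of a cone -/
def coneDesc (F G : ZMod τ → 𝓐) (j : ∀ i, G i ⟶ F (i + 1)) {M : Ct 𝓐 τ} (p : ∀ i, F i ⟶ M.X i)
    (c : ∀ i, G i ⟶ M.X i) (hp : ∀ i, p i ≫ M.d i (i + 1) = 0)
    (hc : ∀ i, c i ≫ M.d i (i + 1) = j i ≫ p (i + 1)) : coneC F G j ⟶ M :=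
  mkHom (fun i => cP F G j i ≫ p i + cQ F G j i ≫ c i) (by
    intro i
    rw [coneC_d]
    simp [hp, hc])

lemma coneDesc_f (F G : ZMod τ → 𝓐) (j : ∀ i, G i ⟶ F (i + 1)) {M : Ct 𝓐 τ} (p : ∀ i, F i ⟶ M.X i)
    (c : ∀ i, G i ⟶ M.X i) (hp : ∀ i, p i ≫ M.d i (i + 1) = 0)
    (hc : ∀ i, c i ≫ M.d i (i + 1) = j i ≫ p (i + 1)) (i : ZMod τ) :
    (coneDesc F G j p c hp hc).f i = cP F G j i ≫ p i + cQ F G j i ≫ c i := rfl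

lemma cone_qis (F G : ZMod τ → 𝓐) (j : ∀ i, G i ⟶ F (i + 1)) {M : Ct 𝓐 τ} (hM : ∀ i, M.d i (i + 1) = 0)
    (p : ∀ i, F i ⟶ M.X i)
    (c : ∀ i, G i ⟶ M.X i) (hs : ∀ i, IsSES (j i) (p (i + 1))) (h1 h2) :
    QuasiIso (coneDesc (M := M) F G j p c h1 h2) := by
  rw [qis_iff]
  constructor
  · intro i A x hx y hy
    rw [coneC_d] at hx
    rw [coneDesc_f, hM] at hy
    have hx0 : x ≫ cQ _ _ _ _ = 0 := by
      have := (hs (i + 1)).mono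
      rw [← cancel_mono (j (i + 1))]
      have := congrArg (· ≫ cP _ _ _ _) hx
      simpa using this
    have hy' : (x ≫ cP _ _ _ _) ≫ p (i + 1) = 0 := by
      rw [Preadditive.comp_add, reassoc_of% hx0] at hy
      simpa using hy
    obtain ⟨l, hl⟩ := (hs i).lift _ hy'
    refine ⟨A, 𝟙 A, inferInstance, l ≫ cJ _ _ _ _, ?_⟩
    rw [coneC_d, Category.assoc, cJQ_assoc, reassoc_of% hl, Category.id_comp]
    conv_lhs => rw [← Category.comp_id x, ← c_total, Preadditive.comp_add, reassoc_of% hx0, zero_comp, add_zero]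
  · intro i A y hy
    obtain ⟨A', π, hπ, l, hl⟩ := IsSES.refine_epi (p (i + 1)) (hs i).epi y
    refine ⟨A', π, hπ, l ≫ cI _ _ _ _, ?_, 0, ?_⟩
    · rw [coneC_d]; simp
    · rw [coneDesc_f]
      simp [hl]

/-- pullbacks of epimorphic quasi-isomorphisms -/
lemma pullback_qis {P W Y : Ct 𝓐 τ} (a : P ⟶ Y) (w : W ⟶ Y) [Epi w] (hw : QuasiIso w) :
    QuasiIso (pullback.fst a w) := by
  obtain ⟨hi, hs⟩ := (qis_iff w).1 hw
  have hep : ∀ i, Epi (w.f i) := fun i =>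
    inferInstanceAs (Epi ((HomologicalComplex.eval 𝓐 (pShape τ) i).map w))
  have hpb : ∀ i, IsPullback ((pullback.fst a w).f i) ((pullback.snd a w).f i) (a.f i) (w.f i) := fun i =>
    (IsPullback.of_hasPullback a w).map (HomologicalComplex.eval 𝓐 (pShape τ) i)
  rw [qis_iff]
  constructor
  · intro i A x hx y hy
    have hω : (x ≫ (pullback.snd a w).f (i + 1)) ≫ W.d _ (i + 1 + 1) = 0 := by
      rw [Category.assoc, HomologicalComplex.Hom.comm, reassoc_of% hx, zero_comp]
    have hω2 : (x ≫ (pullback.snd a w).f (i + 1)) ≫ w.f _ = (y ≫ a.f i) ≫ Y.d i (i + 1) := by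
      rw [Category.assoc, ← (hpb (i + 1)).w, reassoc_of% hy, Category.assoc, HomologicalComplex.Hom.comm]
    obtain ⟨A1, π1, e1, ω', h1⟩ := hi i A _ hω _ hω2
    obtain ⟨k, rfl⟩ : ∃ k, k + 1 = i := ⟨i - 1, by simp⟩
    obtain ⟨A2, π2, e2, κ, hκ, z, h2⟩ := hs k A1 (ω' ≫ w.f _ - π1 ≫ y ≫ a.f _) (by
      rw [Preadditive.sub_comp, Category.assoc, HomologicalComplex.Hom.comm, ← reassoc_of% h1]
      rw [sub_eq_zero]
      simpa using congrArg (π1 ≫ ·) hω2)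
    obtain ⟨A3, π3, e3, z', h3⟩ := IsSES.refine_epi (w.f k) (hep k) z
    let ω : A3 ⟶ W.X (k + 1) := π3 ≫ (π2 ≫ ω' - κ) - z' ≫ W.d k (k + 1)
    have hωw : (π3 ≫ π2 ≫ π1 ≫ y) ≫ a.f _ = ω ≫ w.f _ := by
      have h2' := congrArg (π3 ≫ ·) h2
      simp only [ω, Preadditive.sub_comp, Preadditive.comp_sub, Preadditive.comp_add, Category.assoc, ← HomologicalComplex.Hom.comm] at h2' ⊢
      rw [← reassoc_of% h3]
      rw [sub_eq_iff_eq_add] at h2'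
      rw [h2']
      abel
    refine ⟨A3, π3 ≫ π2 ≫ π1, inferInstance, (hpb (k + 1)).lift _ _ hωw, ?_⟩
    apply (hpb (k + 1 + 1)).hom_ext
    · simp only [Category.assoc]
      rw [← HomologicalComplex.Hom.comm, (hpb (k + 1)).lift_fst_assoc, hy]
      simp only [Category.assoc]
    · simp only [Category.assoc]
      rw [← HomologicalComplex.Hom.comm, (hpb (k + 1)).lift_snd_assoc, h1]
      simp [ω, hκ]
  · intro i A y hy
    obtain ⟨A1, π1, e1, κ, hκ, z, h1⟩ := hs i A (y ≫ a.f _) (by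
      rw [Category.assoc, HomologicalComplex.Hom.comm, reassoc_of% hy, zero_comp])
    obtain ⟨A2, π2, e2, z', h2⟩ := IsSES.refine_epi (w.f i) (hep i) z
    have hc : (π2 ≫ π1 ≫ y) ≫ a.f _ = (π2 ≫ κ + z' ≫ W.d i (i + 1)) ≫ w.f _ := by
      simp only [Category.assoc, Preadditive.add_comp, ← HomologicalComplex.Hom.comm]
      rw [h1, ← reassoc_of% h2, Preadditive.comp_add]
    refine ⟨A2, π2 ≫ π1, inferInstance, (hpb (i + 1)).lift _ _ hc, ?_, 0, ?_⟩
    · apply (hpb (i + 1 + 1)).hom_ext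
      · rw [Category.assoc, ← HomologicalComplex.Hom.comm, (hpb (i + 1)).lift_fst_assoc]
        simp [hy]
      · rw [Category.assoc, ← HomologicalComplex.Hom.comm, (hpb (i + 1)).lift_snd_assoc]
        simp [hκ]
    · simp

end Qis

set_option linter.unusedSectionVars false

section Roof

variable {𝓐 : Type} [SmallCategory 𝓐] [Abelian 𝓐] {τ : ℕ} [NeZero τ]

lemma cone_exact (F G : ZMod τ → 𝓐) (j : ∀ i, G i ⟶ F (i + 1)) (hj : ∀ i, IsIso (j i)) (i : ZMod τ)
    {A : 𝓐} (x : A ⟶ (coneC F G j).X (i + 1)) (hx : x ≫ (coneC F G j).d (i + 1) (i + 1 + 1) = 0) :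
    ∃ x₁ : A ⟶ (coneC F G j).X i, x = x₁ ≫ (coneC F G j).d i (i + 1) := by
  rw [coneC_d] at hx
  have hx0 : x ≫ cQ _ _ _ _ = 0 := by
    rw [← cancel_mono (j (i + 1))]
    have := congrArg (· ≫ cP _ _ _ _) hx
    simpa using this
  refine ⟨x ≫ cP _ _ _ _ ≫ inv (j i) ≫ cJ _ _ _ _, ?_⟩
  rw [coneC_d]
  simp only [Category.assoc, cJQ_assoc, IsIso.inv_hom_id_assoc]
  conv_lhs => rw [← Category.comp_id x, ← c_total, Preadditive.comp_add, reassoc_of% hx0, zero_comp, add_zero]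

lemma inl_qis (Y C : Ct 𝓐 τ) (hC : ∀ (i : ZMod τ) (A : 𝓐) (x : A ⟶ C.X (i + 1)), x ≫ C.d (i + 1) (i + 1 + 1) = 0 →
    ∃ x₁ : A ⟶ C.X i, x = x₁ ≫ C.d i (i + 1)) : QuasiIso (biprod.inl : Y ⟶ Y ⊞ C) := by
  rw [qis_iff]
  have e1 : ∀ i, (biprod.inl : Y ⟶ Y ⊞ C).f i ≫ (biprod.fst : Y ⊞ C ⟶ Y).f i = 𝟙 _ := fun i => by
    rw [← HomologicalComplex.comp_f, biprod.inl_fst, HomologicalComplex.id_f]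
  constructor
  · intro i A x hx y hy
    refine ⟨A, 𝟙 A, inferInstance, y ≫ (biprod.fst : Y ⊞ C ⟶ Y).f i, ?_⟩
    rw [Category.id_comp, Category.assoc, HomologicalComplex.Hom.comm, ← reassoc_of% hy, e1, Category.comp_id]
  · intro i A y hy
    obtain ⟨c, hc⟩ := hC i A (y ≫ (biprod.snd : Y ⊞ C ⟶ C).f _) (by
      rw [Category.assoc, HomologicalComplex.Hom.comm, reassoc_of% hy, zero_comp])
    refine ⟨A, 𝟙 A, inferInstance, y ≫ (biprod.fst : Y ⊞ C ⟶ Y).f _, ?_, c ≫ (biprod.inr : C ⟶ Y ⊞ C).f _, ?_⟩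
    · rw [Category.assoc, HomologicalComplex.Hom.comm, reassoc_of% hy, zero_comp]
    · have ht : (biprod.fst : Y ⊞ C ⟶ Y).f (i + 1) ≫ (biprod.inl : Y ⟶ Y ⊞ C).f (i + 1) +
          (biprod.snd : Y ⊞ C ⟶ C).f (i + 1) ≫ (biprod.inr : C ⟶ Y ⊞ C).f (i + 1) = 𝟙 _ := by
        rw [← HomologicalComplex.comp_f, ← HomologicalComplex.comp_f, ← HomologicalComplex.add_f_apply,
          biprod.total, HomologicalComplex.id_f]
      rw [Category.id_comp, Category.assoc, Category.assoc, HomologicalComplex.Hom.comm, ← reassoc_of% hc,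
        ← Preadditive.comp_add, ht, Category.comp_id]

/-- every quasi-isomorphism can be replaced by an epimorphic one -/
lemma exists_epi_repl {Y' Y : Ct 𝓐 τ} (w : Y' ⟶ Y) (hw : QuasiIso w) :
    ∃ (W : Ct 𝓐 τ) (v : W ⟶ Y) (i : Y' ⟶ W) (r : W ⟶ Y'), Epi v ∧ QuasiIso v ∧ QuasiIso i ∧
      i ≫ v = w ∧ i ≫ r = 𝟙 _ := by
  let C := coneC (fun i : ZMod τ => Y.X (i - 1)) Y.X (fun i => (Y.XIsoOfEq (by simp : i = i + 1 - 1)).hom)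
  let c : C ⟶ Y := coneDesc _ _ _ (fun i => Y.d (i - 1) i) (fun i => 𝟙 _) (by intro; simp) (by intro; simp)
  have hc : Epi c := by
    have : ∀ i, Epi (c.f i) := fun i => by
      have : cJ _ _ _ i ≫ c.f i = 𝟙 _ := by
        rw [coneDesc_f]; simp
      have : Epi (cJ _ _ _ i ≫ c.f i) := by rw [this]; infer_instance
      exact epi_of_epi (cJ _ _ _ i) _
    exact HomologicalComplex.epi_of_epi_f _ this
  have hi : QuasiIso (biprod.inl : Y' ⟶ Y' ⊞ C) :=
    inl_qis Y' C (fun i A x hx => cone_exact _ _ _ (fun i => inferInstance) i x hx)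
  refine ⟨Y' ⊞ C, biprod.desc w c, biprod.inl, biprod.fst, ?_, ?_, hi, by simp, by simp⟩
  · have : Epi (biprod.inr ≫ biprod.desc w c) := by rw [biprod.inr_desc]; exact hc
    exact epi_of_epi (biprod.inr : C ⟶ Y' ⊞ C) _
  · have : QuasiIso ((biprod.inl : Y' ⟶ Y' ⊞ C) ≫ biprod.desc w c) := by rw [biprod.inl_desc]; exact hw
    exact quasiIso_of_comp_left (biprod.inl : Y' ⟶ Y' ⊞ C) _

universe u1 u2

lemma ore {E : Type u1} [Category.{u2} E] (L : Ct 𝓐 τ ⥤ E)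
    (hL : ∀ {X Y : Ct 𝓐 τ} (f : X ⟶ Y), QuasiIso f → IsIso (L.map f))
    {P Y' Y : Ct 𝓐 τ} (a : P ⟶ Y) (w : Y' ⟶ Y) (hw : QuasiIso w) :
    ∃ (P' : Ct 𝓐 τ) (s : P' ⟶ P) (b : P' ⟶ Y'), QuasiIso s ∧ L.map s ≫ L.map a = L.map b ≫ L.map w := by
  obtain ⟨W, v, i, r, hv, hvq, hi, h1, h2⟩ := exists_epi_repl w hw
  refine ⟨pullback a v, pullback.fst a v, pullback.snd a v ≫ r, pullback_qis a v hvq, ?_⟩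
  have : IsIso (L.map i) := hL i hi
  have hri : L.map r ≫ L.map i = 𝟙 _ := by
    rw [← cancel_epi (L.map i), ← Category.assoc, ← L.map_comp, h2, L.map_id]
    simp
  rw [← L.map_comp, pullback.condition, L.map_comp, L.map_comp, ← h1, L.map_comp, Category.assoc,
    reassoc_of% hri]

/-- in the model localization -/
lemma roof_model {X : Ct 𝓐 τ} {A : (HomologicalComplex.quasiIso 𝓐 (pShape τ)).Localization}
    (m : (HomologicalComplex.quasiIso 𝓐 (pShape τ)).Q.obj X ⟶ A) :
    ∃ (P : Ct 𝓐 τ) (s : P ⟶ X) (a : P ⟶ A.as.obj), QuasiIso s ∧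
      (HomologicalComplex.quasiIso 𝓐 (pShape τ)).Q.map s ≫ m =
        (HomologicalComplex.quasiIso 𝓐 (pShape τ)).Q.map a := by
  let W := HomologicalComplex.quasiIso 𝓐 (pShape τ)
  let Gd : ∀ {A : W.Localization}, (W.Q.obj X ⟶ A) → Prop := fun {A} m =>
    ∃ (P : Ct 𝓐 τ) (s : P ⟶ X) (a : P ⟶ A.as.obj), QuasiIso s ∧ W.Q.map s ≫ m = W.Q.map a
  let Pr : MorphismProperty W.Localization := fun A B f => ∀ g : W.Q.obj X ⟶ A, Gd g → Gd (g ≫ f)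
  have : Pr.IsStableUnderComposition := ⟨fun f g hf hg k hk => by
    have := hg _ (hf k hk)
    rwa [Category.assoc] at this⟩
  have hinv : ∀ {X Y : Ct 𝓐 τ} (f : X ⟶ Y), QuasiIso f → IsIso (W.Q.map f) := fun f hf =>
    Localization.inverts W.Q W f ((HomologicalComplex.mem_quasiIso_iff f).2 hf)
  have htop : Pr = ⊤ := by
    refine Localization.Construction.morphismProperty_eq_top Pr ?_ ?_
    · intro Y Z f g hg
      obtain ⟨P, s, a, hs, h⟩ : ∃ (P : Ct 𝓐 τ) (s : P ⟶ X) (a : P ⟶ Y), QuasiIso s ∧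
        W.Q.map s ≫ g = W.Q.map a := hg
      have key : W.Q.map s ≫ g ≫ W.Q.map f = W.Q.map (a ≫ f) := by
        rw [W.Q.map_comp, ← h, Category.assoc]
      exact ⟨P, s, a ≫ f, hs, key⟩
    · intro Y Z w hw g hg
      obtain ⟨P, s, a, hs, h⟩ : ∃ (P : Ct 𝓐 τ) (s : P ⟶ X) (a : P ⟶ Z), QuasiIso s ∧
        W.Q.map s ≫ g = W.Q.map a := hg
      have hwq := (HomologicalComplex.mem_quasiIso_iff w).1 hw
      obtain ⟨P', s', b, hs', h'⟩ := ore W.Q hinv a w hwq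
      have := hinv w hwq
      have hw' : Localization.Construction.wInv w hw ≫ W.Q.map w = 𝟙 _ :=
        (Localization.Construction.wIso w hw).inv_hom_id
      have key : W.Q.map (s' ≫ s) ≫ g ≫ Localization.Construction.wInv w hw = W.Q.map b := by
        rw [← cancel_mono (W.Q.map w), W.Q.map_comp]
        simp only [Category.assoc]
        erw [hw']
        rw [Category.comp_id, h, h']
      exact ⟨P', s' ≫ s, b, inferInstance, key⟩
  have : Pr m := by rw [htop]; trivial
  have h2 := this (𝟙 _) ⟨X, 𝟙 X, 𝟙 X, inferInstance, Category.comp_id _⟩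
  rwa [Category.id_comp] at h2

lemma roof {E : Type u1} [Category.{u2} E] (L : Ct 𝓐 τ ⥤ E)
    [L.IsLocalization (HomologicalComplex.quasiIso 𝓐 (pShape τ))] {X Y : Ct 𝓐 τ} (m : L.obj X ⟶ L.obj Y) :
    ∃ (P : Ct 𝓐 τ) (s : P ⟶ X) (a : P ⟶ Y), QuasiIso s ∧ L.map s ≫ m = L.map a := by
  let W := HomologicalComplex.quasiIso 𝓐 (pShape τ)
  let F := (Localization.uniq W.Q L W).functor
  let e : W.Q ⋙ F ≅ L := Localization.compUniqFunctor W.Q L W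
  obtain ⟨m', hm'⟩ := F.map_surjective (X := W.Q.obj X) (Y := W.Q.obj Y) (e.hom.app X ≫ m ≫ e.inv.app Y)
  obtain ⟨P, s, a, hs, h⟩ : ∃ (P : Ct 𝓐 τ) (s : P ⟶ X) (a : P ⟶ Y), QuasiIso s ∧
        W.Q.map s ≫ m' = W.Q.map a := roof_model m'
  refine ⟨P, s, a, hs, ?_⟩
  have h' := congrArg F.map h
  rw [F.map_comp, hm'] at h'
  have n1 := e.hom.naturality s
  have n2 := e.hom.naturality a
  have n1' : F.map (W.Q.map s) ≫ e.hom.app X = e.hom.app P ≫ L.map s := n1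
  have n2' : F.map (W.Q.map a) ≫ e.hom.app Y = e.hom.app P ≫ L.map a := n2
  have h3 : F.map (W.Q.map s) ≫ e.hom.app X ≫ m ≫ e.inv.app Y = F.map (W.Q.map a) := h'
  rw [← cancel_epi (e.hom.app P), ← n2', ← h3, ← reassoc_of% n1']
  simp

end Roof

set_option linter.unusedSectionVars false

section FinHom

variable {𝓐 : Type} [SmallCategory 𝓐] [Abelian 𝓐] [HasExt.{0} 𝓐] [hF : ∀ X Y : 𝓐, Finite (X ⟶ Y)]
  [hFE : ∀ X Y : 𝓐, Finite (Abelian.Ext X Y 1)] [hH : ∀ X Y : 𝓐, Subsingleton (Abelian.Ext X Y 2)]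

open Abelian

/-- in a hereditary category a map with cokernel `X` factors through an extension of `X` -/
lemma hered_cover {Q Z X : 𝓐} (d : Q ⟶ Z) (q : Z ⟶ X) (hq : Epi q) (w : d ≫ q = 0)
    (hx : ∀ {W : 𝓐} (k : W ⟶ Z), k ≫ q = 0 →
      ∃ (W' : 𝓐) (π : W' ⟶ W) (_ : Epi π) (l : W' ⟶ Q), π ≫ k = l ≫ d) :
    ∃ (V : 𝓐) (j : Q ⟶ V) (π : V ⟶ Z), j ≫ π = d ∧ IsSES j (π ≫ q) := by
  have hB := IsSES.of_epi q
  obtain ⟨e, he⟩ := hB.lift d w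
  have hee : Epi e := by
    obtain ⟨W', π, hπ, l, hl⟩ := hx (kernel.ι q) (by simp)
    have h2 : π = l ≫ e := by
      rw [← cancel_mono (kernel.ι q), hl, Category.assoc, he]
    have : Epi (l ≫ e) := by rw [← h2]; exact hπ
    exact epi_of_epi l e
  have h1 := IsSES.of_epi e
  obtain ⟨y, hy⟩ := ext_surj_left hB _ h1.cls
  obtain ⟨V, i, π, h2, h2y⟩ := exists_isSES y
  obtain ⟨j, hj1, hj2⟩ := (lift_iff h1 h2 (kernel.ι q)).2 (by rw [h2y, hy])
  have hjd : j ≫ π = d := by rw [hj2, he]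
  refine ⟨V, j, π, hjd, ?_⟩
  have := h2.mono
  have hπe := h2.epi
  refine IsSES.mk_of_refine (by rw [reassoc_of% hjd, w]) ?_ ?_ ?_
  · intro W k hk
    have hke : k ≫ e = 0 := by
      rw [← cancel_mono (kernel.ι q), Category.assoc, ← hj2, reassoc_of% hk, zero_comp, zero_comp]
    obtain ⟨l, hl⟩ := h1.lift k hke
    have : l = 0 := by
      rw [← cancel_mono i, ← hj1, reassoc_of% hl, hk, zero_comp]
    rw [← hl, this, zero_comp]
  · intro W k
    exact IsSES.refine_epi _ (epi_comp _ _) k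
  · intro W k hk
    obtain ⟨l, hl⟩ := hB.lift (k ≫ π) (by rw [Category.assoc, hk])
    obtain ⟨W', ρ, hρ, l', hl'⟩ := IsSES.refine_epi e hee l
    obtain ⟨m, hm⟩ := h2.lift (ρ ≫ k - l' ≫ j) (by
      rw [Preadditive.sub_comp, Category.assoc, Category.assoc, ← hl, hj2, reassoc_of% hl', sub_self])
    refine ⟨W', ρ, hρ, l' + m ≫ kernel.ι e, ?_⟩
    rw [Preadditive.add_comp, Category.assoc, hj1, hm]
    abel

lemma ses_pushout {Q V X G : 𝓐} {j : Q ⟶ V} {p : V ⟶ X} (h : IsSES j p) (φ : Q ⟶ G) :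
    ∃ (E : 𝓐) (v : V ⟶ E) (j' : G ⟶ E) (p' : E ⟶ X), IsSES j' p' ∧ v ≫ p' = p ∧ j ≫ v = φ ≫ j' := by
  have := h.mono
  have := h.epi
  refine ⟨pushout j φ, pushout.inl j φ, pushout.inr j φ, pushout.desc p 0 (by rw [h.w, comp_zero]), ?_,
    pushout.inl_desc _ _ _, pushout.condition⟩
  refine IsSES.mk_of_desc (pushout.inr_desc _ _ _) inferInstance ?_ ?_
  · have : Epi (pushout.inl j φ ≫ pushout.desc p 0 (by rw [h.w, comp_zero])) := by
      rw [pushout.inl_desc]; infer_instance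
    exact epi_of_epi (pushout.inl j φ) _
  · intro W k hk
    obtain ⟨l, hl⟩ := h.desc (pushout.inl j φ ≫ k) (by
      rw [← Category.assoc, pushout.condition, Category.assoc, hk, comp_zero])
    refine ⟨l, ?_⟩
    apply pushout.hom_ext
    · rw [pushout.inl_desc_assoc, hl]
    · rw [pushout.inr_desc_assoc, hk, zero_comp]

/-- middle terms of extensions -/
def midS (b a : 𝓐) : Set (IsoCl 𝓐) := {c | ∃ (i : b ⟶ c.out) (p : c.out ⟶ a), IsSES i p}

lemma midS_finite (b a : 𝓐) : (midS b a).Finite := by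
  let Φ : Abelian.Ext a b 1 → IsoCl 𝓐 := fun α => cl (exists_isSES α).choose
  refine (Set.finite_range Φ).subset ?_
  rintro c ⟨i', p', s⟩
  refine ⟨s.cls, ?_⟩
  obtain ⟨i, p, h, hh⟩ := (exists_isSES s.cls).choose_spec
  obtain ⟨y, hy1, hy2⟩ := (lift_iff s h (𝟙 _)).2 (by rw [hh]; simp)
  have : IsIso y := isIso_of_lift s h y hy1 (by simpa using hy2)
  exact (out_cl_eq ⟨(asIso y).symm⟩).symm

variable {τ : ℕ} [NeZero τ]

lemma local_step {P X Y : Ct 𝓐 τ} (hX : ∀ i, X.d i (i + 1) = 0) (hY : ∀ i, Y.d i (i + 1) = 0)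
    (s : P ⟶ X) (a : P ⟶ Y) (hs : QuasiIso s) (i : ZMod τ) :
    ∃ (V : 𝓐) (c : IsoCl 𝓐) (π : V ⟶ P.X i) (v : V ⟶ c.out) (p : c.out ⟶ X.X i) (u : X.X i ⟶ Y.X i),
      π ≫ P.d i (i + 1) = 0 ∧ π ≫ s.f i = v ≫ p ∧ π ≫ a.f i = v ≫ p ≫ u ∧
      ∀ k, k + 1 = i → ∃ (j : P.X k ⟶ V) (j' : X.X k ⊞ Y.X k ⟶ c.out), j ≫ π = P.d k i ∧
        IsSES j (π ≫ s.f i) ∧ IsSES j' p ∧ j ≫ v = biprod.lift (s.f k) (a.f k) ≫ j' := by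
  obtain ⟨k, rfl⟩ : ∃ k, k + 1 = i := ⟨i - 1, by simp⟩
  obtain ⟨hI, hS⟩ := (qis_iff s).1 hs
  have hqe : Epi (kernel.ι (P.d (k + 1) (k + 1 + 1)) ≫ s.f (k + 1)) := by
    obtain ⟨A', π, hπ, x, hx, y₁, h⟩ := hS k _ (𝟙 _) (by rw [hX, comp_zero])
    have e : kernel.lift _ x hx ≫ kernel.ι (P.d (k + 1) (k + 1 + 1)) ≫ s.f (k + 1) = π := by
      rw [kernel.lift_ι_assoc]
      rw [hX, comp_zero, add_zero, Category.comp_id] at h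
      exact h.symm
    have : Epi (kernel.lift _ x hx ≫ kernel.ι (P.d (k + 1) (k + 1 + 1)) ≫ s.f (k + 1)) := by
      rw [e]; exact hπ
    exact epi_of_epi (kernel.lift _ x hx) _
  have hds : P.d k (k + 1) ≫ s.f (k + 1) = 0 := by
    rw [← HomologicalComplex.Hom.comm, hX, comp_zero]
  have hda : P.d k (k + 1) ≫ a.f (k + 1) = 0 := by
    rw [← HomologicalComplex.Hom.comm, hY, comp_zero]
  obtain ⟨V, j, π, hj, hses⟩ := hered_cover
    (kernel.lift (P.d (k + 1) (k + 1 + 1)) (P.d k (k + 1)) (by simp))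
    (kernel.ι (P.d (k + 1) (k + 1 + 1)) ≫ s.f (k + 1)) hqe (by rw [kernel.lift_ι_assoc, hds]) (by
      intro W y hy
      obtain ⟨A', ρ, hρ, x₁, h⟩ := hI k W (y ≫ kernel.ι _) (by simp) 0 (by
        rw [zero_comp, Category.assoc, hy])
      refine ⟨A', ρ, hρ, x₁, ?_⟩
      rw [← cancel_mono (kernel.ι _), Category.assoc, h, Category.assoc, kernel.lift_ι])
  have hj2 : j ≫ π ≫ kernel.ι _ = P.d k (k + 1) := by
    rw [reassoc_of% hj, kernel.lift_ι]
  obtain ⟨u, hu⟩ := hses.desc (π ≫ kernel.ι _ ≫ a.f (k + 1)) (by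
    have := congrArg (· ≫ a.f (k + 1)) hj2
    simp only [Category.assoc] at this
    rw [this, hda])
  obtain ⟨E, v, j', p', h1, h2, h3⟩ := ses_pushout hses (biprod.lift (s.f k) (a.f k))
  obtain ⟨e⟩ := out_iso E
  refine ⟨V, cl E, π ≫ kernel.ι _, v ≫ e.inv, e.hom ≫ p', u, by simp, by simp [h2], ?_, ?_⟩
  · simp only [Category.assoc, Iso.inv_hom_id_assoc]
    rw [← hu, ← h2]
    simp
  · intro k' hk'
    obtain rfl := add_right_cancel hk'
    refine ⟨j, j' ≫ e.inv, hj2, ?_, ?_, ?_⟩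
    · rw [Category.assoc]; exact hses
    · exact h1.comp_iso e.symm
    · rw [reassoc_of% h3]

universe u1 u2

variable {E : Type u1} [Category.{u2} E] (L : Ct 𝓐 τ ⥤ E)
    [L.IsLocalization (HomologicalComplex.quasiIso 𝓐 (pShape τ))]

lemma L_inv {X Y : Ct 𝓐 τ} (f : X ⟶ Y) (hf : QuasiIso f) : IsIso (L.map f) :=
  Localization.inverts L (HomologicalComplex.quasiIso 𝓐 (pShape τ)) f
    ((HomologicalComplex.mem_quasiIso_iff f).2 hf)

/-- Finite set of data for morphisms -/
abbrev Dat (X Y : Ct 𝓐 τ) : Type :=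
  Σ c : ∀ i, (⋃ k, midS (X.X k ⊞ Y.X k) (X.X i) : Set (IsoCl 𝓐)),
    (∀ i, X.X i ⊞ Y.X i ⟶ (c (i + 1)).1.out) × (∀ i, (c i).1.out ⟶ X.X i) × (∀ i, X.X i ⟶ Y.X i)

lemma Dat_finite (X Y : Ct 𝓐 τ) : Finite (Dat X Y) := by
  have : ∀ i, Finite (⋃ k, midS (X.X k ⊞ Y.X k) (X.X i) : Set (IsoCl 𝓐)) := fun i =>
    (Set.finite_iUnion fun k => midS_finite _ _).to_subtype
  infer_instance

/-- data represent a morphism -/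
def Repr {X Y : Ct 𝓐 τ} (m : L.obj X ⟶ L.obj Y) (D : Dat X Y) : Prop :=
  ∃ h1 h2 h3 h4,
    QuasiIso (coneDesc (fun i => (D.1 i).1.out) (fun i => X.X i ⊞ Y.X i) D.2.1 (M := X) D.2.2.1
      (fun _ => biprod.fst) h1 h2) ∧
    L.map (coneDesc (fun i => (D.1 i).1.out) (fun i => X.X i ⊞ Y.X i) D.2.1 (M := X) D.2.2.1
      (fun _ => biprod.fst) h1 h2) ≫ m =
    L.map (coneDesc (fun i => (D.1 i).1.out) (fun i => X.X i ⊞ Y.X i) D.2.1 (M := Y)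
      (fun i => D.2.2.1 i ≫ D.2.2.2 i) (fun _ => biprod.snd) h3 h4)

lemma Repr_unique {X Y : Ct 𝓐 τ} (m m' : L.obj X ⟶ L.obj Y) (D : Dat X Y) (h : Repr L m D)
    (h' : Repr L m' D) : m = m' := by
  obtain ⟨h1, h2, h3, h4, hq, h⟩ := h
  obtain ⟨_, _, _, _, _, h'⟩ := h'
  have := L_inv L _ hq
  exact (cancel_epi _).1 (h.trans h'.symm)

lemma Repr_exists {X Y : Ct 𝓐 τ} (hX : ∀ i, X.d i (i + 1) = 0) (hY : ∀ i, Y.d i (i + 1) = 0)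
    (m : L.obj X ⟶ L.obj Y) : ∃ D, Repr L m D := by
  obtain ⟨P, s, a, hs, hm⟩ := roof L m
  choose V c π v p u hπ hps hpa hk using local_step hX hY s a hs
  choose j j' hj hses hses' hv using fun i => hk (i + 1) i rfl
  let D : Dat X Y := ⟨fun i => ⟨c i, by
    rw [Set.mem_iUnion]
    obtain ⟨k, rfl⟩ : ∃ k, k + 1 = i := ⟨i - 1, by simp⟩
    exact ⟨k, j' k, p (k + 1), hses' k⟩⟩, j', p, u⟩
  have h1 : ∀ i, p i ≫ X.d i (i + 1) = 0 := fun i => by rw [hX, comp_zero]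
  have h2 : ∀ i, biprod.fst ≫ X.d i (i + 1) = j' i ≫ p (i + 1) := fun i => by
    rw [hX, comp_zero, (hses' i).w]
  have h3 : ∀ i, (p i ≫ u i) ≫ Y.d i (i + 1) = 0 := fun i => by rw [hY, comp_zero]
  have h4 : ∀ i, biprod.snd ≫ Y.d i (i + 1) = j' i ≫ p (i + 1) ≫ u (i + 1) := fun i => by
    rw [hY, comp_zero, reassoc_of% (hses' i).w, zero_comp]
  refine ⟨D, h1, h2, h3, h4, cone_qis _ _ _ hX _ _ hses' _ _, ?_⟩
  change L.map (coneDesc (fun i => (c i).out) (fun i => X.X i ⊞ Y.X i) j' (M := X) p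
      (fun _ => biprod.fst) h1 h2) ≫ m =
    L.map (coneDesc (fun i => (c i).out) (fun i => X.X i ⊞ Y.X i) j' (M := Y)
      (fun i => p i ≫ u i) (fun _ => biprod.snd) h3 h4)
  let α : coneC V P.X j ⟶ P := coneDesc V P.X j π (fun i => 𝟙 _) hπ (fun i => by
    rw [Category.id_comp, hj])
  let β : coneC V P.X j ⟶ coneC (fun i => (c i).out) (fun i => X.X i ⊞ Y.X i) j' :=
    coneDesc V P.X j (fun i => v i ≫ cI (fun i => (c i).out) (fun i => X.X i ⊞ Y.X i) j' i)
      (fun i => biprod.lift (s.f i) (a.f i) ≫ cJ (fun i => (c i).out) (fun i => X.X i ⊞ Y.X i) j' i)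
      (fun i => by rw [coneC_d]; simp) (fun i => by
        rw [coneC_d]
        simp only [Category.assoc, cJQ_assoc]
        rw [reassoc_of% (hv i)])
  have e1 : α ≫ s = coneDesc V P.X j (fun i => π i ≫ s.f i) s.f (fun i => by rw [hX, comp_zero])
      (fun i => by rw [hX, comp_zero, (hses i).w]) := by
    ext i
    rw [HomologicalComplex.comp_f, coneDesc_f, coneDesc_f]
    simp
  have hαs : QuasiIso (α ≫ s) := by
    rw [e1]
    exact cone_qis _ _ _ hX _ _ hses _ _
  have e2 : α ≫ s = β ≫ coneDesc (fun i => (c i).out) (fun i => X.X i ⊞ Y.X i) j' (M := X) p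
      (fun _ => biprod.fst) h1 h2 := by
    rw [e1]
    ext i
    rw [HomologicalComplex.comp_f, coneDesc_f, coneDesc_f, coneDesc_f]
    simp [hps]
  have e3 : α ≫ a = β ≫ coneDesc (fun i => (c i).out) (fun i => X.X i ⊞ Y.X i) j' (M := Y)
      (fun i => p i ≫ u i) (fun _ => biprod.snd) h3 h4 := by
    ext i
    rw [HomologicalComplex.comp_f, HomologicalComplex.comp_f, coneDesc_f, coneDesc_f, coneDesc_f]
    simp [hpa]
  have hq : QuasiIso (coneDesc (fun i => (c i).out) (fun i => X.X i ⊞ Y.X i) j' (M := X) p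
      (fun _ => biprod.fst) h1 h2) := cone_qis _ _ _ hX _ _ hses' _ _
  have hβ : QuasiIso β := by
    rw [e2] at hαs
    exact quasiIso_of_comp_right β (coneDesc (fun i => (c i).out) (fun i => X.X i ⊞ Y.X i) j' (M := X) p
      (fun _ => biprod.fst) h1 h2)
  have := L_inv L β hβ
  rw [← cancel_epi (L.map β), ← Category.assoc, ← L.map_comp, ← e2, ← L.map_comp, ← e3, L.map_comp,
    L.map_comp, Category.assoc, hm]

lemma hom_finite {X Y : Ct 𝓐 τ} (hX : ∀ i, X.d i (i + 1) = 0) (hY : ∀ i, Y.d i (i + 1) = 0) :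
    Finite (L.obj X ⟶ L.obj Y) := by
  have := Dat_finite X Y
  choose D hD using Repr_exists L hX hY
  exact Finite.of_injective D (fun m m' h => Repr_unique L m m' (D m) (hD m) (by rw [h]; exact hD m'))

lemma hom_subsingleton {X Y : Ct 𝓐 τ} (hY : IsZero Y) : Subsingleton (L.obj X ⟶ L.obj Y) := by
  have key : ∀ m : L.obj X ⟶ L.obj Y, m = L.map 0 := by
    intro m
    obtain ⟨P, s, a, hs, h⟩ := roof L m
    have := L_inv L s hs
    rw [← cancel_epi (L.map s), h, ← L.map_comp]
    congr 1
    exact hY.eq_of_tgt _ _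
  exact ⟨fun m m' => by rw [key m, key m']⟩

end FinHom

set_option linter.unusedSectionVars false

section Final

variable {𝓐 : Type} [SmallCategory 𝓐] [Abelian 𝓐] [HasExt.{0} 𝓐] [hF : ∀ X Y : 𝓐, Finite (X ⟶ Y)]
  [hFE : ∀ X Y : 𝓐, Finite (Abelian.Ext X Y 1)] [hH : ∀ X Y : 𝓐, Subsingleton (Abelian.Ext X Y 2)]
  {τ : ℕ} [NeZero τ]

universe u1 u2

variable (𝓔 : Type u1) [Category.{u2} 𝓔] [HasShift 𝓔 ℤ] (Λ : Ct 𝓐 τ ⥤ 𝓔)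
    [Λ.IsLocalization (HomologicalComplex.quasiIso 𝓐 (pShape τ))]

lemma autCard_ne (f : ZMod τ → 𝓐) : autCard (Λ.obj (mkZero f)) ≠ 0 := by
  have := hom_finite Λ (X := mkZero f) (Y := mkZero f) (fun _ => rfl) (fun _ => rfl)
  have h1 : Finite (Aut (Λ.obj (mkZero f))) :=
    Finite.of_injective (β := (Λ.obj (mkZero f) ⟶ Λ.obj (mkZero f))) (fun e => e.hom) (fun _ _ h => Iso.ext h)
  have h2 : Nonempty (Aut (Λ.obj (mkZero f))) := ⟨Iso.refl _⟩
  exact Nat.card_ne_zero.2 ⟨h2, h1⟩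

lemma shiftHom_ne (hsh : ∀ (f : ZMod τ → 𝓐) (n : ℤ),
      Nonempty ((Λ.obj (mkZero f))⟦n⟧ ≅ Λ.obj (mkZero (fun j => f (j + n))))) (f : ZMod τ → 𝓐) (n : ℤ) :
    Nat.card ((Λ.obj (mkZero f))⟦n⟧ ⟶ Λ.obj (mkZero f)) ≠ 0 := by
  obtain ⟨e⟩ := hsh f n
  rw [Nat.card_congr (e.homCongr (Iso.refl (Λ.obj (mkZero f))))]
  have := hom_finite Λ (X := mkZero (fun j => f (j + n))) (Y := mkZero f) (fun _ => rfl) (fun _ => rfl)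
  exact Nat.card_ne_zero.2 ⟨⟨Λ.map 0⟩, this⟩

lemma aprime_ne (hsh : ∀ (f : ZMod τ → 𝓐) (n : ℤ),
      Nonempty ((Λ.obj (mkZero f))⟦n⟧ ≅ Λ.obj (mkZero (fun j => f (j + n))))) (f : ZMod τ → IsoCl 𝓐) :
    aprimeR 𝓔 Λ f ≠ 0 := by
  refine mul_ne_zero (Nat.cast_ne_zero.2 (autCard_ne 𝓔 Λ _)) ?_
  refine (Real.sqrt_pos.2 (Finset.prod_pos fun i _ => zpow_pos ?_ _)).ne'
  exact Nat.cast_pos.2 (Nat.pos_of_ne_zero (shiftHom_ne 𝓔 Λ hsh _ _))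

lemma mkZero_isZero (f : ZMod τ → 𝓐) (hf : ∀ i, IsZero (f i)) : IsZero (mkZero f) := by
  rw [IsZero.iff_id_eq_zero]
  ext i
  exact (hf i).eq_of_src _ _

lemma aprime_zero (hsh : ∀ (f : ZMod τ → 𝓐) (n : ℤ),
      Nonempty ((Λ.obj (mkZero f))⟦n⟧ ≅ Λ.obj (mkZero (fun j => f (j + n))))) :
    aprimeR 𝓔 Λ (fun _ => oC 𝓐) = 1 := by
  have hz : IsZero (mkZero (fun _ : ZMod τ => (oC 𝓐).out)) := mkZero_isZero _ fun _ => oC_zero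
  have h1 : ∀ i : ℕ, Nat.card ((Λ.obj (mkZero (fun _ : ZMod τ => (oC 𝓐).out)))⟦(i : ℤ)⟧ ⟶
      Λ.obj (mkZero (fun _ : ZMod τ => (oC 𝓐).out))) = 1 := by
    intro i
    obtain ⟨e⟩ := hsh (fun _ => (oC 𝓐).out) i
    rw [Nat.card_congr (e.homCongr (Iso.refl _))]
    have := hom_subsingleton Λ (X := mkZero (fun _ : ZMod τ => (oC 𝓐).out)) hz
    exact Nat.card_eq_one_iff_unique.2 ⟨this, ⟨Λ.map 0⟩⟩
  have h2 : autCard (Λ.obj (mkZero (fun _ : ZMod τ => (oC 𝓐).out))) = 1 := by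
    have := hom_subsingleton Λ (X := mkZero (fun _ : ZMod τ => (oC 𝓐).out)) hz
    exact Nat.card_eq_one_iff_unique.2 ⟨⟨fun a b => Iso.ext (Subsingleton.elim _ _)⟩, ⟨Iso.refl _⟩⟩
  simp only [aprimeR, h1, h2]
  simp

/-- normalized structure constants -/
def nH (f g x : ZMod τ → IsoCl 𝓐) : ℝ :=
  hconstR f g x * aprimeR 𝓔 Λ x / (aprimeR 𝓔 Λ f * aprimeR 𝓔 Λ g)

lemma deltaT_self (f : ZMod τ → IsoCl 𝓐) : deltaT f f = 1 := if_pos rfl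

lemma deltaT_ne {f x : ZMod τ → IsoCl 𝓐} (h : x ≠ f) : deltaT f x = 0 := if_neg h

lemma mul_right_delta (u : (ZMod τ → IsoCl 𝓐) → ℂ) (h x : ZMod τ → IsoCl 𝓐) :
    mulLt 𝓔 Λ u (deltaT h) x = ∑ᶠ y, u y * (nH 𝓔 Λ y h x : ℂ) := by
  refine finsum_congr fun y => ?_
  rw [finsum_eq_single _ h]
  · rw [deltaT_self, mul_one]; rfl
  · intro g hg
    rw [deltaT_ne hg]; simp

lemma mul_left_delta (v : (ZMod τ → IsoCl 𝓐) → ℂ) (f x : ZMod τ → IsoCl 𝓐) :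
    mulLt 𝓔 Λ (deltaT f) v x = ∑ᶠ z, v z * (nH 𝓔 Λ f z x : ℂ) := by
  unfold mulLt
  rw [finsum_eq_single _ f]
  · refine finsum_congr fun y => ?_
    rw [deltaT_self, one_mul]; rfl
  · intro g hg
    simp [deltaT_ne hg]

lemma mul_delta (f g x : ZMod τ → IsoCl 𝓐) :
    mulLt 𝓔 Λ (deltaT f) (deltaT g) x = (nH 𝓔 Λ f g x : ℂ) := by
  rw [mul_left_delta, finsum_eq_single _ g]
  · rw [deltaT_self, one_mul]
  · intro z hz
    rw [deltaT_ne hz, zero_mul]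

lemma nH_assoc (ht : Odd τ) (hsh : ∀ (f : ZMod τ → 𝓐) (n : ℤ),
      Nonempty ((Λ.obj (mkZero f))⟦n⟧ ≅ Λ.obj (mkZero (fun j => f (j + n))))) (f g h x : ZMod τ → IsoCl 𝓐) :
    ∑ᶠ y, (nH 𝓔 Λ f g y : ℂ) * (nH 𝓔 Λ y h x : ℂ) = ∑ᶠ z, (nH 𝓔 Λ g h z : ℂ) * (nH 𝓔 Λ f z x : ℂ) := by
  have hne := aprime_ne 𝓔 Λ hsh
  let K : ℝ := aprimeR 𝓔 Λ x / (aprimeR 𝓔 Λ f * aprimeR 𝓔 Λ g * aprimeR 𝓔 Λ h)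
  have e1 : ∀ y, (nH 𝓔 Λ f g y : ℂ) * (nH 𝓔 Λ y h x : ℂ) =
      Complex.ofRealHom (hconstR f g y * hconstR y h x * K) := by
    intro y
    rw [← Complex.ofReal_mul]
    change ((_ : ℝ) : ℂ) = ((_ : ℝ) : ℂ)
    congr 1
    have := hne y
    have := hne f
    have := hne g
    have := hne h
    simp only [nH, K]
    field_simp
  have e2 : ∀ z, (nH 𝓔 Λ g h z : ℂ) * (nH 𝓔 Λ f z x : ℂ) =
      Complex.ofRealHom (hconstR g h z * hconstR f z x * K) := by
    intro z
    rw [← Complex.ofReal_mul]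
    change ((_ : ℝ) : ℂ) = ((_ : ℝ) : ℂ)
    congr 1
    have := hne z
    have := hne f
    have := hne g
    have := hne h
    simp only [nH, K]
    field_simp
  have s1 : (Function.support fun y => hconstR f g y * hconstR y h x).Finite :=
    (hconst_supp f g).subset fun y hy => left_ne_zero_of_mul hy
  have s2 : (Function.support fun z => hconstR g h z * hconstR f z x).Finite :=
    (hconst_supp g h).subset fun y hy => left_ne_zero_of_mul hy
  have s1' : (Function.support fun y => hconstR f g y * hconstR y h x * K).Finite :=
    s1.subset fun y hy => left_ne_zero_of_mul hy
  have s2' : (Function.support fun z => hconstR g h z * hconstR f z x * K).Finite :=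
    s2.subset fun y hy => left_ne_zero_of_mul hy
  rw [finsum_congr e1, finsum_congr e2, ← map_finsum _ s1', ← map_finsum _ s2', ← finsum_mul,
    ← finsum_mul, assoc_hconst ht]

end Final

theorem Lt_main
    (A : Type) [SmallCategory A] [Abelian A]
    [HasExt.{0} A]
    (hfinHom : ∀ X Y : A, Finite (X ⟶ Y))
    (hfinExt : ∀ X Y : A, Finite (Abelian.Ext X Y 1))
    (hered : ∀ X Y : A, Subsingleton (Abelian.Ext X Y 2))
    (t : ℕ) [NeZero t] (ht : Odd t)
    (E : Type*) [Category E] [HasShift E ℤ] (L : Ct A t ⥤ E)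
    [L.IsLocalization (HomologicalComplex.quasiIso A (pShape t))]
    (hshift : ∀ (f : ZMod t → A) (n : ℤ),
      Nonempty ((L.obj (mkZero f))⟦n⟧ ≅ L.obj (mkZero (fun j => f (j + n))))) :
    (∀ f g h : ZMod t → IsoCl A,
        mulLt E L (mulLt E L (deltaT f) (deltaT g)) (deltaT h)
          = mulLt E L (deltaT f) (mulLt E L (deltaT g) (deltaT h)))
    ∧ (∀ f : ZMod t → IsoCl A,
        mulLt E L (deltaT (fun _ => cl (0 : A))) (deltaT f) = deltaT f
        ∧ mulLt E L (deltaT f) (deltaT (fun _ => cl (0 : A))) = deltaT f) := by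
  classical
  have hz := aprime_zero E L hshift
  have hne := aprime_ne E L hshift
  refine ⟨fun f g h => ?_, fun f => ⟨?_, ?_⟩⟩
  · funext x
    rw [mul_right_delta, mul_left_delta]
    simp only [mul_delta]
    exact nH_assoc E L ht hshift f g h x
  · funext x
    rw [mul_delta]
    have := unit_left f x
    simp only [nH]
    rw [this, hz]
    by_cases hx : x = f
    · subst hx
      rw [deltaT_self]; simp [hne]
    · rw [deltaT_ne hx]; simp [hx]
  · funext x
    rw [mul_delta]
    have := unit_right f x
    simp only [nH]
    rw [this, hz]
    by_cases hx : x = f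
    · subst hx
      rw [deltaT_self]; simp [hne]
    · rw [deltaT_ne hx]; simp [hx]

theorem Lt_associative_unital
    (k : Type) [Field k] [Fintype k]
    (A : Type) [SmallCategory A] [Abelian A] [CategoryTheory.Linear k A]
    [HasExt.{0} A]
    (hfinHom : ∀ X Y : A, Finite (X ⟶ Y))
    (hfinExt : ∀ X Y : A, Finite (Abelian.Ext X Y 1))
    (hered : ∀ X Y : A, Subsingleton (Abelian.Ext X Y 2))
    (t : ℕ) [NeZero t] (ht : Odd t)
    (E : Type*) [Category E] [HasShift E ℤ] (L : Ct A t ⥤ E)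
    [L.IsLocalization (HomologicalComplex.quasiIso A (pShape t))]
    -- the shift of `E` is compatible with the degree shift of periodic complexes
    (hshift : ∀ (f : ZMod t → A) (n : ℤ),
      Nonempty ((L.obj (mkZero f))⟦n⟧ ≅ L.obj (mkZero (fun j => f (j + n))))) :
    -- associativity (a consequence of Green's formula)
    (∀ f g h : ZMod t → IsoCl A,
        mulLt E L (mulLt E L (deltaT f) (deltaT g)) (deltaT h)
          = mulLt E L (deltaT f) (mulLt E L (deltaT g) (deltaT h)))
    -- the class of the zero complex is a two-sided unit
    ∧ (∀ f : ZMod t → IsoCl A,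
        mulLt E L (deltaT (fun _ => cl (0 : A))) (deltaT f) = deltaT f
        ∧ mulLt E L (deltaT f) (deltaT (fun _ => cl (0 : A))) = deltaT f) := by
  exact Lt_main A hfinHom hfinExt hered t ht E L hshift

end GreenDH
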